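/- arXiv:2010.08616 — 4 statements merged into one kernel-verified Lean document; each statement's English description precedes it below -/
import Mathlib

section
/- Let G be a finite soluble group admitting an automorphism φ of prime order p coprime to |G|, and let m be a positive integer such that every element g ∈ C_G(φ) has a left Engel sink of cardinality at most m. Then the index of the second Fitting subgroup F₂(G) in G is bounded in terms of p and m; equivalently, there is a function f(p, m) such that G has a metanilpotent normal subgroup of index at most f(p, m). -/
/-- The Engel commutator step: `engelComm x g = [x, g] = x⁻¹ g⁻¹ x g`. -/
def engelComm {G : Type*} [Group G] (x g : G) : G := x⁻¹ * g⁻¹ * x * g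

/-- `E` is a left Engel sink of `g`. -/
def IsLeftEngelSink {G : Type*} [Group G] (g : G) (E : Set G) : Prop :=
  ∀ x : G, ∃ l₀ : ℕ, ∀ l ≥ l₀, (fun y => engelComm y g)^[l] x ∈ E

/-! ### Linear part: commuting coprime operators on a finite abelian group -/

section Linear

variable {V : Type*} [AddCommGroup V] [Finite V]
set_option linter.unusedSectionVars false

/-- Coprime operators: a commutator `u v - v` fixed by `u` is zero. -/
lemma coprime_fix {u : AddMonoid.End V} {n : ℕ} (hu : u ^ n = 1) (hn : n.Coprime (Nat.card V))
    {v : V} (h : u (u v - v) = u v - v) : u v = v := by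
  have key : ∀ i : ℕ, (u ^ i) v = v + i • (u v - v) := by
    intro i
    induction i with
    | zero => simp
    | succ i ih =>
      rw [pow_succ']
      change u ((u ^ i) v) = _
      rw [ih, map_add, map_nsmul, h]
      rw [add_smul, one_smul]; abel
  have h1 := key n
  rw [hu] at h1
  have h2 : n • (u v - v) = 0 := by
    simpa using h1
  have h3 : (Nat.card V) • (u v - v) = 0 := by
    exact card_nsmul_eq_zero'
  have h4 : addOrderOf (u v - v) ∣ 1 := by
    rw [← hn]
    exact Nat.dvd_gcd (addOrderOf_dvd_of_nsmul_eq_zero h2) (addOrderOf_dvd_of_nsmul_eq_zero h3)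
  have h5 : u v - v = 0 := by
    rw [← AddMonoid.addOrderOf_eq_one_iff]; exact Nat.dvd_one.mp h4
  exact sub_eq_zero.mp h5

/-- `u - 1` is surjective on its own range. -/
lemma coprime_surj {u : AddMonoid.End V} {n : ℕ} (hu : u ^ n = 1) (hn : n.Coprime (Nat.card V))
    {w : V} (hw : w ∈ Set.range (u - 1 : AddMonoid.End V)) : ∃ w' ∈ Set.range (u - 1 : AddMonoid.End V), (u - 1 : AddMonoid.End V) w' = w := by
  have hmaps : Set.MapsTo (u - 1 : AddMonoid.End V) (Set.range (u - 1 : AddMonoid.End V)) (Set.range (u - 1 : AddMonoid.End V)) :=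
    fun x _ => Set.mem_range_self x
  have hinj : Set.InjOn (u - 1 : AddMonoid.End V) (Set.range (u - 1 : AddMonoid.End V)) := by
    rintro _ ⟨x, rfl⟩ _ ⟨y, rfl⟩ hxy
    have : (u - 1 : AddMonoid.End V) ((u - 1 : AddMonoid.End V) (x - y)) = 0 := by
      rw [map_sub, map_sub, hxy, sub_self]
    have h2 : u (x - y) = x - y := by
      apply coprime_fix hu hn
      have h3 : (u - 1 : AddMonoid.End V) (x - y) = u (x - y) - (x - y) := rfl
      rw [h3] at this
      exact sub_eq_zero.mp this
    have h3 : (u - 1 : AddMonoid.End V) (x - y) = 0 := by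
      change u (x - y) - (x - y) = 0
      rw [h2, sub_self]
    rw [map_sub] at h3
    exact sub_eq_zero.mp h3
  have hs : Set.SurjOn (u - 1 : AddMonoid.End V) (Set.range (u - 1 : AddMonoid.End V)) (Set.range (u - 1 : AddMonoid.End V)) :=
    (((Set.toFinite _).injOn_iff_bijOn_of_mapsTo hmaps).mp hinj).surjOn
  exact hs hw

lemma coprime_surj_pow {u : AddMonoid.End V} {n : ℕ} (hu : u ^ n = 1)
    (hn : n.Coprime (Nat.card V)) (l : ℕ)
    {w : V} (hw : w ∈ Set.range (u - 1 : AddMonoid.End V)) : ∃ w' ∈ Set.range (u - 1 : AddMonoid.End V), ((u - 1 : AddMonoid.End V) ^ l) w' = w := by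
  induction l generalizing w with
  | zero => exact ⟨w, hw, rfl⟩
  | succ l ih =>
    obtain ⟨w1, h1, rfl⟩ := coprime_surj hu hn hw
    obtain ⟨w2, h2, rfl⟩ := ih h1
    exact ⟨w2, h2, by rw [pow_succ']; rfl⟩

/-- Lemma A. -/
lemma card_le_factorial_of_ranges {A : Type*} [Group A] [Finite A] (hc : ∀ a b : A, a * b = b * a)
    (ρ : A →* AddMonoid.End V) (hρ : Function.Injective ρ)
    (hcop : (Nat.card A).Coprime (Nat.card V)) (m : ℕ)
    (hm : ∀ a, (Set.range (ρ a - 1 : AddMonoid.End V)).ncard ≤ m) : Nat.card A ≤ m.factorial := by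
  obtain ⟨g, hg⟩ := Finite.exists_max (fun a : A => (Set.range (ρ a - 1 : AddMonoid.End V)).ncard)
  have hpow : ∀ a : A, (ρ a) ^ (Nat.card A) = 1 := by
    intro a
    rw [← map_pow, pow_card_eq_one', map_one]
  have hmul : ∀ a b : A, ∀ v, ρ (a * b) v = ρ a (ρ b v) := by
    intro a b v; rw [map_mul]; rfl
  have hsub : ∀ a : A, ∀ v, (ρ a - 1 : AddMonoid.End V) v = ρ a v - v := fun a v => rfl
  set W := Set.range (ρ g - 1 : AddMonoid.End V) with hW
  have hinv : ∀ a : A, ∀ w ∈ W, ρ a w ∈ W := by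
    rintro a _ ⟨v, rfl⟩
    refine ⟨ρ a v, ?_⟩
    rw [hsub, hsub, map_sub, ← hmul, ← hmul, hc]
  let act : A →* Equiv.Perm W :=
    { toFun := fun a =>
        { toFun := fun w => ⟨ρ a w, hinv a w w.2⟩
          invFun := fun w => ⟨ρ a⁻¹ w, hinv _ w w.2⟩
          left_inv := fun w => by
            apply Subtype.ext
            simp only
            rw [← hmul]; simp
          right_inv := fun w => by
            apply Subtype.ext
            simp only
            rw [← hmul]; simp }
      map_one' := by ext w; simp
      map_mul' := fun a b => by
        ext w
        simp }
  have hinj : Function.Injective act := by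
    rw [injective_iff_map_eq_one]
    intro h hh
    have htriv : ∀ w ∈ W, ρ h w = w := by
      intro w hw
      have := congrArg (fun σ : Equiv.Perm W => ((σ ⟨w, hw⟩ : W) : V)) hh
      simpa [act] using this
    by_contra hne
    have hex : ∃ v, ρ h v ≠ v := by
      by_contra hcon
      push Not at hcon
      apply hne
      apply hρ
      rw [map_one]
      ext v
      exact hcon v
    obtain ⟨v, hv⟩ := hex
    -- split v = w + u
    obtain ⟨w, hw, hwv⟩ := coprime_surj (hpow g) hcop (w := (ρ g - 1 : AddMonoid.End V) v) (Set.mem_range_self v)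
    set u := v - w with hu
    have hgu : ρ g u = u := by
      have : (ρ g - 1 : AddMonoid.End V) u = 0 := by rw [hu, map_sub, hwv, sub_self]
      rw [hsub] at this
      exact sub_eq_zero.mp this
    have hhu : ρ h u ≠ u := by
      intro h1
      apply hv
      have : v = u + w := by rw [hu]; abel
      rw [this, map_add, h1, htriv w hw]
    have hWsub : W ⊆ Set.range (ρ (g * h) - 1 : AddMonoid.End V) := by
      intro x hx
      obtain ⟨y, hy, rfl⟩ := coprime_surj (hpow g) hcop hx
      refine ⟨y, ?_⟩
      rw [hsub, hsub, hmul, htriv y hy]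
    have hnew : ρ h u - u ∈ Set.range (ρ (g * h) - 1 : AddMonoid.End V) := by
      refine ⟨u, ?_⟩
      rw [hsub, hc, hmul, hgu]
    have hnot : ρ h u - u ∉ W := by
      rintro ⟨x, hx⟩
      rw [hsub] at hx
      have hfix : ρ g (ρ g x - x) = ρ g x - x := by
        rw [hx, map_sub, ← hmul, hc, hmul, hgu]
      have := coprime_fix (hpow g) hcop hfix
      rw [this, sub_self] at hx
      exact hhu (sub_eq_zero.mp hx.symm)
    have hlt : W.ncard < (Set.range (ρ (g * h) - 1 : AddMonoid.End V)).ncard := by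
      apply Set.ncard_lt_ncard _ (Set.toFinite _)
      refine ⟨hWsub, fun h => hnot (h hnew)⟩
    exact absurd (hg (g * h)) (not_le.mpr hlt)
  calc Nat.card A ≤ Nat.card (Equiv.Perm W) := Nat.card_le_card_of_injective _ hinj
    _ = (Nat.card W).factorial := by rw [Nat.card_perm]
    _ ≤ m.factorial := Nat.factorial_le (hm g)

/-- Lemma B: the elimination argument. -/
lemma range_pow_le {A : Type*} [Group A] [Finite A] (hc : ∀ a b : A, a * b = b * a)
    (ρ : A →* AddMonoid.End V) (σ : A →* A) (Φ : AddMonoid.End V) (p k : ℕ) (hp : p.Prime)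
    (hσp : ∀ a, σ^[p] a = a)
    (hcomp : ∀ a, Φ * ρ a = ρ (σ a) * Φ) (hfix : ∀ a, σ a = a → a = 1)
    (hΦ : Φ ^ p = 1) (hk : {v : V | Φ v = v}.ncard ≤ k) (b : A) (j : ℕ) (hj : j < p) :
    ∃ c : ℕ → AddMonoid.End V, (∀ i a, Commute (c i) (ρ a)) ∧ (∀ i, 1 ≤ i → i ≤ j → c i = 0) ∧
      c 0 = (1 - ρ b) ^ j ∧
      (Set.range (∑ i ∈ Finset.range p, c i * Φ ^ i : AddMonoid.End V)).ncard ≤ k ^ (2 ^ j) := by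
  have hcomm : ∀ a b, Commute (ρ a) (ρ b) := by
    intro a b
    change ρ a * ρ b = ρ b * ρ a
    rw [← map_mul, ← map_mul, hc]
  have hpow : ∀ i a, Φ ^ i * ρ a = ρ (σ^[i] a) * Φ ^ i := by
    intro i
    induction i with
    | zero => intro a; simp
    | succ i ih =>
      intro a
      rw [pow_succ, mul_assoc, hcomp, ← mul_assoc, ih, Function.iterate_succ_apply, mul_assoc]
  induction j with
  | zero =>
    refine ⟨fun _ => 1, fun i a => Commute.one_left _, fun i h1 h2 => by omega, by simp, ?_⟩
    simp only [one_mul, pow_zero, pow_one]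
    refine le_trans (Set.ncard_le_ncard ?_ (Set.toFinite _)) hk
    rintro _ ⟨v, rfl⟩
    change Φ ((∑ i ∈ Finset.range p, Φ ^ i : AddMonoid.End V) v) = _
    have : Φ * (∑ i ∈ Finset.range p, Φ ^ i) = ∑ i ∈ Finset.range p, Φ ^ i := by
      have h1 := Finset.sum_range_succ (fun i => Φ ^ i) p
      have h2 := Finset.sum_range_succ' (fun i => Φ ^ i) p
      rw [h1, hΦ, pow_zero] at h2
      have h3 := add_right_cancel h2
      rw [Finset.mul_sum, h3]
      apply Finset.sum_congr rfl
      intro i _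
      rw [pow_succ']
    conv_rhs => rw [← this]
    rfl
  | succ j ih =>
    obtain ⟨c, h1, h2, h3, h4⟩ := ih (by omega)
    -- y with σ^l y = y b, l = j+1
    have hiter : ∀ n, ∀ a b : A, σ^[n] (a * b) = σ^[n] a * σ^[n] b := fun n a b => by
      exact iterate_map_mul σ n a b
    have hy : ∃ y : A, σ^[j+1] y = y * b := by
      have hinj : Function.Injective (fun y : A => y⁻¹ * σ^[j+1] y) := by
        intro y z hyz
        have hyz : y⁻¹ * σ^[j+1] y = z⁻¹ * σ^[j+1] z := hyz
        have e : σ^[j+1] (y * z⁻¹) = y * z⁻¹ := by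
          rw [hiter, iterate_map_inv]
          have : σ^[j+1] y = y * (z⁻¹ * σ^[j+1] z) := by rw [← hyz]; group
          rw [this]; group
        have hcop : Nat.Coprime p (j+1) := by
          exact (Nat.coprime_of_lt_prime (by omega) hj hp)
        have hf : Function.IsPeriodicPt σ 1 (y * z⁻¹) := by
          have := Function.IsPeriodicPt.gcd (f := σ) (x := y * z⁻¹) (m := p) (n := j+1) (hσp _) e
          rwa [hcop] at this
        have := hfix _ hf
        exact mul_inv_eq_one.mp this
      obtain ⟨y, hy⟩ := (Finite.injective_iff_surjective.mp hinj) b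
      exact ⟨y, by rw [← hy]; group⟩
    obtain ⟨y, hy⟩ := hy
    refine ⟨fun i => c i * (ρ (y⁻¹ * σ^[i] y) - ρ b), ?_, ?_, ?_, ?_⟩
    · intro i a
      exact (h1 i a).mul_left ((hcomm _ _).sub_left (hcomm _ _))
    · intro i hi1 hi2
      beta_reduce
      rcases Nat.lt_or_ge i (j+1) with h | h
      · rw [h2 i hi1 (by omega), zero_mul]
      · have : i = j + 1 := by omega
        subst this
        rw [hy]; simp
    · simp [h3, pow_succ]
    · set T := (∑ i ∈ Finset.range p, c i * Φ ^ i : AddMonoid.End V) with hT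
      have hTT : (∑ i ∈ Finset.range p, (c i * (ρ (y⁻¹ * σ^[i] y) - ρ b)) * Φ ^ i
          : AddMonoid.End V) = ρ y⁻¹ * T * ρ y - ρ b * T := by
        rw [hT, Finset.mul_sum, Finset.mul_sum, Finset.sum_mul, ← Finset.sum_sub_distrib]
        apply Finset.sum_congr rfl
        intro i _
        rw [mul_assoc (ρ y⁻¹), mul_assoc (c i) (Φ ^ i), hpow, mul_sub, sub_mul, map_mul]
        congr 1
        · rw [← mul_assoc, ← mul_assoc, ← mul_assoc, (h1 i _).eq]
        · rw [← mul_assoc, (h1 i _).eq]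
      rw [hTT]
      have hsub : Set.range (ρ y⁻¹ * T * ρ y - ρ b * T) ⊆
          Set.image (fun q : V × V => ρ y⁻¹ q.1 - ρ b q.2) (Set.range T ×ˢ Set.range T) := by
        rintro _ ⟨v, rfl⟩
        exact ⟨(T (ρ y v), T v), ⟨⟨_, rfl⟩, ⟨_, rfl⟩⟩, rfl⟩
      calc _ ≤ _ := Set.ncard_le_ncard hsub (Set.toFinite _)
        _ ≤ (Set.range T ×ˢ Set.range T).ncard := Set.ncard_image_le (Set.toFinite _)
        _ = (Set.range T).ncard * (Set.range T).ncard := Set.ncard_prod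
        _ ≤ k ^ 2 ^ j * k ^ 2 ^ j := Nat.mul_le_mul h4 h4
        _ = k ^ 2 ^ (j + 1) := by rw [← pow_add]; congr 1; ring

lemma range_le {A : Type*} [Group A] [Finite A] (hc : ∀ a b : A, a * b = b * a)
    (ρ : A →* AddMonoid.End V) (σ : A →* A) (Φ : AddMonoid.End V) (p k : ℕ) (hp : p.Prime)
    (hσp : ∀ a, σ^[p] a = a)
    (hcomp : ∀ a, Φ * ρ a = ρ (σ a) * Φ) (hfix : ∀ a, σ a = a → a = 1)
    (hcop : (Nat.card A).Coprime (Nat.card V))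
    (hΦ : Φ ^ p = 1) (hk : {v : V | Φ v = v}.ncard ≤ k) (b : A) :
    (Set.range (ρ b - 1 : AddMonoid.End V)).ncard ≤ k ^ (2 ^ (p - 1)) := by
  obtain ⟨c, h1, h2, h3, h4⟩ := range_pow_le hc ρ σ Φ p k hp hσp hcomp hfix hΦ hk b (p - 1)
    (Nat.sub_lt hp.pos one_pos)
  have hsum : (∑ i ∈ Finset.range p, c i * Φ ^ i : AddMonoid.End V) = (1 - ρ b : AddMonoid.End V) ^ (p - 1) := by
    rw [Finset.sum_eq_single 0]
    · rw [h3]; simp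
    · intro i hi hi0
      rw [h2 i (Nat.one_le_iff_ne_zero.mpr hi0) (by have := Finset.mem_range.mp hi; omega), zero_mul]
    · intro h; exact absurd (Finset.mem_range.mpr hp.pos) h
  rw [hsum] at h4
  refine le_trans (Set.ncard_le_ncard ?_ (Set.toFinite _)) h4
  intro w hw
  have hpow : (ρ b) ^ (Nat.card A) = 1 := by
    rw [← map_pow, pow_card_eq_one', map_one]
  obtain ⟨w', _, rfl⟩ := coprime_surj_pow hpow hcop (p - 1) hw
  have : (1 - ρ b : AddMonoid.End V) ^ (p - 1) = (-1) ^ (p-1) * (ρ b - 1 : AddMonoid.End V) ^ (p - 1) := by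
    rw [← neg_sub (ρ b) 1, neg_pow]
  rcases neg_one_pow_eq_or (AddMonoid.End V) (p-1) with h | h
  · rw [h, one_mul] at this; exact ⟨w', by rw [this]⟩
  · rw [h] at this
    refine ⟨-w', ?_⟩
    rw [this, map_neg, neg_one_mul]
    exact neg_neg (((ρ b - 1 : AddMonoid.End V) ^ (p - 1)) w')

end Linear

/-! ### Nilpotent groups all of whose invariant abelian subgroups are small -/

section Ramsey

open scoped commutatorElement

lemma exists_max_sub {T : Type*} [Group T] [Finite T] (P : Subgroup T → Prop)
    (h : ∃ Y, P Y) : ∃ X, P X ∧ ∀ Y, P Y → X ≤ Y → Y ≤ X := by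
  obtain ⟨X, hX, hm⟩ := Set.Finite.exists_maximal (s := {Y : Subgroup T | P Y})
    (Set.toFinite _) h
  exact ⟨X, hX, fun Y hY hle => hm hY hle⟩

lemma card_le_of_fibers {T α : Type*} [Group T] [Finite T] [Finite α] (D : Subgroup T)
    (H : Subgroup T) (f : T → α)
    (hf : ∀ a ∈ D, ∀ b ∈ D, f a = f b → a⁻¹ * b ∈ H) : Nat.card D ≤ Nat.card H * Nat.card α := by
  classical
  have hrep : ∀ y : α, ∃ t : T, ∀ d ∈ D, f d = y → t⁻¹ * d ∈ H := by
    intro y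
    by_cases h : ∃ d ∈ D, f d = y
    · obtain ⟨d, hd, rfl⟩ := h
      exact ⟨d, fun e he hfe => hf d hd e he hfe.symm⟩
    · push Not at h
      exact ⟨1, fun d hd hfd => absurd hfd (h d hd)⟩
  choose r hr using hrep
  let g : D → H × α := fun d => (⟨(r (f d))⁻¹ * d, hr _ d d.2 rfl⟩, f d)
  have hg : Function.Injective g := by
    intro d e hde
    simp only [g, Prod.mk.injEq, Subtype.mk.injEq] at hde
    obtain ⟨h1, h2⟩ := hde
    rw [h2] at h1
    exact Subtype.ext (mul_left_cancel h1)
  calc Nat.card D ≤ Nat.card (H × α) := Nat.card_le_card_of_injective g hg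
    _ = _ := Nat.card_prod _ _

lemma exists_preimage_of_invariant {T : Type*} [Group T] {σ : T →* T} {n : ℕ} (hn : 0 < n)
    (hσ : ∀ x, σ^[n] x = x) {H : Subgroup T} (hH : ∀ x ∈ H, σ x ∈ H) {x : T} (hx : x ∈ H) :
    ∃ y ∈ H, σ y = x := by
  have hit : ∀ i, σ^[i] x ∈ H := by
    intro i
    induction i with
    | zero => exact hx
    | succ i ih => rw [Function.iterate_succ_apply']; exact hH _ ih
  refine ⟨σ^[n-1] x, hit _, ?_⟩
  rw [← Function.iterate_succ_apply' σ, Nat.succ_eq_add_one, Nat.sub_add_cancel hn, hσ]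

lemma centralizer_invariant {T : Type*} [Group T] {σ : T →* T} {n : ℕ} (hn : 0 < n)
    (hσ : ∀ x, σ^[n] x = x) {H : Subgroup T} (hH : ∀ x ∈ H, σ x ∈ H) :
    ∀ x ∈ Subgroup.centralizer (H : Set T), σ x ∈ Subgroup.centralizer (H : Set T) := by
  intro x hx
  rw [Subgroup.mem_centralizer_iff] at hx ⊢
  intro h hh
  obtain ⟨y, hy, rfl⟩ := exists_preimage_of_invariant hn hσ hH hh
  rw [← map_mul, hx y hy, map_mul]

/-- elements all of whose iterates commute with all iterates of `x` -/
def crossSub {T : Type*} [Group T] (σ : T →* T) (x : T) : Subgroup T where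
  carrier := {e | ∀ a b : ℕ, σ^[a] x * σ^[b] e = σ^[b] e * σ^[a] x}
  one_mem' := by intro a b; rw [iterate_map_one]; simp
  mul_mem' := by
    intro e f he hf a b
    rw [iterate_map_mul, ← mul_assoc, he a b, mul_assoc, hf a b, mul_assoc]
  inv_mem' := by
    intro e he a b
    rw [iterate_map_inv]
    exact (Commute.inv_right (he a b : Commute _ _))

def ramE (n k : ℕ) : ℕ := (k ^ (n * n) + 1) * k * (k ^ (n * n)) ^ (k ^ (n * n) + 1)

def ramT (n k : ℕ) : ℕ := ramE n k * k ^ k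

lemma comm_of_eq {T : Type*} [Group T] {x y z : T} (h : ⁅x, y⁆ = ⁅x, z⁆) :
    x * (y⁻¹ * z) = (y⁻¹ * z) * x := by
  rw [commutatorElement_def, commutatorElement_def] at h
  have h1 : x * y * x⁻¹ = x * z * x⁻¹ * z⁻¹ * y := by rw [← h]; group
  have h2 : x * (y⁻¹ * z) * x⁻¹ = y⁻¹ * z := by
    calc x * (y⁻¹ * z) * x⁻¹ = (x * y * x⁻¹)⁻¹ * (x * z * x⁻¹) := by group
      _ = _ := by rw [h1]; group
  calc x * (y⁻¹ * z) = x * (y⁻¹ * z) * x⁻¹ * x := by group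
    _ = _ := by rw [h2]

lemma commutator_mul_of_cross {T : Type*} [Group T] {x x' y y' : T} (h1 : Commute x x')
    (h2 : Commute x y') (h3 : Commute y x') (h4 : Commute y y') :
    ⁅x * x', y * y'⁆ = ⁅x, y⁆ * ⁅x', y'⁆ := by
  rw [commutatorElement_def, commutatorElement_def, commutatorElement_def]
  have e1 : x * x' * (y * y') = (x * y) * (x' * y') := by
    rw [mul_assoc, ← mul_assoc x', ← h3.eq]; group
  have e2 : (x * x')⁻¹ * (y * y')⁻¹ = (x⁻¹ * y⁻¹) * (x'⁻¹ * y'⁻¹) := by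
    have : (y * y') * (x * x') = (y' * x') * (y * x) := by
      calc (y * y') * (x * x') = y * (y' * x) * x' := by group
        _ = y * (x * y') * x' := by rw [h2.eq]
        _ = (y * x) * (y' * x') := by group
        _ = (y' * x') * (y * x) :=
          (((h4.mul_right h3)).mul_left (h2.mul_right h1)).eq
    rw [← mul_inv_rev, this]; group
  have e3 : (x' * y') * (x⁻¹ * y⁻¹) = (x⁻¹ * y⁻¹) * (x' * y') :=
    (((h1.mul_right h2).inv_left).mul_left ((h3.mul_right h4).inv_left)).symm.eq
  calc x * x' * (y * y') * (x * x')⁻¹ * (y * y')⁻¹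
      = (x * x' * (y * y')) * ((x * x')⁻¹ * (y * y')⁻¹) := by group
    _ = (x * y) * ((x' * y') * (x⁻¹ * y⁻¹)) * (x'⁻¹ * y'⁻¹) := by rw [e1, e2]; group
    _ = _ := by rw [e3]; group

lemma ramsey_class_two {T : Type*} [Group T] [Finite T] (σ : T →* T) (n k : ℕ) (hn : 0 < n)
    (hσ : ∀ x, σ^[n] x = x) (X : Subgroup T) (hX : ∀ a b : T, ⁅a, b⁆ ∈ X)
    (hXk : Nat.card X ≤ k)
    (hab : ∀ Y : Subgroup T, (∀ y ∈ Y, σ y ∈ Y) → (∀ a ∈ Y, ∀ b ∈ Y, a * b = b * a) →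
      Nat.card Y ≤ k) : Nat.card T ≤ ramT n k := by
  classical
  have hk : 0 < k := lt_of_lt_of_le Nat.card_pos hXk
  obtain ⟨W, hW⟩ := exists_max_sub (T := T)
    (fun Y => (∀ y ∈ Y, σ y ∈ Y) ∧ (∀ a ∈ Y, ∀ b ∈ Y, a * b = b * a))
    ⟨⊥, by simp, by simp⟩
  obtain ⟨⟨hW1, hW2⟩, hWmax⟩ := hW
  have hWk : Nat.card W ≤ k := hab W hW1 hW2
  have hWW : ∀ i, ∀ w ∈ W, σ^[i] w ∈ W := by
    intro i
    induction i with
    | zero => exact fun w hw => hw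
    | succ i ih => intro w hw; rw [Function.iterate_succ_apply']; exact hW1 _ (ih w hw)
  set E := Subgroup.centralizer (W : Set T) with hE
  have hEinv := centralizer_invariant hn hσ hW1
  have hEE : ∀ i, ∀ e ∈ E, σ^[i] e ∈ E := by
    intro i
    induction i with
    | zero => exact fun w hw => hw
    | succ i ih => intro w hw; rw [Function.iterate_succ_apply']; exact hEinv _ (ih w hw)
  -- elements of E with commuting iterates are in W
  have hmemW : ∀ u ∈ E, (∀ a b : Fin n, ⁅σ^[a] u, σ^[b] u⁆ = 1) → u ∈ W := by
    intro u hu hc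
    have hc' : ∀ a b : ℕ, σ^[a] u * σ^[b] u = σ^[b] u * σ^[a] u := by
      intro a b
      have := hc ⟨a % n, Nat.mod_lt _ hn⟩ ⟨b % n, Nat.mod_lt _ hn⟩
      have hper : Function.IsPeriodicPt σ n u := hσ u
      simp only [hper.iterate_mod_apply] at this
      exact commutatorElement_eq_one_iff_mul_comm.mp this
    set B : Set T := (W : Set T) ∪ Set.range (fun a : ℕ => σ^[a] u) with hB
    have hBc : ∀ x ∈ B, ∀ y ∈ B, x * y = y * x := by
      rintro x (hx | ⟨a, rfl⟩) y (hy | ⟨b, rfl⟩)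
      · exact hW2 x hx y hy
      · exact (Subgroup.mem_centralizer_iff.mp (hEE b u hu) x hx)
      · exact (Subgroup.mem_centralizer_iff.mp (hEE a u hu) y hy).symm
      · exact hc' a b
    have h1 : Subgroup.closure B ≤ Subgroup.centralizer B := by
      rw [Subgroup.closure_le]
      intro x hx
      rw [SetLike.mem_coe, Subgroup.mem_centralizer_iff]
      exact fun y hy => hBc y hy x hx
    have h2 : Subgroup.closure B ≤ Subgroup.centralizer (Subgroup.closure B : Set T) := by
      rw [Subgroup.closure_le]
      intro x hx
      rw [SetLike.mem_coe, Subgroup.mem_centralizer_iff]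
      intro y hy
      exact (Subgroup.mem_centralizer_iff.mp (h1 hy) x hx).symm
    have hle : W ≤ Subgroup.closure B := fun x hx => Subgroup.subset_closure (Or.inl hx)
    refine hWmax _ ⟨?_, ?_⟩ hle (Subgroup.subset_closure (Or.inr ⟨0, rfl⟩))
    · have : Subgroup.closure B ≤ (Subgroup.closure B).comap σ := by
        rw [Subgroup.closure_le]
        rintro x (hx | ⟨a, rfl⟩)
        · exact Subgroup.subset_closure (Or.inl (hW1 x hx))
        · exact Subgroup.subset_closure (Or.inr ⟨a + 1, Function.iterate_succ_apply' σ a u⟩)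
      exact fun y hy => this hy
    · intro a ha b hb
      exact (Subgroup.mem_centralizer_iff.mp (h2 hb) a ha)
  -- bound on T in terms of E
  have hTE : Nat.card T ≤ Nat.card E * k ^ k := by
    have := card_le_of_fibers (⊤ : Subgroup T) E
      (fun t => (fun w : W => (⟨⁅(w : T), t⁆, hX _ _⟩ : X))) (by
        intro a _ b _ hab
        rw [hE, Subgroup.mem_centralizer_iff]
        intro w hw
        have := congrFun hab ⟨w, hw⟩
        exact comm_of_eq (Subtype.ext_iff.mp this))
    rw [Subgroup.card_top] at this
    refine this.trans (Nat.mul_le_mul_left _ ?_)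
    rw [Nat.card_fun]
    calc Nat.card X ^ Nat.card W ≤ k ^ Nat.card W := Nat.pow_le_pow_left hXk _
      _ ≤ k ^ k := Nat.pow_le_pow_right hk hWk
  refine hTE.trans (Nat.mul_le_mul_right _ ?_)
  by_contra hbig
  push Not at hbig
  set M := k ^ (n * n) with hM
  have hMpos : 0 < M := Nat.pow_pos hk
  have hMcard : Nat.card (Fin n × Fin n → X) ≤ M := by
    rw [Nat.card_fun, Nat.card_prod, Nat.card_fin]
    exact Nat.pow_le_pow_left hXk _
  have hbig' : (M + 1) * k * M ^ (M + 1) < Nat.card E := hbig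
  have claim : ∀ j, j ≤ M → ∃ P : ℕ → T, ∃ D : Subgroup T, D ≤ E ∧
      Nat.card E ≤ Nat.card D * M ^ (j + 1) ∧ (∀ s ≤ j, P s ∈ E) ∧
      (∀ s ≤ j, D ≤ crossSub σ (P s)) ∧
      (∀ s t, s < t → t ≤ j → (P s)⁻¹ * P t ∈ crossSub σ (P s) ∧ (P s)⁻¹ * P t ∉ W) := by
    intro j
    induction j with
    | zero =>
      intro _
      refine ⟨fun _ => 1, E, le_rfl, ?_, fun s _ => E.one_mem, ?_, ?_⟩
      · rw [zero_add, pow_one]; exact Nat.le_mul_of_pos_right _ hMpos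
      · intro s _ e _ a b
        rw [iterate_map_one]; simp
      · intro s t h1 h2; omega
    | succ j ih =>
      intro hj
      obtain ⟨P, D, hDE, hcard, hPE, hDP, hPP⟩ := ih (by omega)
      have hPP' : ∀ s ≤ j, (P s)⁻¹ * P j ∈ crossSub σ (P s) := by
        intro s hs
        rcases Nat.lt_or_ge s j with h | h
        · exact (hPP s j h le_rfl).1
        · have : s = j := by omega
          subst this
          rw [inv_mul_cancel]; exact Subgroup.one_mem _
      have hDbig : (j + 1) * k < Nat.card D := by
        by_contra hcon
        push Not at hcon
        have : Nat.card E ≤ (M + 1) * k * M ^ (M + 1) := by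
          refine hcard.trans (Nat.mul_le_mul (hcon.trans (Nat.mul_le_mul_right _ (by omega))) ?_)
          exact Nat.pow_le_pow_right hMpos (by omega)
        omega
      have hex : ∃ e ∈ D, ∀ s ≤ j, (P s)⁻¹ * (P j * e) ∉ W := by
        by_contra hcon
        push Not at hcon
        have hsub : (D : Set T) ⊆ Set.range (fun q : Fin (j+1) × W =>
            ((P q.1)⁻¹ * P j)⁻¹ * (q.2 : T)) := by
          intro e he
          obtain ⟨s, hs, hw⟩ := hcon e he
          refine ⟨(⟨s, by omega⟩, ⟨_, hw⟩), ?_⟩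
          simp only
          group
        have h1 : (D : Set T).ncard ≤ Nat.card (Fin (j+1) × W) := by
          refine (Set.ncard_le_ncard hsub (Set.toFinite _)).trans ?_
          rw [← Set.image_univ]
          exact (Set.ncard_image_le (Set.toFinite _)).trans (by rw [Set.ncard_univ])
        rw [Nat.card_prod, Nat.card_fin] at h1
        have h2 : (D : Set T).ncard = Nat.card D := rfl
        have h3 : (j + 1) * Nat.card W ≤ (j + 1) * k := Nat.mul_le_mul_left _ hWk
        omega
      obtain ⟨e, heD, heW⟩ := hex
      refine ⟨fun i => if i = j + 1 then P j * e else P i, D ⊓ crossSub σ (P j * e),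
        inf_le_left.trans hDE, ?_, ?_, ?_, ?_⟩
      · have := card_le_of_fibers D (D ⊓ crossSub σ (P j * e))
          (fun f => (fun q : Fin n × Fin n =>
            (⟨⁅σ^[q.1] (P j * e), σ^[q.2] f⁆, hX _ _⟩ : X))) (by
            intro a ha b hb hab
            refine ⟨D.mul_mem (D.inv_mem ha) hb, ?_⟩
            intro c d
            have := Subtype.ext_iff.mp
              (congrFun hab (⟨c % n, Nat.mod_lt _ hn⟩, ⟨d % n, Nat.mod_lt _ hn⟩))
            have hper : ∀ u, Function.IsPeriodicPt σ n u := hσ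
            simp only [(hper _).iterate_mod_apply] at this
            rw [iterate_map_mul σ d, iterate_map_inv]
            exact comm_of_eq this)
        calc Nat.card E ≤ Nat.card D * M ^ (j + 1) := hcard
          _ ≤ (Nat.card (D ⊓ crossSub σ (P j * e) : Subgroup T) * M) * M ^ (j+1) :=
            Nat.mul_le_mul_right _ (this.trans (Nat.mul_le_mul_left _ hMcard))
          _ = _ := by ring
      · intro s hs
        by_cases h : s = j + 1
        · simp only [h, if_true]
          exact E.mul_mem (hPE j le_rfl) (hDE heD)
        · simp only [h, if_false]
          exact hPE s (by omega)
      · intro s hs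
        by_cases h : s = j + 1
        · simp only [h, if_true]
          exact inf_le_right
        · simp only [h, if_false]
          exact inf_le_left.trans (hDP s (by omega))
      · intro s t hst ht
        have hs : s ≠ j + 1 := by omega
        by_cases h : t = j + 1
        · simp only [h, if_true, hs, if_false]
          refine ⟨?_, heW s (by omega)⟩
          rw [← mul_assoc]
          exact Subgroup.mul_mem _ (hPP' s (by omega)) (hDP s (by omega) heD)
        · simp only [h, if_false, hs]
          exact hPP s t hst (by omega)
  obtain ⟨P, D, -, -, hPE, -, hPP⟩ := claim M le_rfl
  -- pigeonhole
  obtain ⟨s, t, hst, heq⟩ : ∃ s t : Fin (M + 1), s < t ∧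
      (fun q : Fin n × Fin n => (⟨⁅σ^[q.1] (P s), σ^[q.2] (P s)⁆, hX _ _⟩ : X)) =
      (fun q : Fin n × Fin n => (⟨⁅σ^[q.1] (P t), σ^[q.2] (P t)⁆, hX _ _⟩ : X)) := by
    have hninj : ¬ Function.Injective (fun s : Fin (M+1) => (fun q : Fin n × Fin n =>
        (⟨⁅σ^[q.1] (P s), σ^[q.2] (P s)⁆, hX _ _⟩ : X))) := by
      intro hinj
      have := Nat.card_le_card_of_injective _ hinj
      rw [Nat.card_fin] at this
      omega
    rw [Function.not_injective_iff] at hninj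
    obtain ⟨a, b, hab, hne⟩ := hninj
    rcases lt_or_gt_of_ne hne with h | h
    · exact ⟨a, b, h, hab⟩
    · exact ⟨b, a, h, hab.symm⟩
  have hs' : (s : ℕ) ≤ M := by omega
  have ht' : (t : ℕ) ≤ M := by omega
  obtain ⟨hcross, hnW⟩ := hPP s t hst ht'
  apply hnW
  apply hmemW _ (E.mul_mem (E.inv_mem (hPE s hs')) (hPE t ht'))
  intro a b
  have h1 := Subtype.ext_iff.mp (congrFun heq (a, b))
  simp only at h1
  generalize hu : (P s)⁻¹ * P t = u at *
  have hPt : P t = P s * u := by rw [← hu]; group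
  rw [hPt, iterate_map_mul, iterate_map_mul,
    commutator_mul_of_cross (hcross _ _) (hcross _ _) (hcross _ _) (hcross _ _)] at h1
  exact mul_eq_left.mp h1.symm

def ramS (n k : ℕ) : ℕ := k * (ramT n k) ^ (ramT n k)

lemma exists_central_mod {S : Type*} [Group S] [Group.IsNilpotent S] (E X : Subgroup S)
    [E.Normal] (h : ¬ E ≤ X) : ∃ e ∈ E, e ∉ X ∧ ∀ s : S, ⁅e, s⁆ ∈ X := by
  by_contra hcon
  push Not at hcon
  have key : ∀ i, ∃ e ∈ E, e ∉ X ∧ e ∈ (⊤ : Subgroup S).lowerCentralSeries i := by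
    intro i
    induction i with
    | zero =>
      obtain ⟨e, he, heX⟩ := Set.not_subset.mp h
      exact ⟨e, he, heX, Subgroup.mem_top _⟩
    | succ i ih =>
      obtain ⟨e, he, heX, hi⟩ := ih
      obtain ⟨s, hs⟩ := hcon e he heX
      refine ⟨⁅e, s⁆, ?_, hs, ?_⟩
      · rw [commutatorElement_def, mul_assoc, mul_assoc]
        refine E.mul_mem he ?_
        rw [← mul_assoc]
        exact Subgroup.Normal.conj_mem inferInstance _ (E.inv_mem he) s
      · rw [Subgroup.lowerCentralSeries_succ]
        exact Subgroup.subset_closure ⟨e, hi, s, Subgroup.mem_top _, rfl⟩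
  obtain ⟨c, hc⟩ := Subgroup.nilpotent_iff_lowerCentralSeries.mp (inferInstance : Group.IsNilpotent S)
  obtain ⟨e, _, heX, hi⟩ := key c
  rw [hc, Subgroup.mem_bot] at hi
  exact heX (hi ▸ X.one_mem)

lemma ramsey_nilpotent {S : Type*} [Group S] [Finite S] [Group.IsNilpotent S] (σ : S →* S)
    (n k : ℕ) (hn : 0 < n) (hσ : ∀ x, σ^[n] x = x)
    (hab : ∀ Y : Subgroup S, (∀ y ∈ Y, σ y ∈ Y) → (∀ a ∈ Y, ∀ b ∈ Y, a * b = b * a) →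
      Nat.card Y ≤ k) : Nat.card S ≤ ramS n k := by
  classical
  obtain ⟨X, ⟨hXn, hX1, hX2⟩, hXmax⟩ := exists_max_sub (T := S)
    (fun Y => Y.Normal ∧ (∀ y ∈ Y, σ y ∈ Y) ∧ (∀ a ∈ Y, ∀ b ∈ Y, a * b = b * a))
    ⟨⊥, inferInstance, by simp, by simp⟩
  have hXk := hab X hX1 hX2
  have hsurj : ∀ s : S, ∃ t, σ t = s := fun s => by
    obtain ⟨y, _, hy⟩ := exists_preimage_of_invariant (H := ⊤) hn hσ (by simp) (Subgroup.mem_top s)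
    exact ⟨y, hy⟩
  let Zq : Subgroup S := (Subgroup.center (S ⧸ X)).comap (QuotientGroup.mk' X)
  have hZq : ∀ t, t ∈ Zq ↔ ∀ s, ⁅t, s⁆ ∈ X := by
    intro t
    rw [Subgroup.mem_comap, Subgroup.mem_center_iff]
    constructor
    · intro h s
      rw [← QuotientGroup.eq_one_iff]
      have := h (QuotientGroup.mk' X s)
      change QuotientGroup.mk' X _ = 1
      rw [map_commutatorElement, commutatorElement_eq_one_iff_mul_comm]
      exact this.symm
    · intro h g
      obtain ⟨s, rfl⟩ := QuotientGroup.mk'_surjective X g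
      have h1 := (QuotientGroup.eq_one_iff _).mpr (h s)
      change QuotientGroup.mk' X _ = 1 at h1
      rw [map_commutatorElement, commutatorElement_eq_one_iff_mul_comm] at h1
      exact h1.symm
  let T : Subgroup S := Subgroup.centralizer (X : Set S) ⊓ Zq
  have hTn : T.Normal := by
    have : Zq.Normal := inferInstance
    infer_instance
  have hCX := centralizer_invariant hn hσ hX1
  have hT1 : ∀ t ∈ T, σ t ∈ T := by
    rintro t ⟨ht1, ht2⟩
    refine ⟨hCX t ht1, (hZq _).mpr ?_⟩
    intro s
    obtain ⟨s, rfl⟩ := hsurj s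
    rw [← map_commutatorElement]
    exact hX1 _ ((hZq t).mp ht2 s)
  have hXT : X ≤ T := by
    intro x hx
    refine ⟨Subgroup.mem_centralizer_iff.mpr fun y hy => hX2 y hy x hx, (hZq x).mpr fun s => ?_⟩
    rw [commutatorElement_def, mul_assoc, mul_assoc]
    refine X.mul_mem hx ?_
    rw [← mul_assoc]
    exact hXn.conj_mem _ (X.inv_mem hx) s
  have hCT : Subgroup.centralizer (T : Set S) ≤ X := by
    by_contra hcon
    obtain ⟨e, heC, heX, hes⟩ := exists_central_mod _ _ hcon
    have hCTX : Subgroup.centralizer (T : Set S) ≤ Subgroup.centralizer (X : Set S) :=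
      Subgroup.centralizer_le hXT
    have heT : e ∈ T := ⟨hCTX heC, (hZq e).mpr hes⟩
    apply heX
    refine hXmax (Subgroup.centralizer (T : Set S) ⊓ T) ⟨inferInstance, ?_, ?_⟩ ?_ ⟨heC, heT⟩
    · rintro y ⟨h1, h2⟩
      exact ⟨centralizer_invariant hn hσ hT1 y h1, hT1 y h2⟩
    · rintro a ⟨_, ha⟩ b ⟨hb, _⟩
      exact Subgroup.mem_centralizer_iff.mp hb a ha
    · intro x hx
      refine ⟨Subgroup.mem_centralizer_iff.mpr fun t ht => ?_, hXT hx⟩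
      exact (Subgroup.mem_centralizer_iff.mp ht.1 x hx).symm
  let σT : T →* T := (σ.comp T.subtype).codRestrict T (fun t => hT1 t t.2)
  have hσT : ∀ t : T, ((σT t : T) : S) = σ t := fun t => rfl
  have hσTi : ∀ i, ∀ t : T, ((σT^[i] t : T) : S) = σ^[i] t := by
    intro i
    induction i with
    | zero => intro t; rfl
    | succ i ih => intro t; rw [Function.iterate_succ_apply, Function.iterate_succ_apply, ih, hσT]
  have hTcard : Nat.card T ≤ ramT n k := by
    apply ramsey_class_two σT n k hn (fun t => Subtype.ext (by rw [hσTi, hσ]))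
      (X.subgroupOf T)
    · intro a b
      rw [Subgroup.mem_subgroupOf]
      exact (hZq a).mp a.2.2 b
    · rw [Nat.card_congr (Subgroup.subgroupOfEquivOfLe hXT).toEquiv]; exact hXk
    · intro Y hY1 hY2
      rw [Nat.card_congr (Y.equivMapOfInjective T.subtype T.subtype_injective).toEquiv]
      apply hab
      · rintro _ ⟨y, hy, rfl⟩
        exact ⟨σT y, hY1 y hy, rfl⟩
      · rintro _ ⟨a, ha, rfl⟩ _ ⟨b, hb, rfl⟩
        rw [← map_mul, hY2 a ha b hb, map_mul]
  have hfin := card_le_of_fibers (⊤ : Subgroup S) (Subgroup.centralizer (T : Set S))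
    (fun s => (fun t : T => (⟨s * t * s⁻¹, hTn.conj_mem _ t.2 s⟩ : T))) (by
      intro a _ b _ hab
      rw [Subgroup.mem_centralizer_iff]
      intro t ht
      have h1 : a * t * a⁻¹ = b * t * b⁻¹ := Subtype.ext_iff.mp (congrFun hab ⟨t, ht⟩)
      calc t * (a⁻¹ * b) = a⁻¹ * (a * t * a⁻¹) * b := by group
        _ = _ := by rw [h1]; group)
  rw [Subgroup.card_top, Nat.card_fun] at hfin
  have hT0 : 0 < Nat.card T := Nat.card_pos
  refine hfin.trans (Nat.mul_le_mul ?_ ?_)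
  · exact (Subgroup.card_le_of_le hCT).trans hXk
  · exact (Nat.pow_le_pow_left hTcard _).trans (Nat.pow_le_pow_right (by omega) hTcard)

end Ramsey

/-! ### Nilpotency criteria and maximal invariant nilpotent normal subgroups -/

section Nilp

open scoped commutatorElement

lemma three_subgroups {G : Type*} [Group G] (A B C N : Subgroup G) [N.Normal]
    (h1 : ⁅⁅B, C⁆, A⁆ ≤ N) (h2 : ⁅⁅C, A⁆, B⁆ ≤ N) : ⁅⁅A, B⁆, C⁆ ≤ N := by
  have key : ∀ D : Subgroup G, D ≤ N ↔ D.map (QuotientGroup.mk' N) = ⊥ := by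
    intro D
    rw [Subgroup.map_eq_bot_iff, QuotientGroup.ker_mk']
  rw [key, Subgroup.map_commutator, Subgroup.map_commutator] at *
  exact Subgroup.commutator_commutator_eq_bot_of_rotate h1 h2

lemma lcs_normal {G : Type*} [Group G] (N : Subgroup G) [hN : N.Normal] (i : ℕ) :
    (N.lowerCentralSeries i).Normal := by
  induction i with
  | zero => exact hN
  | succ i ih => rw [Subgroup.lowerCentralSeries_succ]; infer_instance

/-- Lemma P. -/
lemma nilpotent_of_commutator_le {G : Type*} [Group G] (N K : Subgroup G) [hN : N.Normal]
    [K.Normal] (hnil : Group.IsNilpotent N) (hNK : ⁅N, K⁆ ≤ ⁅N, N⁆) (c : ℕ)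
    (hc : K.lowerCentralSeries c ≤ N) : Group.IsNilpotent K := by
  have hn := lcs_normal N
  have hL : ∀ i, ⁅⁅N, N⁆, N.lowerCentralSeries i⁆ ≤ N.lowerCentralSeries (i + 2) := by
    intro i
    have := hn (i + 2)
    apply three_subgroups
    · rw [Subgroup.commutator_comm N]
      exact le_rfl
    · exact le_rfl
  have hLK : ∀ i, ⁅N.lowerCentralSeries i, K⁆ ≤ N.lowerCentralSeries (i + 1) := by
    intro i
    induction i with
    | zero => exact hNK
    | succ i ih =>
      have := hn (i + 2)
      have := hn (i + 1 + 1)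
      rw [Subgroup.lowerCentralSeries_succ N i]
      apply three_subgroups
      · exact (Subgroup.commutator_mono hNK le_rfl).trans (hL i)
      · rw [Subgroup.commutator_comm K]
        exact Subgroup.commutator_mono ih le_rfl
  have hfin : ∀ j, K.lowerCentralSeries (c + j) ≤ N.lowerCentralSeries j := by
    intro j
    induction j with
    | zero => exact hc
    | succ j ih =>
      rw [← add_assoc, Subgroup.lowerCentralSeries_succ]
      exact (Subgroup.commutator_mono ih le_rfl).trans (hLK j)
  rw [Subgroup.isNilpotent_iff_lowerCentralSeries] at hnil ⊢
  obtain ⟨n, hn⟩ := hnil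
  exact ⟨c + n, le_bot_iff.mp (hn ▸ hfin n)⟩

lemma lcs_le_of_pgroup {G : Type*} [Group G] [Finite G] (N K : Subgroup G) [hN : N.Normal]
    (q : ℕ) (hq : q.Prime) (h : ∀ x ∈ K, ∃ i : ℕ, x ^ (q ^ i) ∈ N) :
    ∃ c, K.lowerCentralSeries c ≤ N := by
  have : Fact q.Prime := ⟨hq⟩
  have hp : IsPGroup q (K.map (QuotientGroup.mk' N)) := by
    rintro ⟨_, x, hx, rfl⟩
    obtain ⟨i, hi⟩ := h x hx
    refine ⟨i, Subtype.ext ?_⟩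
    rw [Subgroup.coe_pow, Subgroup.coe_one]
    simp only
    rw [← map_pow]
    exact (QuotientGroup.eq_one_iff _).mpr hi
  have hnil := hp.isNilpotent
  rw [Subgroup.isNilpotent_iff_lowerCentralSeries] at hnil
  obtain ⟨c, hc⟩ := hnil
  refine ⟨c, ?_⟩
  rw [← Subgroup.map_lowerCentralSeries, Subgroup.map_eq_bot_iff, QuotientGroup.ker_mk'] at hc
  exact hc

structure IsInvNil {G : Type*} [Group G] (φ : G →* G) (F : Subgroup G) : Prop where
  normal : F.Normal
  inv : ∀ x ∈ F, φ x ∈ F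
  nil : Group.IsNilpotent F

structure IsMaxNil {G : Type*} [Group G] (φ : G →* G) (F : Subgroup G) : Prop
    extends IsInvNil φ F where
  max : ∀ Y, IsInvNil φ Y → F ≤ Y → Y ≤ F

lemma exists_isMaxNil {G : Type*} [Group G] [Finite G] (φ : G →* G) : ∃ F, IsMaxNil φ F := by
  obtain ⟨F, h1, h2⟩ := exists_max_sub (IsInvNil φ) ⟨⊥, inferInstance, by simp, inferInstance⟩
  exact ⟨F, h1, h2⟩

def dser {G : Type*} [Group G] (C : Subgroup G) : ℕ → Subgroup G
  | 0 => C
  | n + 1 => ⁅dser C n, dser C n⁆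

lemma map_commutator_le {G : Type*} [Group G] (φ : G →* G) (A : Subgroup G)
    (h : ∀ x ∈ A, φ x ∈ A) : ∀ x ∈ ⁅A, A⁆, φ x ∈ ⁅A, A⁆ := by
  intro x hx
  have h1 : A.map φ ≤ A := Subgroup.map_le_iff_le_comap.mpr h
  have h2 : (⁅A, A⁆ : Subgroup G).map φ ≤ ⁅A, A⁆ := by
    rw [Subgroup.map_commutator]
    exact Subgroup.commutator_mono h1 h1
  exact h2 ⟨x, hx, rfl⟩

lemma centralizer_le_max {G : Type*} [Group G] [Finite G] [Group.IsSolvable G] (φ : G →* G) (p : ℕ)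
    (hp : 0 < p) (hφ : ∀ x, φ^[p] x = x) (F : Subgroup G) (hF : IsMaxNil φ F) :
    Subgroup.centralizer (F : Set G) ≤ F := by
  classical
  have hFn := hF.normal
  set C := Subgroup.centralizer (F : Set G) with hC
  have hCn : C.Normal := inferInstance
  have hCi := centralizer_invariant hp hφ hF.inv
  have hn : ∀ i, (dser C i).Normal := by
    intro i
    induction i with
    | zero => exact hCn
    | succ i ih => rw [dser]; infer_instance
  have hi : ∀ i, ∀ x ∈ dser C i, φ x ∈ dser C i := by
    intro i
    induction i with
    | zero => exact hCi
    | succ i ih => exact map_commutator_le φ _ ih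
  have hle : ∀ i, dser C i ≤ C := by
    intro i
    induction i with
    | zero => exact le_rfl
    | succ i ih => have := hn i; exact (Subgroup.commutator_le_left _ _).trans ih
  have hds : ∀ i, dser C i ≤ derivedSeries G i := by
    intro i
    induction i with
    | zero => exact le_top
    | succ i ih => exact Subgroup.commutator_mono ih ih
  have hex : ∃ n, dser C n ≤ F := by
    obtain ⟨n, hn⟩ := (inferInstance : Group.IsSolvable G).solvable
    exact ⟨n, (hds n).trans (hn ▸ bot_le)⟩
  rcases h0 : Nat.find hex with _ | j
  · have := Nat.find_spec hex
    rw [h0] at this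
    exact this
  exfalso
  have h1 : ⁅dser C j, dser C j⁆ ≤ F := by
    have := Nat.find_spec hex
    rw [h0] at this
    exact this
  have h2 : ¬ dser C j ≤ F := Nat.find_min hex (by omega)
  apply h2
  have hnj := hn j
  have hmem : ∀ k ∈ F ⊔ dser C j, ∃ f ∈ F, ∃ d ∈ dser C j, f * d = k := by
    intro k hk
    rw [← SetLike.mem_coe, Subgroup.mul_normal] at hk
    exact Set.mem_mul.mp hk
  refine le_sup_right.trans (hF.max (F ⊔ dser C j) ⟨inferInstance, ?_, ?_⟩ le_sup_left)
  · intro k hk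
    obtain ⟨f, hf, d, hd, rfl⟩ := hmem k hk
    rw [map_mul]
    exact Subgroup.mul_mem_sup (hF.inv f hf) (hi j d hd)
  · apply nilpotent_of_commutator_le F (F ⊔ dser C j) hF.nil ?_ 1
    · rw [Subgroup.lowerCentralSeries_succ, Subgroup.lowerCentralSeries_zero]
      have key : ∀ D : Subgroup G, D ≤ F ↔ D.map (QuotientGroup.mk' F) = ⊥ := by
        intro D
        rw [Subgroup.map_eq_bot_iff, QuotientGroup.ker_mk']
      rw [key, Subgroup.map_commutator, Subgroup.map_sup, (key F).mp le_rfl, bot_sup_eq,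
        ← Subgroup.map_commutator, ← key]
      exact h1
    · rw [Subgroup.commutator_le]
      intro x hx k hk
      obtain ⟨f, hf, d, hd, rfl⟩ := hmem k hk
      have hdx := Subgroup.mem_centralizer_iff.mp (hle j hd) x hx
      have : ⁅x, f * d⁆ = ⁅x, f⁆ := by
        have h3 : d * x⁻¹ = x⁻¹ * d := by
          have : Commute x d := hdx
          exact this.inv_left.symm.eq
        calc ⁅x, f * d⁆ = x * f * (d * x⁻¹) * d⁻¹ * f⁻¹ := by rw [commutatorElement_def]; group
          _ = _ := by rw [h3, commutatorElement_def]; group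
      rw [this]
      exact Subgroup.commutator_mem_commutator hx hf

lemma lift_fixed {G : Type*} [Group G] [Finite G] (φ : G →* G) (p : ℕ) (hp : p.Prime)
    (hφ : ∀ x, φ^[p] x = x) (hcop : p.Coprime (Nat.card G)) (N : Subgroup G)
    (hN : ∀ x ∈ N, φ x ∈ N) (g : G) (hg : g⁻¹ * φ g ∈ N) : ∃ n ∈ N, φ (g * n) = g * n := by
  classical
  have : Fact p.Prime := ⟨hp⟩
  have : Fintype N := Fintype.ofFinite _
  let f : Function.End N := fun n => ⟨g⁻¹ * φ (g * n), by
    rw [map_mul, ← mul_assoc]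
    exact N.mul_mem hg (hN _ n.2)⟩
  have hfi : ∀ i, ∀ n : N, ((f ^ i) n : G) = g⁻¹ * φ^[i] (g * n) := by
    intro i
    induction i with
    | zero =>
      intro n
      change (n : G) = g⁻¹ * (g * n)
      simp
    | succ i ih =>
      intro n
      rw [pow_succ']
      change (f ((f ^ i) n) : G) = _
      change g⁻¹ * φ (g * ((f ^ i) n : G)) = _
      rw [ih, Function.iterate_succ_apply']
      simp
  have hf : f ^ p ^ 1 = 1 := by
    rw [pow_one]
    funext n
    apply Subtype.ext
    rw [hfi, hφ]
    change g⁻¹ * (g * (n : G)) = (n : G)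
    simp
  have h := Equiv.Perm.card_fixedPoints_modEq hf
  have hne : (Function.fixedPoints f).Nonempty := by
    by_contra hcon
    rw [Set.not_nonempty_iff_eq_empty] at hcon
    have h0 : Fintype.card (Function.fixedPoints f) = 0 := by
      rw [Fintype.card_eq_zero_iff, hcon]; infer_instance
    rw [h0] at h
    have h1 : p ∣ Fintype.card N := (Nat.modEq_zero_iff_dvd).mp h
    rw [← Nat.card_eq_fintype_card] at h1
    have h2 : p ∣ Nat.card G := h1.trans (Subgroup.card_subgroup_dvd_card N)
    exact hp.one_lt.ne' (Nat.eq_one_of_dvd_coprimes hcop dvd_rfl h2)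
  obtain ⟨n, hn⟩ := hne
  refine ⟨n, n.2, ?_⟩
  have h1 : g⁻¹ * φ (g * n) = n := congrArg Subtype.val hn
  rw [inv_mul_eq_iff_eq_mul] at h1
  exact h1

end Nilp

/-! ### Primary parts of nilpotent groups -/

section Parts

open scoped commutatorElement

lemma nil_decomp {T : Type*} [Group T] [Finite T] (hT : Group.IsNilpotent T) (q : ℕ)
    (hq : q.Prime) :
    ∃ N : Subgroup T, N.Normal ∧ q.Coprime (Nat.card N) ∧ ∀ x : T, ∃ i : ℕ, x ^ (q ^ i) ∈ N := by
  classical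
  have hFq : Fact q.Prime := ⟨hq⟩
  obtain ⟨e⟩ := (Group.isNilpotent_of_finite_tfae (G := T)).out 0 4 |>.mp hT
  by_cases hqd : q ∈ (Nat.card T).primeFactors
  swap
  · refine ⟨⊤, inferInstance, ?_, fun x => ⟨0, Subgroup.mem_top _⟩⟩
    rw [Subgroup.card_top, Nat.Prime.coprime_iff_not_dvd hq]
    intro h
    exact hqd (Nat.mem_primeFactors.mpr ⟨hq, h, Nat.card_pos.ne'⟩)
  let π : T →* (∀ P : Sylow q T, (P : Subgroup T)) :=
    (Pi.evalMonoidHom (fun p : (Nat.card T).primeFactors => ∀ P : Sylow p T, (P : Subgroup T))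
      ⟨q, hqd⟩).comp e.symm.toMonoidHom
  refine ⟨π.ker, inferInstance, ?_, ?_⟩
  · rw [Nat.Prime.coprime_iff_not_dvd hq]
    intro h
    obtain ⟨⟨x, hxk⟩, hx⟩ := exists_prime_orderOf_dvd_card' q h
    have hx1 : x ^ q = 1 := by
      have := pow_orderOf_eq_one (⟨x, hxk⟩ : π.ker)
      rw [hx] at this
      exact congrArg Subtype.val this
    have hxe : e.symm x = 1 := by
      funext p P
      by_cases hpq : (p : ℕ) = q
      · have hp : p = ⟨q, hqd⟩ := Subtype.ext hpq
        subst hp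
        exact congrFun (MonoidHom.mem_ker.mp hxk) P
      · have hpp : (p : ℕ).Prime := Nat.prime_of_mem_primeFactors p.2
        have : Fact (p : ℕ).Prime := ⟨hpp⟩
        have h1 : (e.symm x p P) ^ q = 1 := by
          have : (e.symm x) ^ q = 1 := by rw [← map_pow, hx1, map_one]
          exact congrFun (congrFun this p) P
        obtain ⟨k, hk⟩ := P.isPGroup' (e.symm x p P)
        have hcop : Nat.Coprime q ((p : ℕ) ^ k) :=
          Nat.Coprime.pow_right _ ((Nat.coprime_primes hq hpp).mpr (Ne.symm hpq))
        have h2 := Nat.dvd_gcd (orderOf_dvd_of_pow_eq_one h1) (orderOf_dvd_of_pow_eq_one hk)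
        rw [hcop.gcd_eq_one] at h2
        exact orderOf_eq_one_iff.mp (Nat.dvd_one.mp h2)
    have hx2 : x = 1 := by
      have := congrArg e hxe
      simpa using this
    have : orderOf (⟨x, hxk⟩ : π.ker) = 1 := orderOf_eq_one_iff.mpr (Subtype.ext hx2)
    rw [this] at hx
    exact hq.one_lt.ne hx
  · intro x
    have hpi : ∀ P : Sylow q T, ∃ k : ℕ, (π x P) ^ (q ^ k) = 1 := fun P => P.isPGroup' (π x P)
    choose k hk using hpi
    have : Finite (Sylow q T) := inferInstance
    have : Fintype (Sylow q T) := Fintype.ofFinite _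
    refine ⟨∑ P, k P, ?_⟩
    rw [MonoidHom.mem_ker, map_pow]
    funext P
    have : (π x P) ^ (q ^ (∑ P, k P)) = 1 := by
      obtain ⟨c, hc⟩ := pow_dvd_pow q (Finset.single_le_sum (f := k) (fun _ _ => Nat.zero_le _)
        (Finset.mem_univ P))
      rw [hc, pow_mul, hk, one_pow]
    exact this

lemma qpart_of_nilpotent {G : Type*} [Group G] [Finite G] (F : Subgroup G)
    (hF : Group.IsNilpotent F) (q : ℕ) (hq : q.Prime) :
    ∃ P : Subgroup G, ∀ x, x ∈ P ↔ x ∈ F ∧ ∃ i : ℕ, x ^ (q ^ i) = 1 := by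
  have hFq : Fact q.Prime := ⟨hq⟩
  let P : Sylow q F := default
  have hPn : (P : Subgroup F).Normal :=
    ((Group.isNilpotent_of_finite_tfae (G := F)).out 0 3 rfl rfl |>.mp hF) q hFq P
  refine ⟨(P : Subgroup F).map F.subtype, fun x => ⟨?_, ?_⟩⟩
  · rintro ⟨y, hy, rfl⟩
    refine ⟨y.2, ?_⟩
    obtain ⟨i, hi⟩ := P.isPGroup' ⟨y, hy⟩
    exact ⟨i, congrArg (fun z : (P : Subgroup F) => ((z : F) : G)) hi⟩
  · rintro ⟨hx, i, hi⟩
    refine ⟨⟨x, hx⟩, ?_, rfl⟩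
    have hz : IsPGroup q (Subgroup.zpowers (⟨x, hx⟩ : F)) := by
      apply IsPGroup.of_card (n := (Nat.card (Subgroup.zpowers (⟨x, hx⟩ : F))).factorization q)
      rw [Nat.card_zpowers]
      have : orderOf (⟨x, hx⟩ : F) ∣ q ^ i := orderOf_dvd_of_pow_eq_one (Subtype.ext hi)
      obtain ⟨j, _, hj⟩ := (Nat.dvd_prime_pow hq).mp this
      rw [hj]
      simp [hq.factorization_self]
    obtain ⟨P', hP'⟩ := hz.exists_le_sylow
    have hsub := Sylow.unique_of_normal P hPn
    have : P' = P := Subsingleton.elim _ _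
    rw [← this]
    exact hP' (Subgroup.mem_zpowers _)

lemma coprimePart_of_nilpotent {G : Type*} [Group G] [Finite G] (F : Subgroup G)
    (hF : Group.IsNilpotent F) (q : ℕ) (hq : q.Prime) :
    ∃ N : Subgroup G, (∀ x, x ∈ N ↔ x ∈ F ∧ q.Coprime (orderOf x)) ∧
      q.Coprime (Nat.card N) ∧ ∀ x ∈ F, ∃ i : ℕ, x ^ (q ^ i) ∈ N := by
  obtain ⟨N, hNn, hNq, hNx⟩ := nil_decomp hF q hq
  refine ⟨N.map F.subtype, fun x => ⟨?_, ?_⟩, ?_, ?_⟩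
  · rintro ⟨y, hy, rfl⟩
    refine ⟨y.2, ?_⟩
    have h1 : orderOf (F.subtype y) = orderOf (⟨y, hy⟩ : N) := by
      rw [orderOf_injective F.subtype F.subtype_injective,
        ← orderOf_injective N.subtype N.subtype_injective]
      rfl
    rw [h1]
    exact hNq.coprime_dvd_right (orderOf_dvd_natCard _)
  · rintro ⟨hx, hc⟩
    refine ⟨⟨x, hx⟩, ?_, rfl⟩
    obtain ⟨i, hi⟩ := hNx ⟨x, hx⟩
    have hc' : (orderOf (⟨x, hx⟩ : F)).Coprime (q ^ i) := by
      rw [Subgroup.orderOf_mk]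
      exact (hc.pow_left i).symm
    obtain ⟨m, hm⟩ := exists_pow_eq_self_of_coprime hc'.symm
    rw [← hm]
    exact N.pow_mem hi m
  · rw [← Nat.card_congr (N.equivMapOfInjective F.subtype F.subtype_injective).toEquiv]
    exact hNq
  · intro x hx
    obtain ⟨i, hi⟩ := hNx ⟨x, hx⟩
    exact ⟨i, ⟨_, hi, rfl⟩⟩

end Parts

/-! ### The module attached to a normal subgroup -/

section Module

open scoped commutatorElement

variable {G : Type} [Group G]

abbrev modV (N : Subgroup G) : Type := Additive (Abelianization N)

/-- the class of an element of `N` -/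
def cls (N : Subgroup G) (x : N) : modV N := Additive.ofMul (Abelianization.of x)

lemma cls_mul (N : Subgroup G) (x y : N) : cls N (x * y) = cls N x + cls N y := by
  unfold cls; rw [map_mul]; rfl

lemma cls_inv (N : Subgroup G) (x : N) : cls N x⁻¹ = - cls N x := by
  unfold cls; rw [map_inv]; rfl

lemma cls_surj (N : Subgroup G) (v : modV N) : ∃ x, cls N x = v := by
  obtain ⟨x, hx⟩ := QuotientGroup.mk_surjective (Additive.toMul v)
  exact ⟨x, hx⟩

lemma cls_eq_iff (N : Subgroup G) (x y : N) :
    cls N x = cls N y ↔ (x : G)⁻¹ * y ∈ ⁅N, N⁆ := by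
  have h1 : cls N x = cls N y ↔ x⁻¹ * y ∈ commutator N := by
    change (QuotientGroup.mk x : N ⧸ commutator N) = QuotientGroup.mk y ↔ _
    exact QuotientGroup.eq
  rw [h1, ← Subgroup.map_subtype_commutator]
  constructor
  · intro h; exact ⟨_, h, rfl⟩
  · rintro ⟨z, hz, h⟩
    have : z = x⁻¹ * y := Subtype.ext h
    exact this ▸ hz

def endOf (N : Subgroup G) (f : N →* N) : AddMonoid.End (modV N) :=
  MonoidHom.toAdditive (Abelianization.map f)

lemma endOf_cls (N : Subgroup G) (f : N →* N) (x : N) : endOf N f (cls N x) = cls N (f x) := rfl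

lemma end_ext (N : Subgroup G) (a b : AddMonoid.End (modV N))
    (h : ∀ x, a (cls N x) = b (cls N x)) : a = b := by
  apply AddMonoidHom.ext
  intro v
  obtain ⟨x, rfl⟩ := cls_surj N v
  exact h x

def conjRep (N : Subgroup G) [N.Normal] : G →* AddMonoid.End (modV N) where
  toFun g := endOf N (MulAut.conjNormal g).toMonoidHom
  map_one' := by
    apply end_ext
    intro x
    rw [endOf_cls, map_one]
    rfl
  map_mul' a b := by
    apply end_ext
    intro x
    rw [endOf_cls, map_mul]
    rfl

lemma conjRep_cls (N : Subgroup G) [hN : N.Normal] (g : G) (x : N) :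
    conjRep N g (cls N x) = cls N ⟨g * x * g⁻¹, hN.conj_mem _ x.2 g⟩ := by
  change endOf N (MulAut.conjNormal g).toMonoidHom (cls N x) = _
  rw [endOf_cls]
  congr 1

lemma conjRep_eq_one_iff (N : Subgroup G) [hN : N.Normal] (g : G) :
    conjRep N g = 1 ↔ ∀ x ∈ N, ⁅x, g⁆ ∈ ⁅N, N⁆ := by
  constructor
  · intro h x hx
    have h1 : conjRep N g (cls N ⟨x⁻¹, N.inv_mem hx⟩) = cls N ⟨x⁻¹, N.inv_mem hx⟩ := by
      rw [h]; rfl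
    rw [conjRep_cls] at h1
    have h2 := (cls_eq_iff N _ _).mp h1.symm
    convert h2 using 1
    simp only [commutatorElement_def]
    group
  · intro h
    apply end_ext
    intro x
    rw [conjRep_cls]
    symm
    rw [AddMonoid.End.one_apply, cls_eq_iff]
    have h1 := h (x : G)⁻¹ (N.inv_mem x.2)
    convert h1 using 1
    simp only [commutatorElement_def]
    group

lemma conjRep_of_mem (N : Subgroup G) [hN : N.Normal] (g : G) (hg : g ∈ N) : conjRep N g = 1 :=
  (conjRep_eq_one_iff N g).mpr fun _ hx => Subgroup.commutator_mem_commutator hx hg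

lemma eq_one_of_coprime_pow {M : Type*} [Monoid M] {u : M} {a b : ℕ} (h : a.Coprime b)
    (ha : u ^ a = 1) (hb : u ^ b = 1) : u = 1 := by
  have h2 := Nat.dvd_gcd (orderOf_dvd_of_pow_eq_one ha) (orderOf_dvd_of_pow_eq_one hb)
  rw [h.gcd_eq_one] at h2
  exact orderOf_eq_one_iff.mp (Nat.dvd_one.mp h2)

/-- restriction of an endomorphism -/
def restr (N : Subgroup G) (φ : G →* G) (h : ∀ x ∈ N, φ x ∈ N) : N →* N :=
  (φ.comp N.subtype).codRestrict N (fun t => h t t.2)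

lemma restr_iter (N : Subgroup G) (φ : G →* G) (h : ∀ x ∈ N, φ x ∈ N) (i : ℕ) (x : N) :
    (((restr N φ h)^[i] x : N) : G) = φ^[i] x := by
  induction i with
  | zero => rfl
  | succ i ih =>
    rw [Function.iterate_succ_apply', Function.iterate_succ_apply', ← ih]; rfl

lemma endOf_pow (N : Subgroup G) (f : N →* N) (i : ℕ) (x : N) :
    (endOf N f ^ i) (cls N x) = cls N (f^[i] x) := by
  induction i with
  | zero => rfl
  | succ i ih =>
    rw [pow_succ', Function.iterate_succ_apply']
    change endOf N f ((endOf N f ^ i) (cls N x)) = _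
    rw [ih, endOf_cls]

lemma engel_mem (N : Subgroup G) [hN : N.Normal] (g : G) (x : N) : engelComm (x : G) g ∈ N := by
  unfold engelComm
  have := hN.conj_mem _ x.2 g⁻¹
  rw [inv_inv] at this
  rw [mul_assoc, mul_assoc, ← mul_assoc g⁻¹]
  exact N.mul_mem (N.inv_mem x.2) this

lemma engel_iter (N : Subgroup G) [hN : N.Normal] (g : G) (l : ℕ) (x : N) :
    ∃ h : (fun y => engelComm y g)^[l] (x : G) ∈ N,
      cls N ⟨_, h⟩ = ((conjRep N g⁻¹ - 1 : AddMonoid.End (modV N)) ^ l) (cls N x) := by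
  induction l with
  | zero => exact ⟨x.2, rfl⟩
  | succ l ih =>
    obtain ⟨h, hl⟩ := ih
    have h' : (fun y => engelComm y g)^[l + 1] (x : G) =
      engelComm ((fun y => engelComm y g)^[l] (x : G)) g := Function.iterate_succ_apply' _ _ _
    refine ⟨h' ▸ engel_mem N g ⟨_, h⟩, ?_⟩
    rw [pow_succ']
    change _ = (conjRep N g⁻¹ - 1 : AddMonoid.End (modV N))
      (((conjRep N g⁻¹ - 1 : AddMonoid.End (modV N)) ^ l) (cls N x))
    rw [← hl]
    change _ = conjRep N g⁻¹ (cls N ⟨_, h⟩) - cls N ⟨_, h⟩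
    rw [conjRep_cls, sub_eq_neg_add, ← cls_inv, ← cls_mul]
    congr 1
    apply Subtype.ext
    refine h'.trans ?_
    simp only [Subgroup.coe_mul, Subgroup.coe_inv]
    generalize (fun y => engelComm y g)^[l] (x : G) = z
    unfold engelComm
    group

lemma sink_range [Finite G] (N : Subgroup G) [hN : N.Normal] (g : G) (E : Set G)
    (hE : IsLeftEngelSink g E) (n : ℕ) (hn : conjRep N g⁻¹ ^ n = 1)
    (hcop : n.Coprime (Nat.card (modV N))) :
    (Set.range (conjRep N g⁻¹ - 1 : AddMonoid.End (modV N))).ncard ≤ E.ncard := by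
  classical
  choose L hL using hE
  have : Finite N := inferInstance
  have : Fintype N := Fintype.ofFinite _
  let l := ∑ x : N, L x
  have hl : ∀ x : N, (fun y => engelComm y g)^[l] (x : G) ∈ E := fun x =>
    hL x l (Finset.single_le_sum (f := fun x : N => L x) (fun _ _ => Nat.zero_le _)
        (Finset.mem_univ x))
  let c : G → modV N := fun y => if h : y ∈ N then cls N ⟨y, h⟩ else 0
  have hsub : Set.range (conjRep N g⁻¹ - 1 : AddMonoid.End (modV N)) ⊆ Set.image c E := by
    intro w hw
    obtain ⟨w', _, hw'⟩ := coprime_surj_pow hn hcop l hw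
    obtain ⟨x, rfl⟩ := cls_surj N w'
    obtain ⟨h1, h2⟩ := engel_iter N g l x
    refine ⟨_, hl x, ?_⟩
    simp only [c]
    rw [dif_pos h1, h2, hw']
  exact (Set.ncard_le_ncard hsub (Set.toFinite _)).trans (Set.ncard_image_le (Set.toFinite _))

end Module

/-! ### The core lemma -/

section Core

open scoped commutatorElement

structure Hyp (G : Type) [Group G] (φ : G →* G) (p m : ℕ) : Prop where
  prime : p.Prime
  iter : ∀ x, φ^[p] x = x
  cop : p.Coprime (Nat.card G)
  sink : ∀ g, φ g = g → ∃ E : Set G, IsLeftEngelSink g E ∧ E.ncard ≤ m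

variable {G : Type} [Group G]

def qmap (F : Subgroup G) [F.Normal] (φ : G →* G) (h : ∀ x ∈ F, φ x ∈ F) : G ⧸ F →* G ⧸ F :=
  QuotientGroup.map F F φ h

lemma qmap_mk (F : Subgroup G) [F.Normal] (φ : G →* G) (h : ∀ x ∈ F, φ x ∈ F) (g : G) :
    qmap F φ h (g : G ⧸ F) = (φ g : G) := rfl

lemma qmap_iter (F : Subgroup G) [F.Normal] (φ : G →* G) (h : ∀ x ∈ F, φ x ∈ F) (i : ℕ) (g : G) :
    (qmap F φ h)^[i] (g : G ⧸ F) = (φ^[i] g : G) := by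
  induction i with
  | zero => rfl
  | succ i ih => rw [Function.iterate_succ_apply', Function.iterate_succ_apply', ih, qmap_mk]

lemma lift_quot [Finite G] {φ : G →* G} {p m : ℕ} (hyp : Hyp G φ p m) (F : Subgroup G) [F.Normal]
    (h : ∀ x ∈ F, φ x ∈ F) (a : G ⧸ F) (ha : qmap F φ h a = a) :
    ∃ g : G, φ g = g ∧ (g : G ⧸ F) = a := by
  obtain ⟨g, rfl⟩ := QuotientGroup.mk_surjective a
  rw [qmap_mk] at ha
  obtain ⟨n, hn, hfix⟩ := lift_fixed φ p hyp.prime hyp.iter hyp.cop F h g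
    (QuotientGroup.eq.mp ha.symm)
  refine ⟨g * n, hfix, ?_⟩
  rw [QuotientGroup.mk_mul, (QuotientGroup.eq_one_iff n).mpr hn, mul_one]

lemma engel_quot (F : Subgroup G) [F.Normal] (x g : G) (l : ℕ) :
    (fun y => engelComm y (g : G ⧸ F))^[l] (x : G ⧸ F) =
      ((fun y => engelComm y g)^[l] x : G) := by
  induction l with
  | zero => rfl
  | succ l ih => rw [Function.iterate_succ_apply', Function.iterate_succ_apply', ih]; rfl

lemma Hyp.quot [Finite G] {φ : G →* G} {p m : ℕ} (hyp : Hyp G φ p m) (F : Subgroup G) [F.Normal]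
    (h : ∀ x ∈ F, φ x ∈ F) : Hyp (G ⧸ F) (qmap F φ h) p m where
  prime := hyp.prime
  iter := by
    intro a
    obtain ⟨g, rfl⟩ := QuotientGroup.mk_surjective a
    rw [qmap_iter, hyp.iter]
  cop := hyp.cop.coprime_dvd_right (Subgroup.card_quotient_dvd_card F)
  sink := by
    intro a ha
    obtain ⟨g, hg, rfl⟩ := lift_quot hyp F h a ha
    obtain ⟨E, hE, hEm⟩ := hyp.sink g hg
    refine ⟨Set.image (fun x : G => (x : G ⧸ F)) E, ?_, (Set.ncard_image_le (Set.toFinite _)).trans hEm⟩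
    intro b
    obtain ⟨x, rfl⟩ := QuotientGroup.mk_surjective b
    obtain ⟨l₀, hl⟩ := hE x
    refine ⟨l₀, fun l hle => ?_⟩
    rw [engel_quot]
    exact ⟨_, hl l hle, rfl⟩

lemma core [Finite G] {φ : G →* G} {p m : ℕ} (hyp : Hyp G φ p m) (F : Subgroup G)
    [hFn : F.Normal] (hF : IsMaxNil φ F) (Q : Subgroup (G ⧸ F))
    (hQ : IsInvNil (qmap F φ hF.inv) Q) (q : ℕ) (hq : q.Prime) :
    ∃ (V : Type) (_ : AddCommGroup V) (_ : Finite V) (ρ : G ⧸ F →* AddMonoid.End V)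
      (Φ : AddMonoid.End V), q.Coprime (Nat.card V) ∧
      (∀ a ∈ Q, (∃ i : ℕ, a ^ (q ^ i) = 1) → ρ a = 1 → a = 1) ∧ Φ ^ p = 1 ∧
      (∀ a, Φ * ρ a = ρ (qmap F φ hF.inv a) * Φ) ∧
      {v | Φ v = v}.ncard ≤ {x | x ∈ F ∧ φ x = x}.ncard ∧
      ∀ a, qmap F φ hF.inv a = a → (∃ i : ℕ, a ^ (q ^ i) = 1) →
        (Set.range (ρ a - 1 : AddMonoid.End V)).ncard ≤ m := by
  classical
  obtain ⟨P, hP⟩ := qpart_of_nilpotent F hF.nil q hq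
  obtain ⟨N, hN, hNq, hNx⟩ := coprimePart_of_nilpotent F hF.nil q hq
  obtain ⟨S, hS⟩ := qpart_of_nilpotent Q hQ.nil q hq
  have hQn := hQ.normal
  have hbij : Function.Injective φ := by
    intro a b hab
    have : ∀ i, φ^[i+1] a = φ^[i+1] b := fun i => by
      rw [Function.iterate_succ_apply, hab, Function.iterate_succ_apply]
    obtain ⟨j, hj⟩ := Nat.exists_eq_succ_of_ne_zero hyp.prime.ne_zero
    have h1 := this j
    rw [← Nat.succ_eq_add_one, ← hj, hyp.iter, hyp.iter] at h1
    exact h1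
  have hNF : N ≤ F := fun x hx => ((hN x).mp hx).1
  have hPn : P.Normal := ⟨fun x hx g => by
    obtain ⟨h1, i, hi⟩ := (hP x).mp hx
    refine (hP _).mpr ⟨hFn.conj_mem x h1 g, i, ?_⟩
    rw [conj_pow, hi]; simp⟩
  have hNn : N.Normal := ⟨fun x hx g => by
    obtain ⟨h1, hi⟩ := (hN x).mp hx
    refine (hN _).mpr ⟨hFn.conj_mem x h1 g, ?_⟩
    have : orderOf (g * x * g⁻¹) = orderOf x := by
      have := orderOf_injective (MulAut.conj g).toMonoidHom (MulAut.conj g).injective x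
      simpa using this
    rw [this]; exact hi⟩
  have hNi : ∀ x ∈ N, φ x ∈ N := by
    intro x hx
    obtain ⟨h1, hi⟩ := (hN x).mp hx
    refine (hN _).mpr ⟨hF.inv x h1, ?_⟩
    rw [orderOf_injective φ hbij]; exact hi
  have hSn : S.Normal := ⟨fun x hx g => by
    obtain ⟨h1, i, hi⟩ := (hS x).mp hx
    refine (hS _).mpr ⟨hQn.conj_mem x h1 g, i, ?_⟩
    rw [conj_pow, hi]; simp⟩
  have hNi' := map_commutator_le φ N hNi
  have hdis : Disjoint N P := by
    rw [Subgroup.disjoint_def]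
    intro x h1 h2
    obtain ⟨_, h3⟩ := (hN x).mp h1
    obtain ⟨_, i, h4⟩ := (hP x).mp h2
    exact eq_one_of_coprime_pow (h3.pow_left i) h4 (pow_orderOf_eq_one x)
  have hcard : q.Coprime (Nat.card (modV N)) :=
    hNq.coprime_dvd_right (Subgroup.card_quotient_dvd_card (commutator N))
  have hFt : ∀ x ∈ F, conjRep N x = 1 := by
    intro x hx
    obtain ⟨i, hi⟩ := hNx x hx
    have h1 : conjRep N x ^ (q ^ i) = 1 := by rw [← map_pow]; exact conjRep_of_mem N _ hi
    have h2 := ((hN _).mp hi).2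
    have h3 : x ^ (orderOf (x ^ (q ^ i))) ∈ P := by
      refine (hP _).mpr ⟨F.pow_mem hx _, i, ?_⟩
      rw [← pow_mul, mul_comm, pow_mul, pow_orderOf_eq_one]
    have h4 : conjRep N x ^ (orderOf (x ^ (q ^ i))) = 1 := by
      rw [← map_pow, conjRep_eq_one_iff]
      intro y hy
      have : Commute y (x ^ (orderOf (x ^ (q ^ i)))) :=
        Subgroup.commute_of_normal_of_disjoint N P hNn hPn hdis _ _ hy h3
      rw [commutatorElement_eq_one_iff_mul_comm.mpr this.eq]
      exact Subgroup.one_mem _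
    exact eq_one_of_coprime_pow (h2.pow_left i) h1 h4
  let ρ : G ⧸ F →* AddMonoid.End (modV N) := QuotientGroup.lift F (conjRep N) hFt
  have hρ : ∀ g : G, ρ (g : G ⧸ F) = conjRep N g := fun g => rfl
  refine ⟨modV N, inferInstance, inferInstance, ρ, endOf N (restr N φ hNi), hcard, ?_, ?_, ?_,
    ?_, ?_⟩
  · -- faithfulness
    intro a haQ hai ha1
    let K : Subgroup G := (conjRep N).ker ⊓ S.comap (QuotientGroup.mk' F)
    have hKF : K ≤ F := by
      apply hF.max K ⟨inferInstance, ?_, ?_⟩ ?_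
      · rintro x ⟨h1, h2⟩
        refine ⟨?_, ?_⟩
        · change conjRep N (φ x) = 1
          rw [conjRep_eq_one_iff]
          intro y hy
          obtain ⟨z, hz, rfl⟩ := exists_preimage_of_invariant hyp.prime.pos hyp.iter hNi hy
          rw [← map_commutatorElement]
          exact hNi' _ ((conjRep_eq_one_iff N x).mp h1 z hz)
        · obtain ⟨h3, i, h4⟩ := (hS _).mp h2
          refine (hS _).mpr ⟨hQ.inv _ h3, i, ?_⟩
          have := congrArg (qmap F φ hF.inv) h4
          rw [map_pow, map_one] at this
          exact this
      · have hq1 : ∀ x ∈ K, ∃ i : ℕ, x ^ (q ^ i) ∈ N := by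
          rintro x ⟨_, h2⟩
          obtain ⟨_, i, h4⟩ := (hS _).mp h2
          rw [← map_pow] at h4
          obtain ⟨j, hj⟩ := hNx _ ((QuotientGroup.eq_one_iff _).mp h4)
          refine ⟨i + j, ?_⟩
          rw [pow_add, pow_mul]; exact hj
        obtain ⟨c, hc⟩ := lcs_le_of_pgroup N K q hq hq1
        refine nilpotent_of_commutator_le N K ?_ ?_ c hc
        · have := hF.nil
          exact Group.nilpotent_of_mulEquiv (Subgroup.subgroupOfEquivOfLe hNF)
        · rw [Subgroup.commutator_le]
          intro x hx k hk
          exact (conjRep_eq_one_iff N k).mp hk.1 x hx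
      · intro x hx
        refine ⟨hFt x hx, ?_⟩
        change QuotientGroup.mk' F x ∈ S
        rw [show QuotientGroup.mk' F x = 1 from (QuotientGroup.eq_one_iff _).mpr hx]
        exact S.one_mem
    obtain ⟨g, rfl⟩ := QuotientGroup.mk_surjective a
    rw [QuotientGroup.eq_one_iff]
    exact hKF ⟨ha1, (hS _).mpr ⟨haQ, hai⟩⟩
  · apply end_ext
    intro x
    rw [endOf_pow]
    congr 1
    apply Subtype.ext
    rw [restr_iter, hyp.iter]
  · intro a
    obtain ⟨g, rfl⟩ := QuotientGroup.mk_surjective a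
    rw [qmap_mk, hρ, hρ]
    apply end_ext
    intro x
    change endOf N _ (conjRep N g (cls N x)) = conjRep N (φ g) (endOf N _ (cls N x))
    rw [conjRep_cls, endOf_cls, endOf_cls, conjRep_cls]
    congr 1
    apply Subtype.ext
    change φ (g * x * g⁻¹) = φ g * φ x * (φ g)⁻¹
    simp
  · let c : G → modV N := fun y => if h : y ∈ N then cls N ⟨y, h⟩ else 0
    refine (Set.ncard_le_ncard (t := Set.image c {x | x ∈ F ∧ φ x = x}) ?_ (Set.toFinite _)).trans
      (Set.ncard_image_le (Set.toFinite _))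
    intro v hv
    obtain ⟨x, rfl⟩ := cls_surj N v
    have h1 : cls N (restr N φ hNi x) = cls N x := hv
    have h2 := (cls_eq_iff N _ _).mp h1.symm
    obtain ⟨n, hn, hfix⟩ := lift_fixed φ p hyp.prime hyp.iter hyp.cop ⁅N, N⁆ hNi' x h2
    have hnN : n ∈ N := Subgroup.commutator_le_left N N hn
    have hm : (x : G) * n ∈ N := N.mul_mem x.2 hnN
    refine ⟨x * n, ⟨hNF hm, hfix⟩, ?_⟩
    simp only [c]
    rw [dif_pos hm]
    symm
    rw [cls_eq_iff]
    simpa using hn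
  · intro a ha hai
    obtain ⟨i, hi⟩ := hai
    obtain ⟨g, hg, rfl⟩ := lift_quot hyp F hF.inv a ha
    have hg' : φ g⁻¹ = g⁻¹ := by rw [map_inv, hg]
    obtain ⟨E, hE, hEm⟩ := hyp.sink g⁻¹ hg'
    have h1 : conjRep N (g⁻¹)⁻¹ ^ (q ^ i) = 1 := by
      rw [inv_inv, ← hρ, ← map_pow, hi, map_one]
    have := sink_range N g⁻¹ E hE (q ^ i) h1 (hcard.pow_left i)
    rw [inv_inv] at this
    exact this.trans hEm

end Core

/-! ### Assembly -/

section Assembly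

lemma nat_bound {n B : ℕ} (hn : n ≠ 0) (h : ∀ q, q.Prime → q ^ (n.factorization q) ≤ B) :
    n ≤ B ^ (B + 1) := by
  have hB : 0 < B := lt_of_lt_of_le (Nat.pow_pos (by norm_num)) (h 2 Nat.prime_two)
  have h1 : n = ∏ q ∈ n.primeFactors, q ^ n.factorization q :=
    (Nat.prod_factorization_pow_eq_self hn).symm
  have h2 : n.primeFactors ⊆ Finset.range (B + 1) := by
    intro q hq
    have hqp := Nat.prime_of_mem_primeFactors hq
    have h3 : n.factorization q ≠ 0 := by
      rw [← Finsupp.mem_support_iff, Nat.support_factorization]; exact hq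
    have := (Nat.le_self_pow h3 q).trans (h q hqp)
    exact Finset.mem_range.mpr (by omega)
  calc n = ∏ q ∈ n.primeFactors, q ^ n.factorization q := h1
    _ ≤ B ^ n.primeFactors.card :=
      Finset.prod_le_pow_card _ _ _ (fun q hq => h q (Nat.prime_of_mem_primeFactors hq))
    _ ≤ B ^ (B + 1) := by
      apply Nat.pow_le_pow_right hB
      simpa using Finset.card_le_card h2

lemma nil_bound {T : Type} [Group T] [Finite T] (hT : Group.IsNilpotent T) (σ : T →* T) (n k : ℕ)
    (hn : 0 < n) (hσ : ∀ x, σ^[n] x = x)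
    (h : ∀ q : ℕ, q.Prime → ∀ Y : Subgroup T, (∀ y ∈ Y, σ y ∈ Y) →
      (∀ a ∈ Y, ∀ b ∈ Y, a * b = b * a) → (∀ y ∈ Y, ∃ i : ℕ, y ^ (q ^ i) = 1) →
      Nat.card Y ≤ k) : Nat.card T ≤ (ramS n k) ^ (ramS n k + 1) := by
  apply nat_bound Nat.card_pos.ne'
  intro q hq
  have hFq : Fact q.Prime := ⟨hq⟩
  obtain ⟨P, hP⟩ := qpart_of_nilpotent (⊤ : Subgroup T) (Group.isNilpotent_top.mpr hT) q hq
  let S : Sylow q T := default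
  have hSP : (S : Subgroup T) ≤ P := by
    intro x hx
    obtain ⟨i, hi⟩ := S.isPGroup' ⟨x, hx⟩
    exact (hP x).mpr ⟨Subgroup.mem_top _, i, congrArg Subtype.val hi⟩
  have hPi : ∀ x ∈ P, σ x ∈ P := by
    intro x hx
    obtain ⟨_, i, hi⟩ := (hP x).mp hx
    exact (hP _).mpr ⟨Subgroup.mem_top _, i, by rw [← map_pow, hi, map_one]⟩
  rw [← S.card_eq_multiplicity]
  refine (Subgroup.card_le_of_le hSP).trans ?_
  apply ramsey_nilpotent (restr P σ hPi) n k hn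
  · intro x
    apply Subtype.ext
    rw [restr_iter, hσ]
  · intro Y hY1 hY2
    rw [Nat.card_congr (Y.equivMapOfInjective P.subtype P.subtype_injective).toEquiv]
    apply h q hq
    · rintro _ ⟨y, hy, rfl⟩
      exact ⟨_, hY1 y hy, rfl⟩
    · rintro _ ⟨a, ha, rfl⟩ _ ⟨b, hb, rfl⟩
      rw [← map_mul, hY2 a ha b hb, map_mul]
    · rintro _ ⟨y, hy, rfl⟩
      exact ((hP _).mp y.2).2

lemma card_coprime_of_qgroup {A : Type} [Group A] [Finite A] {q c : ℕ} (hq : q.Prime)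
    (h : ∀ a : A, ∃ i : ℕ, a ^ (q ^ i) = 1) (hc : q.Coprime c) : (Nat.card A).Coprime c := by
  have hFq : Fact q.Prime := ⟨hq⟩
  obtain ⟨n, hn⟩ := IsPGroup.iff_card.mp (show IsPGroup q A from h)
  rw [hn]
  exact hc.pow_left n

/-- fixed points as a subgroup -/
def fixSub {A : Type} [Group A] (σ : A →* A) : Subgroup A where
  carrier := {a | σ a = a}
  one_mem' := map_one σ
  mul_mem' := by
    intro a b ha hb
    change σ (a * b) = a * b
    rw [map_mul, show σ a = a from ha, show σ b = b from hb]
  inv_mem' := by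
    intro a ha
    change σ a⁻¹ = a⁻¹
    rw [map_inv, show σ a = a from ha]

lemma prop1 {G : Type} [Group G] [Finite G] {φ : G →* G} {p m : ℕ} (hyp : Hyp G φ p m)
    (F : Subgroup G) [hFn : F.Normal] (hF : IsMaxNil φ F) (Q : Subgroup (G ⧸ F))
    (hQ : IsInvNil (qmap F φ hF.inv) Q) :
    {x | x ∈ Q ∧ qmap F φ hF.inv x = x}.ncard ≤
      (ramS 1 m.factorial) ^ (ramS 1 m.factorial + 1) := by
  let C := Q ⊓ fixSub (qmap F φ hF.inv)
  have hCcard : {x | x ∈ Q ∧ qmap F φ hF.inv x = x}.ncard = Nat.card C := rfl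
  rw [hCcard]
  have hCn : Group.IsNilpotent C := by
    have := hQ.nil
    exact Group.nilpotent_of_mulEquiv (Subgroup.subgroupOfEquivOfLe (inf_le_left : C ≤ Q))
  apply nil_bound hCn (MonoidHom.id C) 1 _ one_pos (fun x => rfl)
  intro q hq Y _ hYc hYq
  obtain ⟨V, _, _, ρ, Φ, hcop, hfaith, -, -, -, hsink⟩ := core hyp F hF Q hQ q hq
  have hYq' : ∀ a : Y, ∃ i : ℕ, ((a : C) : G ⧸ F) ^ (q ^ i) = 1 := by
    intro a
    obtain ⟨i, hi⟩ := hYq a a.2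
    exact ⟨i, congrArg Subtype.val hi⟩
  apply card_le_factorial_of_ranges (V := V) (A := Y)
    (fun a b => Subtype.ext (hYc a a.2 b b.2)) (ρ.comp (C.subtype.comp Y.subtype))
  · rw [injective_iff_map_eq_one]
    intro a ha
    have := hfaith (a : C) (a : C).2.1 (hYq' a) ha
    exact Subtype.ext (Subtype.ext this)
  · apply card_coprime_of_qgroup hq _ hcop
    intro a
    obtain ⟨i, hi⟩ := hYq a a.2
    exact ⟨i, Subtype.ext hi⟩
  · intro a
    exact hsink (a : C) (a : C).2.2 (hYq' a)

lemma abelian_bound {A V : Type} [Group A] [Finite A] [AddCommGroup V] [Finite V]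
    (hc : ∀ a b : A, a * b = b * a) (ρ : A →* AddMonoid.End V) (hρ : Function.Injective ρ)
    (hcop : (Nat.card A).Coprime (Nat.card V)) (σ : A →* A) (Φ : AddMonoid.End V) (p k m : ℕ)
    (hp : p.Prime) (hpA : p.Coprime (Nat.card A)) (hσp : ∀ a, σ^[p] a = a)
    (hcomp : ∀ a, Φ * ρ a = ρ (σ a) * Φ) (hΦ : Φ ^ p = 1) (hk : {v : V | Φ v = v}.ncard ≤ k)
    (hm : ∀ a, σ a = a → (Set.range (ρ a - 1 : AddMonoid.End V)).ncard ≤ m) :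
    Nat.card A ≤ m.factorial * (k ^ (2 ^ (p - 1))).factorial := by
  let δ : A →* A :=
    { toFun := fun a => a⁻¹ * σ a
      map_one' := by simp
      map_mul' := by
        intro a b
        rw [map_mul, mul_inv_rev, hc b⁻¹ a⁻¹]
        calc a⁻¹ * b⁻¹ * (σ a * σ b) = a⁻¹ * (b⁻¹ * σ a) * σ b := by group
          _ = a⁻¹ * (σ a * b⁻¹) * σ b := by rw [hc b⁻¹]
          _ = _ := by group }
  have hδ : ∀ a, δ a = a⁻¹ * σ a := fun _ => rfl
  have hcard : Nat.card A = Nat.card δ.ker * Nat.card δ.range := by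
    rw [← Subgroup.index_ker, Subgroup.card_mul_index]
  have hdvd : ∀ B : Subgroup A, (Nat.card B).Coprime (Nat.card V) := fun B =>
    hcop.coprime_dvd_left (Subgroup.card_subgroup_dvd_card B)
  have hinj : ∀ B : Subgroup A, Function.Injective (ρ.comp B.subtype) := fun B =>
    hρ.comp B.subtype_injective
  rw [hcard]
  apply Nat.mul_le_mul
  · apply card_le_factorial_of_ranges (V := V) (A := δ.ker)
      (fun a b => Subtype.ext (hc a b)) (ρ.comp δ.ker.subtype) (hinj _) (hdvd _)
    intro a
    apply hm
    have := MonoidHom.mem_ker.mp a.2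
    rw [hδ, inv_mul_eq_one] at this
    exact this.symm
  · have hinv : ∀ x ∈ δ.range, σ x ∈ δ.range := by
      rintro _ ⟨y, rfl⟩
      exact ⟨σ y, by rw [hδ, hδ, map_mul, map_inv]⟩
    apply card_le_factorial_of_ranges (V := V) (A := δ.range)
      (fun a b => Subtype.ext (hc a b)) (ρ.comp δ.range.subtype) (hinj _) (hdvd _)
    apply range_le (V := V) (A := δ.range)
      (fun a b => Subtype.ext (hc a b)) (ρ.comp δ.range.subtype) (restr _ σ hinv) Φ p k hp
      ?_ ?_ ?_ (hdvd _) hΦ hk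
    · intro a
      apply Subtype.ext
      rw [restr_iter, hσp]
    · intro a
      exact hcomp a
    · rintro ⟨_, x, rfl⟩ hfix
      apply Subtype.ext
      have h1 : σ (δ x) = δ x := congrArg Subtype.val hfix
      have h2 : ∀ i, σ^[i] x = x * (δ x) ^ i := by
        intro i
        induction i with
        | zero => simp
        | succ i ih =>
          rw [Function.iterate_succ_apply', ih, map_mul, map_pow, h1, pow_succ']
          rw [← mul_assoc]
          congr 1
          rw [hδ]; group
      have h3 : (δ x) ^ p = 1 := by
        have := h2 p
        rw [hσp] at this
        exact (mul_eq_left.mp this.symm)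
      exact eq_one_of_coprime_pow hpA h3 pow_card_eq_one'

def bnd2 (p k m : ℕ) : ℕ := ramS p (m.factorial * (k ^ (2 ^ (p - 1))).factorial)

lemma prop2 {G : Type} [Group G] [Finite G] {φ : G →* G} {p m : ℕ} (hyp : Hyp G φ p m)
    (F : Subgroup G) [hFn : F.Normal] (hF : IsMaxNil φ F) (Q : Subgroup (G ⧸ F))
    (hQ : IsInvNil (qmap F φ hF.inv) Q) (k : ℕ) (hk : {x | x ∈ F ∧ φ x = x}.ncard ≤ k) :
    Nat.card Q ≤ (bnd2 p k m) ^ (bnd2 p k m + 1) := by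
  have hyp' := hyp.quot F hF.inv
  apply nil_bound hQ.nil (restr Q _ hQ.inv) p _ hyp.prime.pos
    (fun x => Subtype.ext (by rw [restr_iter, hyp'.iter]))
  intro q hq Y hYi hYc hYq
  obtain ⟨V, _, _, ρ, Φ, hcop, hfaith, hΦ, hcomp, hfix, hsink⟩ := core hyp F hF Q hQ q hq
  have hYq' : ∀ a : Y, ∃ i : ℕ, ((a : Q) : G ⧸ F) ^ (q ^ i) = 1 := by
    intro a
    obtain ⟨i, hi⟩ := hYq a a.2
    exact ⟨i, congrArg Subtype.val hi⟩
  apply abelian_bound (A := Y) (V := V) (fun a b => Subtype.ext (hYc a a.2 b b.2))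
    (ρ.comp (Q.subtype.comp Y.subtype)) ?_ ?_ (restr Y (restr Q _ hQ.inv) hYi) Φ p k m hyp.prime
    ?_ ?_ ?_ hΦ (hfix.trans hk) ?_
  · rw [injective_iff_map_eq_one]
    intro a ha
    have := hfaith (a : Q) (a : Q).2 (hYq' a) ha
    exact Subtype.ext (Subtype.ext this)
  · apply card_coprime_of_qgroup hq _ hcop
    intro a
    obtain ⟨i, hi⟩ := hYq a a.2
    exact ⟨i, Subtype.ext hi⟩
  · exact hyp'.cop.coprime_dvd_right
      ((Subgroup.card_subgroup_dvd_card Y).trans (Subgroup.card_subgroup_dvd_card Q))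
  · intro a
    apply Subtype.ext
    apply Subtype.ext
    rw [restr_iter, restr_iter, hyp'.iter]
  · intro a
    exact hcomp (a : Q)
  · intro a ha
    exact hsink (a : Q) (congrArg (fun z : Y => ((z : Q) : G ⧸ F)) ha) (hYq' a)

lemma card_le_of_centralizer {G : Type} [Group G] [Finite G] (F : Subgroup G) [hF : F.Normal]
    (h : Subgroup.centralizer (F : Set G) ≤ F) (B : ℕ) (hB : Nat.card F ≤ B) :
    Nat.card G ≤ B * B ^ B := by
  have hfin := card_le_of_fibers (⊤ : Subgroup G) (Subgroup.centralizer (F : Set G))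
    (fun s => (fun t : F => (⟨s * t * s⁻¹, hF.conj_mem _ t.2 s⟩ : F))) (by
      intro a _ b _ hab
      rw [Subgroup.mem_centralizer_iff]
      intro t ht
      have h1 : a * t * a⁻¹ = b * t * b⁻¹ := Subtype.ext_iff.mp (congrFun hab ⟨t, ht⟩)
      calc t * (a⁻¹ * b) = a⁻¹ * (a * t * a⁻¹) * b := by group
        _ = _ := by rw [h1]; group)
  rw [Subgroup.card_top, Nat.card_fun] at hfin
  have hT0 : 0 < Nat.card F := Nat.card_pos
  refine hfin.trans (Nat.mul_le_mul ?_ ?_)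
  · exact (Subgroup.card_le_of_le h).trans hB
  · exact (Nat.pow_le_pow_left hB _).trans (Nat.pow_le_pow_right (by omega) hB)

def bnd1 (m : ℕ) : ℕ := (ramS 1 m.factorial) ^ (ramS 1 m.factorial + 1)

def bnd3 (p m : ℕ) : ℕ := (bnd2 p (bnd1 m) m) ^ (bnd2 p (bnd1 m) m + 1)

lemma main_hyp {G : Type} [Group G] [Finite G] [hs : Group.IsSolvable G] {φ : G →* G} {p m : ℕ}
    (hyp : Hyp G φ p m) :
    ∃ H : Subgroup G, H.Normal ∧ H.index ≤ bnd3 p m * bnd3 p m ^ bnd3 p m ∧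
        ∃ K : Subgroup ↥H, ∃ _ : K.Normal,
          Group.IsNilpotent ↥K ∧ Group.IsNilpotent (↥H ⧸ K) := by
  obtain ⟨F0, hF0⟩ := exists_isMaxNil φ
  have hn0 := hF0.normal
  have hyp1 := hyp.quot F0 hF0.inv
  obtain ⟨F1, hF1⟩ := exists_isMaxNil (qmap F0 φ hF0.inv)
  have hn1 := hF1.normal
  have hyp2 := hyp1.quot F1 hF1.inv
  obtain ⟨F2, hF2⟩ := exists_isMaxNil (qmap F1 _ hF1.inv)
  have hn2 := hF2.normal
  have hk := prop1 hyp F0 hF0 F1 hF1.toIsInvNil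
  have hF2c := prop2 hyp1 F1 hF1 F2 hF2.toIsInvNil _ hk
  have hcent := centralizer_le_max (qmap F1 _ hF1.inv) p hyp.prime.pos hyp2.iter F2 hF2
  have hG2 := card_le_of_centralizer F2 hcent _ hF2c
  let H := F1.comap (QuotientGroup.mk' F0)
  have hFH : F0 ≤ H := by
    intro x hx
    change QuotientGroup.mk' F0 x ∈ F1
    rw [show QuotientGroup.mk' F0 x = 1 from (QuotientGroup.eq_one_iff _).mpr hx]
    exact F1.one_mem
  refine ⟨H, inferInstance, ?_, F0.subgroupOf H, inferInstance, ?_, ?_⟩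
  · rw [Subgroup.index_comap_of_surjective _ (QuotientGroup.mk'_surjective F0)]
    exact hG2
  · have := hF0.nil
    exact Group.nilpotent_of_mulEquiv (Subgroup.subgroupOfEquivOfLe hFH).symm
  · let π : H →* F1 := ((QuotientGroup.mk' F0).comp H.subtype).codRestrict F1 (fun x => x.2)
    have hker : π.ker = F0.subgroupOf H := by
      ext x
      rw [MonoidHom.mem_ker, Subgroup.mem_subgroupOf]
      constructor
      · intro h
        exact (QuotientGroup.eq_one_iff _).mp (congrArg Subtype.val h)
      · intro h
        exact Subtype.ext ((QuotientGroup.eq_one_iff _).mpr h)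
    have := hF1.nil
    have h1 : Group.IsNilpotent (H ⧸ π.ker) :=
      Group.nilpotent_of_mulEquiv (QuotientGroup.quotientKerEquivRange π).symm
    exact Group.nilpotent_of_mulEquiv (QuotientGroup.quotientMulEquivOfEq hker)

end Assembly

theorem stmt7 :
    ∃ f : ℕ → ℕ → ℕ, ∀ (G : Type) (_ : Group G) (_ : Finite G) (_ : IsSolvable G)
      (φ : G ≃* G) (m : ℕ),
      (orderOf φ).Prime → Nat.Coprime (orderOf φ) (Nat.card G) → 0 < m →
      (∀ g : G, φ g = g → ∃ E : Set G, IsLeftEngelSink g E ∧ E.ncard ≤ m) →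
      ∃ H : Subgroup G, H.Normal ∧ H.index ≤ f (orderOf φ) m ∧
        ∃ K : Subgroup ↥H, ∃ _ : K.Normal,
          Group.IsNilpotent ↥K ∧ Group.IsNilpotent (↥H ⧸ K) := by
  refine ⟨fun p m => bnd3 p m * bnd3 p m ^ bnd3 p m, ?_⟩
  intro G _ _ hs φ m hp hcop _ hsink
  have hs' : Group.IsSolvable G := hs
  refine main_hyp (φ := φ.toMonoidHom) ⟨hp, ?_, hcop, hsink⟩
  intro x
  have hpow : ∀ i : ℕ, ∀ x, (φ.toMonoidHom)^[i] x = (φ ^ i : MulAut G) x := by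
    intro i
    induction i with
    | zero => intro x; rfl
    | succ i ih =>
      intro x
      rw [Function.iterate_succ_apply', ih, pow_succ']
      rfl
  rw [hpow]
  have : (φ ^ orderOf φ : MulAut G) = 1 := pow_orderOf_eq_one φ
  rw [this]
  rfl
end

section
/- Let G be a finite soluble group with trivial centre Z(G) = 1 whose quotient G/F(G) by the Fitting subgroup F = F(G) is nilpotent, admitting an automorphism φ of prime order coprime to |G|. Suppose F(G) is a direct product of minimal normal φ-invariant subgroups of G, and let m be a positive integer such that every element g ∈ C_G(φ) has a right Engel sink of cardinality at most m. Then the order of the centralizer C_{G/F}(φ) of the induced automorphism φ on G/F is bounded in terms of m only. -/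
/-- `R` is a right Engel sink of `g`. -/
def IsRightEngelSink {G : Type*} [Group G] (g : G) (R : Set G) : Prop :=
  ∀ x : G, ∃ r₀ : ℕ, ∀ r ≥ r₀, (fun y => engelComm y x)^[r] g ∈ R

/-- `V` is a minimal normal `φ`-invariant subgroup of `G`. -/
def IsMinNormalInv {G : Type*} [Group G] (φ : G ≃* G) (V : Subgroup G) : Prop :=
  V ≠ ⊥ ∧ V.Normal ∧ (∀ v ∈ V, φ v ∈ V) ∧
    ∀ W : Subgroup G, W ≠ ⊥ → W.Normal → (∀ w ∈ W, φ w ∈ W) → W ≤ V → W = V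


/-- The commutator map `a ↦ (k • a) / a`. -/
def dlt {A K : Type*} [CommGroup A] [Group K] [MulDistribMulAction K A] (k : K) : A →* A where
  toFun a := (k • a) / a
  map_one' := by simp
  map_mul' a b := by simp [smul_mul', mul_div_mul_comm]

theorem dlt_apply {A K : Type*} [CommGroup A] [Group K] [MulDistribMulAction K A] (k : K) (a : A) :
    dlt k a = (k • a) / a := rfl

theorem dcount {A K : Type*} [CommGroup A] [Finite A] [Group K] [Finite K]
    [MulDistribMulAction K A] (m : ℕ)
    (h : ∀ k : K, Nat.card (dlt (A := A) k).range ≤ m) :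
    Nat.card A ≤ 2 * m * Nat.card {a : A | Nat.card (MulAction.orbit K a) ≤ 2 * m} := by
  classical
  have := Fintype.ofFinite A
  have := Fintype.ofFinite K
  have e1 : ∑ a : A, Nat.card (MulAction.stabilizer K a)
      = ∑ k : K, Nat.card (dlt (A := A) k).ker := by
    have l1 : ∀ a : A, Nat.card (MulAction.stabilizer K a)
        = ∑ k : K, if k • a = a then 1 else 0 := by
      intro a
      rw [← Finset.sum_filter, Finset.sum_const, smul_eq_mul, mul_one,
        ← Fintype.card_subtype, ← Nat.card_eq_fintype_card]
      rfl
    have l2 : ∀ k : K, Nat.card (dlt (A := A) k).ker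
        = ∑ a : A, if k • a = a then 1 else 0 := by
      intro k
      rw [← Finset.sum_filter, Finset.sum_const, smul_eq_mul, mul_one,
        ← Fintype.card_subtype, ← Nat.card_eq_fintype_card]
      refine Nat.card_congr (Equiv.subtypeEquivRight fun a => ?_)
      rw [MonoidHom.mem_ker, dlt_apply, div_eq_one]
    simp_rw [l1, l2]
    exact Finset.sum_comm
  have e2 : Nat.card K * Nat.card A ≤ m * ∑ k : K, Nat.card (dlt (A := A) k).ker := by
    rw [Finset.mul_sum, Nat.card_eq_fintype_card (α := K), ← Finset.card_univ, ← smul_eq_mul]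
    refine Finset.card_nsmul_le_sum _ _ _ fun k _ => ?_
    rw [← Subgroup.card_mul_index (dlt (A := A) k).ker, Subgroup.index_ker, mul_comm]
    exact Nat.mul_le_mul_right _ (h k)
  have e3 : 2 * m * ∑ a : A, Nat.card (MulAction.stabilizer K a) ≤
      2 * m * (Nat.card K * Nat.card {a : A | Nat.card (MulAction.orbit K a) ≤ 2 * m})
        + Nat.card A * Nat.card K := by
    have l3 : ∀ a : A, 2 * m * Nat.card (MulAction.stabilizer K a) ≤
        2 * m * (Nat.card K * if Nat.card (MulAction.orbit K a) ≤ 2 * m then 1 else 0)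
         + Nat.card K := by
      intro a
      have hos : Nat.card (MulAction.orbit K a) * Nat.card (MulAction.stabilizer K a)
          = Nat.card K := by
        rw [Nat.card_coe_set_eq, ← MulAction.index_stabilizer, mul_comm, Subgroup.card_mul_index]
      split_ifs with hh
      · have := Subgroup.card_le_card_group (MulAction.stabilizer K a)
        nlinarith
      · push Not at hh
        rw [← hos]
        nlinarith
    rw [Finset.mul_sum]
    refine (Finset.sum_le_sum fun a _ => l3 a).trans ?_
    rw [Finset.sum_add_distrib, ← Finset.mul_sum, ← Finset.mul_sum, ← Finset.sum_filter,
      Finset.sum_const, Finset.sum_const, Finset.card_univ, smul_eq_mul, smul_eq_mul, mul_one,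
      ← Fintype.card_subtype, ← Nat.card_eq_fintype_card, ← Nat.card_eq_fintype_card]
    rfl
  have hK : 0 < Nat.card K := Nat.card_pos
  rw [e1] at e3
  refine Nat.le_of_mul_le_mul_left ?_ hK
  nlinarith

theorem keylem {A K : Type*} [CommGroup A] [Finite A] [Group K] [Finite K]
    [MulDistribMulAction K A] (m : ℕ) (hm : 0 < m)
    (hf : ∀ k : K, (∀ a : A, k • a = a) → k = 1)
    (h : ∀ k : K, Nat.card (dlt (A := A) k).range ≤ m)
    (ss : ∀ (k : K) (a : A), dlt k (dlt k a) = 1 → dlt k a = 1) :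
    Nat.card K ≤ m ^ m * (2 * m) ^ (2 * m) * (2 * m) ^ m := by
  classical
  set S : Set A := {a : A | Nat.card (MulAction.orbit K a) ≤ 2 * m} with hS
  set W := Subgroup.closure S with hW
  have hWinv : ∀ (k : K), ∀ a ∈ W, k • a ∈ W := by
    intro k a ha
    induction ha using Subgroup.closure_induction with
    | mem x hx =>
      apply Subgroup.subset_closure
      change Nat.card (MulAction.orbit K (k • x)) ≤ 2 * m
      rw [MulAction.orbit_smul]
      exact hx
    | one => simp
    | mul x y _ _ hx hy => rw [smul_mul']; exact mul_mem hx hy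
    | inv x _ hx => rw [smul_inv']; exact inv_mem hx
  have hWi : W.index ≤ 2 * m := by
    have h1 := dcount m h
    rw [← hS] at h1
    have h2 : Nat.card S ≤ Nat.card W :=
      Nat.card_mono (Set.toFinite (W : Set A)) Subgroup.subset_closure
    have h3 := W.card_mul_index
    have h4 : 0 < Nat.card W := Nat.card_pos
    refine Nat.le_of_mul_le_mul_left ?_ h4
    nlinarith
  obtain ⟨g, hg⟩ := Finite.exists_max (fun k : K => Nat.card (W.map (dlt k)))
  set D := W.map (dlt g) with hD
  have hDm : Nat.card D ≤ m :=
    (Nat.card_mono (Set.toFinite ((dlt (A := A) g).range : Set A))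
      (Subgroup.map_le_range _ _)).trans (h g)
  have hDS : D = Subgroup.closure (dlt g '' S) := by
    rw [hD, hW, MonoidHom.map_closure]
  have h1S : (1 : A) ∈ S := by
    change Nat.card (MulAction.orbit K (1 : A)) ≤ 2 * m
    have : MulAction.orbit K (1 : A) = {1} := by
      ext x; simp [MulAction.mem_orbit_iff, eq_comm]
    rw [this]; simp; omega
  have hs : ∀ d : D, ∃ s ∈ S, (d : A) ∈ dlt g '' S → dlt g s = d := by
    intro d
    by_cases hd : (d : A) ∈ dlt g '' S
    · obtain ⟨s, hs, hsd⟩ := hd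
      exact ⟨s, hs, fun _ => hsd⟩
    · exact ⟨1, h1S, fun hh => absurd hh hd⟩
  choose s hsS hsd using hs
  set U : Subgroup K := ⨅ d : D, MulAction.stabilizer K (s d) with hU
  have := Fintype.ofFinite D
  have hUi : U.index ≤ (2 * m) ^ m := by
    refine (Subgroup.index_iInf_le _).trans ?_
    refine (Finset.prod_le_pow_card _ _ (2 * m) fun d _ => ?_).trans ?_
    · rw [MulAction.index_stabilizer]
      exact hsS d
    · refine Nat.pow_le_pow_right (by omega) ?_
      rw [Finset.card_univ, ← Nat.card_eq_fintype_card]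
      exact hDm
  have hUD : ∀ u ∈ U, ∀ w ∈ W, dlt u w ∈ D := by
    intro u hu w hw
    have h1 : D ≤ W.map (dlt (g * u)) := by
      rw [hDS, Subgroup.closure_le]
      rintro _ ⟨t, ht, rfl⟩
      have htD : dlt g t ∈ D := ⟨t, Subgroup.subset_closure ht, rfl⟩
      refine ⟨s ⟨_, htD⟩, Subgroup.subset_closure (hsS _), ?_⟩
      have h2 := hsd ⟨_, htD⟩ ⟨t, ht, rfl⟩
      have h3 : u • s ⟨_, htD⟩ = s ⟨_, htD⟩ := by
        have := (Subgroup.mem_iInf.1 hu) ⟨_, htD⟩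
        exact this
      rw [dlt_apply, mul_smul, h3, ← dlt_apply, h2]
    have h2 : D = W.map (dlt (g * u)) :=
      Subgroup.eq_of_le_of_card_ge h1 (hg (g * u))
    have h3 : dlt (g * u) w ∈ D := by rw [h2]; exact ⟨w, hw, rfl⟩
    have h4 : dlt g (u • w) ∈ D := ⟨_, hWinv u w hw, rfl⟩
    have h5 : dlt u w = dlt (g * u) w / dlt g (u • w) := by
      simp only [dlt_apply, mul_smul]
      rw [div_div_div_cancel_left]
    rw [h5]; exact div_mem h3 h4
  have hDW : D ≤ W := by
    rintro _ ⟨w, hw, rfl⟩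
    exact div_mem (hWinv g w hw) hw
  let Φ : U → (D → D) × ((A ⧸ W) → (A ⧸ W)) := fun u =>
    (fun d => ⟨dlt (u : K) (d : A), hUD u u.2 d (hDW d.2)⟩,
     fun q => QuotientGroup.mk ((u : K) • q.out))
  have hΦ : Function.Injective Φ := by
    intro u v huv
    have a1 : ∀ d ∈ D, (u : K) • d = (v : K) • d := by
      intro d hd
      have := congrArg Subtype.val (congrFun (congrArg Prod.fst huv) ⟨d, hd⟩)
      simpa [Φ, dlt_apply] using this
    have a2 : ∀ a : A, ((u : K) • a)⁻¹ * (v : K) • a ∈ W := by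
      intro a
      have h1 := congrFun (congrArg Prod.snd huv) (QuotientGroup.mk a)
      simp only [Φ] at h1
      rw [QuotientGroup.eq] at h1
      obtain ⟨w, hw⟩ := QuotientGroup.mk_out_eq_mul W a
      rw [hw, smul_mul', smul_mul'] at h1
      have hu := hWinv u w w.2
      have hv := hWinv v w w.2
      have : ((u : K) • a)⁻¹ * (v : K) • a =
        (((u : K) • a * (u : K) • (w : A))⁻¹ * ((v : K) • a * (v : K) • (w : A)))
          * ((u : K) • (w : A)) * ((v : K) • (w : A))⁻¹ := by
        simp only [mul_inv]
        generalize (u : K) • a = x1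
        generalize (v : K) • a = x2
        generalize (u : K) • (w : A) = x3
        generalize (v : K) • (w : A) = x4
        have : x1⁻¹ * x3⁻¹ * (x2 * x4) * x3 * x4⁻¹ = x1⁻¹ * x2 * (x3⁻¹ * x3) * (x4 * x4⁻¹) := by
          ac_rfl
        rw [this]; simp
      rw [this]
      exact mul_mem (mul_mem h1 hu) (inv_mem hv)
    set t : K := (u : K)⁻¹ * v with ht
    have htU : t ∈ U := mul_mem (inv_mem u.2) v.2
    have b1 : ∀ d ∈ D, dlt t d = 1 := by
      intro d hd
      rw [dlt_apply, div_eq_one, ht, mul_smul, ← a1 d hd, inv_smul_smul]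
    have b2 : ∀ a : A, dlt t a ∈ W := by
      intro a
      have := hWinv (u : K)⁻¹ _ (a2 a)
      rw [smul_mul', smul_inv', inv_smul_smul, ← mul_smul, ← ht] at this
      rw [dlt_apply, div_eq_mul_inv, mul_comm]; exact this
    have b3 : t = 1 := by
      apply hf
      intro a
      rw [← div_eq_one, ← dlt_apply]
      exact ss _ _ (ss _ _ (b1 _ (hUD t htU _ (b2 a))))
    exact Subtype.ext (inv_mul_eq_one.1 b3)
  have hUc : Nat.card U ≤ m ^ m * (2 * m) ^ (2 * m) := by
    refine (Nat.card_le_card_of_injective Φ hΦ).trans ?_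
    rw [Nat.card_prod, Nat.card_fun, Nat.card_fun]
    have p1 : 0 < Nat.card D := Nat.card_pos
    have hq : Nat.card (A ⧸ W) ≤ 2 * m := hWi
    have p2 : 0 < Nat.card (A ⧸ W) := Nat.card_pos
    refine Nat.mul_le_mul ?_ ?_
    · exact (Nat.pow_le_pow_left hDm _).trans (Nat.pow_le_pow_right hm hDm)
    · exact (Nat.pow_le_pow_left hq _).trans (Nat.pow_le_pow_right (by omega) hq)
  rw [← U.card_mul_index]
  exact Nat.mul_le_mul hUc hUi

theorem exists_fix_lift {G : Type*} [Group G] [Finite G] (φ : G ≃* G) (F : Subgroup G)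
    (hp : (orderOf φ).Prime) (hc : Nat.Coprime (orderOf φ) (Nat.card G))
    (g : G) (hg : (QuotientGroup.mk (φ g) : G ⧸ F) = QuotientGroup.mk g)
    (hF : ∀ g, φ g ∈ F ↔ g ∈ F) :
    ∃ y : G, φ y = y ∧ (QuotientGroup.mk y : G ⧸ F) = QuotientGroup.mk g := by
  classical
  have : Fact (orderOf φ).Prime := ⟨hp⟩
  have hP : ∀ y : G, (QuotientGroup.mk (φ.toEquiv y) : G ⧸ F) = QuotientGroup.mk g ↔
      (QuotientGroup.mk y : G ⧸ F) = QuotientGroup.mk g := by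
    intro y
    change (QuotientGroup.mk (φ y) : G ⧸ F) = QuotientGroup.mk g ↔ _
    rw [← hg, QuotientGroup.eq, hg, QuotientGroup.eq, ← map_inv, ← map_mul, hF]
  let σ : Equiv.Perm {y : G // (QuotientGroup.mk y : G ⧸ F) = QuotientGroup.mk g} :=
    Equiv.Perm.subtypePerm (φ.toEquiv : Equiv.Perm G) hP
  have := Fintype.ofFinite {y : G // (QuotientGroup.mk y : G ⧸ F) = QuotientGroup.mk g}
  have hcard : Nat.card {y : G // (QuotientGroup.mk y : G ⧸ F) = QuotientGroup.mk g}
      = Nat.card F := by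
    rw [← Nat.card_congr (Subgroup.leftCosetEquivSubgroup (s := F) g),
      ← QuotientGroup.eq_class_eq_leftCoset F g]
    rfl
  have hσ : σ ^ (orderOf φ) ^ 1 = 1 := by
    have h1 : ∀ n : ℕ, ∀ y, ((σ ^ n) y : G) = (φ ^ n) (y : G) := by
      intro n
      induction n with
      | zero => intro y; rfl
      | succ n ih =>
        intro y
        rw [pow_succ, pow_succ, Equiv.Perm.mul_apply, ih]
        rfl
    ext y
    rw [pow_one, h1, pow_orderOf_eq_one]
    rfl
  obtain ⟨y, hy⟩ := Equiv.Perm.exists_fixed_point_of_prime (p := orderOf φ) (n := 1) (σ := σ) (by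
    rw [← Nat.card_eq_fintype_card, hcard]
    intro hd
    have := Nat.dvd_gcd dvd_rfl (hd.trans (Subgroup.card_subgroup_dvd_card F))
    rw [hc] at this
    exact hp.one_lt.ne' (Nat.dvd_one.1 this)) hσ
  exact ⟨y, congrArg Subtype.val hy, y.2⟩

theorem min_le_center {G : Type*} [Group G] (φ : G ≃* G) (F V : Subgroup G) [hFn : F.Normal]
    (hn : Group.IsNilpotent F) (hF : ∀ g, φ g ∈ F ↔ g ∈ F) (hV : IsMinNormalInv φ V)
    (hVF : V ≤ F) : ∀ v ∈ V, ∀ f ∈ F, v * f = f * v := by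
  obtain ⟨hne, hnorm, hinv, hmin⟩ := hV
  let W : Subgroup G := V ⊓ Subgroup.centralizer F
  have hWne : W ≠ ⊥ := by
    intro hW
    have key : ∀ n : ℕ, ∀ v : F, v ∈ Subgroup.upperCentralSeries F n → (v : G) ∈ V → v = 1 := by
      intro n
      induction n with
      | zero => intro v hv _; simpa using hv
      | succ n ih =>
        intro v hv hvV
        have hc : (v : G) ∈ W := by
          refine Subgroup.mem_inf.2 ⟨hvV, ?_⟩
          rw [Subgroup.mem_centralizer_iff]
          intro f hf
          have h1 := (Subgroup.mem_upperCentralSeries_succ_iff).1 hv ⟨f, hf⟩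
          have h2 := ih _ h1 (by
            have := mul_mem hvV (hnorm.conj_mem _ (inv_mem hvV) f)
            simpa [commutatorElement_def, mul_assoc] using this)
          have h3 := congrArg Subtype.val h2
          simp only [commutatorElement_def, Subgroup.coe_mul, Subgroup.coe_inv,
            Subgroup.coe_one] at h3
          rw [mul_inv_eq_one, mul_inv_eq_iff_eq_mul] at h3
          exact h3.symm
        rw [hW, Subgroup.mem_bot] at hc
        exact Subtype.ext hc
    obtain ⟨n, hn⟩ := hn.nilpotent
    apply hne
    rw [eq_bot_iff]
    intro v hv
    have := key n ⟨v, hVF hv⟩ (by rw [hn]; trivial) hv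
    exact congrArg Subtype.val this
  have hWV : W = V := by
    refine hmin W hWne ⟨fun w hw g => ⟨hnorm.conj_mem w hw.1 g, ?_⟩⟩ (fun w hw => Subgroup.mem_inf.2 ⟨hinv w hw.1, ?_⟩)
      inf_le_left
    · exact (Subgroup.normal_centralizer (H := F)).conj_mem w hw.2 g
    · have h2 := (Subgroup.mem_inf.1 hw).2
      rw [Subgroup.mem_centralizer_iff] at h2 ⊢
      intro f hf
      have h3 := h2 (φ.symm f) (by rw [SetLike.mem_coe, ← hF]; simpa using hf)
      simpa using congrArg φ h3
  intro v hv f hf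
  rw [← hWV] at hv
  exact ((Subgroup.mem_centralizer_iff.1 hv.2) f hf).symm

theorem min_struct {G : Type*} [Group G] [Finite G] (φ : G ≃* G) (F V : Subgroup G)
    [hFn : F.Normal] (hq : Group.IsNilpotent (G ⧸ F))
    (hF : ∀ g, φ g ∈ F ↔ g ∈ F) (hV : IsMinNormalInv φ V) (hVF : V ≤ F)
    (hab : ∀ v ∈ V, ∀ f ∈ F, v * f = f * v) :
    ∃ p : ℕ, p.Prime ∧ (∀ v ∈ V, v ^ p = 1) ∧
      ∀ (g : G) (n : ℕ), g ^ p ^ n ∈ F → ∀ v ∈ V, g * v = v * g := by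
  obtain ⟨hne, hnorm, hinv, hmin⟩ := hV
  obtain ⟨p, hp, hpd⟩ := Nat.exists_prime_and_dvd
    (show Nat.card V ≠ 1 by rwa [Ne, Subgroup.card_eq_one])
  have : Fact p.Prime := ⟨hp⟩
  refine ⟨p, hp, ?_, ?_⟩
  · let W : Subgroup G :=
      { carrier := {v | v ∈ V ∧ v ^ p = 1}
        one_mem' := ⟨one_mem _, one_pow _⟩
        mul_mem' := by
          rintro a b ⟨ha, ha'⟩ ⟨hb, hb'⟩
          refine ⟨mul_mem ha hb, ?_⟩
          have : Commute a b := hab a ha b (hVF hb)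
          rw [this.mul_pow, ha', hb', one_mul]
        inv_mem' := by
          rintro a ⟨ha, ha'⟩
          exact ⟨inv_mem ha, by rw [inv_pow, ha', inv_one]⟩ }
    have hWV : W = V := by
      refine hmin W ?_ ⟨?_⟩ ?_ (fun w hw => hw.1)
      · obtain ⟨x, hx⟩ := exists_prime_orderOf_dvd_card' p hpd
        intro hW
        have h1 : (x : G) ∈ W := ⟨x.2, by
          have := pow_orderOf_eq_one x
          rw [hx] at this
          exact congrArg Subtype.val this⟩
        rw [hW, Subgroup.mem_bot] at h1
        have h2 : x = 1 := Subtype.ext h1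
        rw [h2, orderOf_one] at hx
        exact hp.one_lt.ne hx
      · rintro w ⟨hw, hw'⟩ g
        exact ⟨hnorm.conj_mem w hw g, by rw [conj_pow, hw']; simp⟩
      · rintro w ⟨hw, hw'⟩
        exact ⟨hinv w hw, by rw [← map_pow, hw', map_one]⟩
    intro v hv
    rw [← hWV] at hv
    exact hv.2
  · let W : Subgroup G :=
      { carrier := {v | v ∈ V ∧ ∀ (g : G) (n : ℕ), g ^ p ^ n ∈ F → g * v = v * g}
        one_mem' := ⟨one_mem _, by simp⟩
        mul_mem' := by
          rintro a b ⟨ha, ha'⟩ ⟨hb, hb'⟩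
          refine ⟨mul_mem ha hb, fun g n hg => ?_⟩
          rw [← mul_assoc, ha' g n hg, mul_assoc, hb' g n hg, mul_assoc]
        inv_mem' := by
          rintro a ⟨ha, ha'⟩
          refine ⟨inv_mem ha, fun g n hg => ?_⟩
          have : Commute g a := ha' g n hg
          exact this.inv_right }
    have hWV : W = V := by
      refine hmin W ?_ ⟨?_⟩ ?_ (fun w hw => hw.1)
      · let Q : Sylow p G := default
        let Q' : Subgroup (MulAut V) := (Q : Subgroup G).map (MulAut.conjNormal (H := V))
        have hQ' : IsPGroup p Q' := Q.2.map _
        obtain ⟨b, hb, hb1⟩ := hQ'.exists_fixed_point_of_prime_dvd_card_of_fixed_point V hpd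
          (a := 1) (fun k => smul_one k)
        intro hW
        have hbW : (b : G) ∈ W := by
          refine ⟨b.2, fun g n hg => ?_⟩
          let P : Sylow p (G ⧸ F) := Q.mapSurjective (QuotientGroup.mk'_surjective F)
          have hPn : (P : Subgroup (G ⧸ F)).Normal := inferInstance
          have hz : IsPGroup p (Subgroup.zpowers (QuotientGroup.mk g : G ⧸ F)) := by
            have h0 : (QuotientGroup.mk g : G ⧸ F) ^ p ^ n = 1 := by
              rw [← QuotientGroup.mk_pow]; exact (QuotientGroup.eq_one_iff _).2 hg
            obtain ⟨j, _, hj⟩ := (Nat.dvd_prime_pow hp).1 (orderOf_dvd_of_pow_eq_one h0)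
            exact IsPGroup.of_card (n := j) (by rw [Nat.card_zpowers, hj])
          obtain ⟨P1, hP1⟩ := hz.exists_le_sylow
          have hPP : P1 = P := by
            have := Sylow.unique_of_normal P hPn
            exact Subsingleton.elim _ _
          have hgP : (QuotientGroup.mk g : G ⧸ F) ∈ P := by
            rw [← hPP]; exact hP1 (Subgroup.mem_zpowers _)
          obtain ⟨q, hq, hqg⟩ : ∃ q ∈ (Q : Subgroup G), QuotientGroup.mk' F q = QuotientGroup.mk g :=
            hgP
          have hqg' : q⁻¹ * g ∈ F := QuotientGroup.eq.1 hqg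
          have h1 := hb ⟨MulAut.conjNormal q, ⟨q, hq, rfl⟩⟩
          have h2 : q * b * q⁻¹ = b := congrArg Subtype.val h1
          have h3 := hab b b.2 _ hqg'
          rw [mul_inv_eq_iff_eq_mul] at h2
          calc g * b = q * (q⁻¹ * g * b) := by group
            _ = q * b * (q⁻¹ * g) := by rw [← h3, mul_assoc]
            _ = b * g := by rw [h2]; group
        rw [hW, Subgroup.mem_bot] at hbW
        exact hb1 (Subtype.ext hbW.symm)
      · rintro w ⟨hw, hw'⟩ g
        refine ⟨hnorm.conj_mem w hw g, fun x n hx => ?_⟩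
        have h1 := hw' (g⁻¹ * x * g) n (by
          have := hFn.conj_mem _ hx g⁻¹
          rw [← conj_pow, inv_inv] at this
          exact this)
        calc x * (g * w * g⁻¹) = g * (g⁻¹ * x * g * w) * g⁻¹ := by group
          _ = g * w * g⁻¹ * x := by rw [h1]; group
      · rintro w ⟨hw, hw'⟩
        refine ⟨hinv w hw, fun x n hx => ?_⟩
        have h1 := hw' (φ.symm x) n (by rw [← hF]; simpa using hx)
        simpa using congrArg φ h1
    intro g n hg v hv
    rw [← hWV] at hv
    exact hv.2 g n hg

theorem min_ss {G : Type*} [Group G] [Finite G] (F V : Subgroup G)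
    [hFn : F.Normal] (hVn : V.Normal) (p : ℕ) (hp : p.Prime) (hVp : ∀ v ∈ V, v ^ p = 1)
    (hc : ∀ (g : G) (n : ℕ), g ^ p ^ n ∈ F → ∀ v ∈ V, g * v = v * g)
    (hab : ∀ v ∈ V, ∀ w ∈ V, v * w = w * v)
    (g v : G) (hv : v ∈ V)
    (h : g * (g * v * g⁻¹ * v⁻¹) * g⁻¹ * (g * v * g⁻¹ * v⁻¹)⁻¹ = 1) :
    g * v * g⁻¹ * v⁻¹ = 1 := by
  set w := g * v * g⁻¹ * v⁻¹ with hw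
  have hwV : w ∈ V := mul_mem (hVn.conj_mem v hv g) (inv_mem hv)
  have h1 : g * w * g⁻¹ = w := by rwa [mul_inv_eq_one] at h
  have h2 : g * v * g⁻¹ = w * v := by rw [hw]; group
  have h3 : ∀ j : ℕ, g ^ j * v * (g ^ j)⁻¹ = w ^ j * v := by
    intro j
    induction j with
    | zero => simp
    | succ j ih =>
      have h1' : g * w ^ j * g⁻¹ = w ^ j := by rw [← conj_pow, h1]
      calc g ^ (j + 1) * v * (g ^ (j + 1))⁻¹ = g * (g ^ j * v * (g ^ j)⁻¹) * g⁻¹ := by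
            rw [pow_succ']; group
        _ = (g * w ^ j * g⁻¹) * (g * v * g⁻¹) := by rw [ih]; group
        _ = w ^ (j + 1) * v := by rw [h1', h2, pow_succ]; group
  obtain ⟨a, n, hn, hpn⟩ := Nat.exists_eq_pow_mul_and_not_dvd
    (n := orderOf g) (orderOf_pos g).ne' p hp.ne_one
  have h4 := hc (g ^ n) a (by
    rw [← pow_mul, mul_comm, ← hpn, pow_orderOf_eq_one]; exact one_mem _) v hv
  have h5 := h3 n
  rw [h4, mul_inv_cancel_right, right_eq_mul] at h5
  have h6 : orderOf w ∣ 1 := by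
    have hco : Nat.Coprime p n := (Nat.Prime.coprime_iff_not_dvd hp).2 hn
    rw [← hco]
    exact Nat.dvd_gcd (orderOf_dvd_of_pow_eq_one (hVp w hwV)) (orderOf_dvd_of_pow_eq_one h5)
  exact orderOf_eq_one_iff.1 (Nat.dvd_one.1 h6)

theorem ss_of_range {A : Type*} [CommGroup A] [Finite A] (d : A →* A)
    (h : ∀ y, ∃ z, d y = d (d z)) (y : A) (hy : d (d y) = 1) : d y = 1 := by
  let f : d.range → d.range := fun x => ⟨d x, ⟨_, rfl⟩⟩
  have hs : Function.Surjective f := by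
    rintro ⟨_, ⟨y, rfl⟩⟩
    obtain ⟨z, hz⟩ := h y
    exact ⟨⟨d z, ⟨z, rfl⟩⟩, Subtype.ext hz.symm⟩
  have hi := Finite.injective_iff_surjective.2 hs
  have := @hi ⟨d y, ⟨y, rfl⟩⟩ 1 (Subtype.ext (by simp [f, hy]))
  exact congrArg Subtype.val this

theorem iter_of_range {A : Type*} [CommGroup A] (d : A →* A)
    (h : ∀ y, ∃ z, d y = d (d z)) (r : ℕ) : ∀ y, ∃ z, d y = d^[r + 1] z := by
  induction r with
  | zero => intro y; exact ⟨y, rfl⟩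
  | succ r ih =>
    intro y
    obtain ⟨z, hz⟩ := h y
    obtain ⟨z', hz'⟩ := ih z
    refine ⟨z', ?_⟩
    rw [Function.iterate_succ_apply', ← hz', hz]

/-- If the subgroups generating `A` are invariant and semisimple, then `d A = d (d A)`. -/
theorem range_of_ss {A : Type*} [CommGroup A] [Finite A] (d : A →* A) (V : Subgroup A)
    (hV : ∀ v ∈ V, d v ∈ V) (h : ∀ v ∈ V, d (d v) = 1 → d v = 1) :
    ∀ v ∈ V, ∃ z, d v = d (d z) := by
  let D := V.map d
  have hDV : D ≤ V := by rintro _ ⟨v, hv, rfl⟩; exact hV v hv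
  let f : D → D := fun x => ⟨d x, ⟨x, hDV x.2, rfl⟩⟩
  have hi : Function.Injective f := by
    rintro ⟨_, ⟨x, hx, rfl⟩⟩ ⟨_, ⟨y, hy, rfl⟩⟩ hxy
    have h1 : d (d x) = d (d y) := congrArg Subtype.val hxy
    have h2 := h (x / y) (div_mem hx hy) (by rw [map_div, map_div, h1, div_self'])
    rw [map_div, div_eq_one] at h2
    exact Subtype.ext h2
  have hs := Finite.injective_iff_surjective.1 hi
  intro v hv
  obtain ⟨⟨_, ⟨z, hz, rfl⟩⟩, hx⟩ := hs ⟨d v, ⟨v, hv, rfl⟩⟩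
  exact ⟨z, (congrArg Subtype.val hx).symm⟩

theorem stmt10 :
    ∃ f : ℕ → ℕ, ∀ (G : Type) (_ : Group G) (_ : Finite G) (_ : IsSolvable G)
      (φ : G ≃* G) (m : ℕ) (F : Subgroup G) (hFn : F.Normal),
      Subgroup.center G = ⊥ →
      (orderOf φ).Prime → Nat.Coprime (orderOf φ) (Nat.card G) → 0 < m →
      -- `F` is the Fitting subgroup: the largest nilpotent normal subgroup
      Group.IsNilpotent ↥F →
      (∀ K : Subgroup G, K.Normal → Group.IsNilpotent ↥K → K ≤ F) →
      -- `G/F` is nilpotent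
      Group.IsNilpotent (G ⧸ F) →
      -- `F` is a direct product of minimal normal `φ`-invariant subgroups
      (∃ (k : ℕ) (V : Fin k → Subgroup G),
        (∀ i, IsMinNormalInv φ (V i)) ∧ iSupIndep V ∧ (⨆ i, V i) = F) →
      -- every fixed point of `φ` has a right Engel sink of cardinality at most `m`
      (∀ g : G, φ g = g → ∃ R : Set G, IsRightEngelSink g R ∧ R.ncard ≤ m) →
      -- conclusion: the fixed points of the automorphism induced by `φ` on `G/F`
      -- number at most `f m`
      ∀ ψ : (G ⧸ F) ≃* (G ⧸ F),
        (∀ g : G, ψ (QuotientGroup.mk g) = QuotientGroup.mk (φ g)) →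
        Nat.card {x : G ⧸ F | ψ x = x} ≤ f m := by
  refine ⟨fun m => m ^ m * (2 * m) ^ (2 * m) * (2 * m) ^ m, ?_⟩
  intro G _ _ _ φ m F hFn _ hp hcop hm hFnil hFmax hqnil hV hsink ψ hψ
  obtain ⟨k, V, hVmin, -, hVF⟩ := hV
  -- `F` is `φ`-invariant
  have hmapF : ∀ χ : G ≃* G, ∀ g ∈ F, χ g ∈ F := by
    intro χ g hg
    have hN : (F.map χ.toMonoidHom).Normal := hFn.map _ χ.surjective
    have hnil : Group.IsNilpotent (F.map χ.toMonoidHom) :=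
      Group.nilpotent_of_mulEquiv (χ.subgroupMap F)
    exact hFmax _ hN hnil ⟨g, hg, rfl⟩
  have hF : ∀ g, φ g ∈ F ↔ g ∈ F := by
    intro g
    refine ⟨fun h => ?_, hmapF φ g⟩
    simpa using hmapF φ.symm _ h
  have hVle : ∀ i, V i ≤ F := fun i => hVF ▸ le_iSup V i
  have hVc : ∀ i, ∀ v ∈ V i, ∀ f ∈ F, v * f = f * v := fun i =>
    min_le_center φ F (V i) hFnil hF (hVmin i) (hVle i)
  -- `F` is abelian
  have hFc : ∀ a ∈ F, ∀ b ∈ F, a * b = b * a := by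
    have h1 : F ≤ Subgroup.centralizer (F : Set G) := by
      conv_lhs => rw [← hVF]
      refine iSup_le fun i v hv => ?_
      rw [Subgroup.mem_centralizer_iff]
      intro f hf
      exact (hVc i v hv f hf).symm
    intro a ha b hb
    exact ((Subgroup.mem_centralizer_iff.1 (h1 ha)) b hb).symm
  -- `F` contains its centralizer
  have hCF : Subgroup.centralizer (F : Set G) ≤ F := by
    refine hFmax _ inferInstance ?_
    refine Subgroup.isNilpotent_of_ker_le_center
      ((QuotientGroup.mk' F).comp (Subgroup.centralizer (F : Set G)).subtype) ?_
    intro x hx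
    have hxF : (x : G) ∈ F := (QuotientGroup.eq_one_iff _).1 hx
    rw [Subgroup.mem_center_iff]
    intro y
    exact Subtype.ext ((Subgroup.mem_centralizer_iff.1 y.2) x hxF).symm
  letI : CommGroup F := { (inferInstance : Group F) with
    mul_comm := fun a b => Subtype.ext (hFc a a.2 b b.2) }
  let C : Subgroup G := MonoidHom.eqLocus φ.toMonoidHom (MonoidHom.id G)
  let K : Subgroup (MulAut F) := C.map (MulAut.conjNormal (H := F))
  have hdl : ∀ (κ : K) (g : G), MulAut.conjNormal g = (κ : MulAut F) → ∀ y : F,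
      ((dlt κ y : F) : G) = g * y * g⁻¹ * (y : G)⁻¹ := by
    intro κ g hg y
    have h1 : ((κ • y : F) : G) = g * y * g⁻¹ := by
      change (((κ : MulAut F) y : F) : G) = _
      rw [← hg, MulAut.conjNormal_apply]
    rw [dlt_apply, div_eq_mul_inv, ← h1]
    rfl
  have hrange : ∀ (κ : K) (y : F), ∃ z : F, dlt κ y = dlt κ (dlt κ z) := by
    intro κ
    obtain ⟨g, -, hg⟩ := κ.2
    have hd := hdl κ g hg
    have h1 : ∀ i, V i ≤ ((((dlt κ).comp (dlt κ)).range.comap (dlt κ) : Subgroup F)).map F.subtype := by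
      intro i v hv
      obtain ⟨p, hpp, hVp, hVcc⟩ := min_struct φ F (V i) hqnil hF (hVmin i) (hVle i) (hVc i)
      have hVn := (hVmin i).2.1
      obtain ⟨z, hz⟩ := range_of_ss (dlt κ) ((V i).subgroupOf F) (by
          intro v hv
          rw [Subgroup.mem_subgroupOf] at hv ⊢
          rw [hd]
          exact mul_mem (hVn.conj_mem _ hv g) (inv_mem hv)) (by
          intro v hv hvv
          rw [Subgroup.mem_subgroupOf] at hv
          have h2 : ((dlt κ (dlt κ v) : F) : G) = 1 := by rw [hvv]; rfl
          rw [hd, hd] at h2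
          have h3 := min_ss F (V i) hVn p hpp hVp hVcc
            (fun a ha b hb => hVc i a ha b (hVle i hb)) g v hv h2
          apply Subtype.ext
          rw [hd, h3]; rfl) ⟨v, hVle i hv⟩ hv
      exact ⟨⟨v, hVle i hv⟩, ⟨z, hz.symm⟩, rfl⟩
    intro y
    have h2 : (y : G) ∈ ⨆ i, V i := by rw [hVF]; exact y.2
    obtain ⟨y', ⟨z, hz⟩, hy'⟩ := (iSup_le h1) h2
    have h3 : y' = y := Subtype.ext hy'
    rw [h3] at hz
    exact ⟨z, hz.symm⟩
  -- the sinks bound the commutators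
  have hbd : ∀ κ : K, Nat.card (dlt (A := F) κ).range ≤ m := by
    intro κ
    obtain ⟨g, hgC, hg⟩ := κ.2
    have hd := hdl κ g hg
    have hgφ : φ g = g := hgC
    obtain ⟨R, hR, hRm⟩ := hsink g⁻¹ (by rw [map_inv, hgφ])
    have hit : ∀ (v : F) (r : ℕ), (fun y => engelComm y (g⁻¹ * (v : G)))^[r + 1] g⁻¹
        = (((dlt κ)^[r + 1] v⁻¹ : F) : G) := by
      intro v r
      induction r with
      | zero =>
        simp only [zero_add, Function.iterate_one]
        rw [hd, engelComm]
        simp only [Subgroup.coe_inv]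
        group
      | succ r ih =>
        rw [Function.iterate_succ_apply', ih, show (dlt κ)^[r + 1 + 1] v⁻¹ = dlt κ ((dlt κ)^[r + 1] v⁻¹) from
          Function.iterate_succ_apply' _ _ _]
        generalize (dlt κ)^[r + 1] v⁻¹ = y
        rw [hd]
        have h1 : g * y * g⁻¹ ∈ F := hFn.conj_mem _ y.2 g
        rw [engelComm]
        calc (y : G)⁻¹ * (g⁻¹ * (v : G))⁻¹ * y * (g⁻¹ * v)
            = (y : G)⁻¹ * ((v : G)⁻¹ * (g * y * g⁻¹)) * v := by group
          _ = (y : G)⁻¹ * (g * y * g⁻¹) := by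
              rw [hFc _ (inv_mem v.2) _ h1]; group
          _ = g * y * g⁻¹ * (y : G)⁻¹ := hFc _ (inv_mem y.2) _ h1
    choose r₀ hr₀ using fun v : F => hR (g⁻¹ * (v : G))
    obtain ⟨v₁, hv₁⟩ := Finite.exists_max r₀
    have hsub : ((fun y : F => (y : G)) '' ((dlt (A := F) κ).range : Set F)) ⊆ R := by
      rintro _ ⟨_, ⟨y, rfl⟩, rfl⟩
      obtain ⟨z, hz⟩ := iter_of_range (dlt κ) (hrange κ) (r₀ v₁) y
      have h1 := hr₀ z⁻¹ (r₀ v₁ + 1) ((hv₁ _).trans (Nat.le_succ _))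
      rw [hit, inv_inv, ← hz] at h1
      exact h1
    have h2 := Set.ncard_le_ncard hsub (Set.toFinite R)
    rw [Set.ncard_image_of_injective _ Subtype.val_injective] at h2
    exact h2.trans hRm
  have hK := keylem (A := F) (K := K) m hm
    (fun κ hκ => Subtype.ext (MulEquiv.ext fun a => hκ a)) hbd
    (fun κ a h => ss_of_range (dlt κ) (hrange κ) a h)
  refine le_trans ?_ hK
  have hlift : ∀ x : {x : G ⧸ F | ψ x = x}, ∃ y : G, φ y = y ∧ (QuotientGroup.mk y : G ⧸ F) = x := by
    rintro ⟨x, hx⟩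
    obtain ⟨g, rfl⟩ := QuotientGroup.mk_surjective x
    have hx' : ψ (QuotientGroup.mk g) = QuotientGroup.mk g := hx
    rw [hψ] at hx'
    exact exists_fix_lift φ F hp hcop g hx' hF
  choose l hl1 hl2 using hlift
  refine Nat.card_le_card_of_injective
    (fun x => (⟨MulAut.conjNormal (l x), ⟨l x, hl1 x, rfl⟩⟩ : K)) ?_
  intro x y hxy
  have h1 : MulAut.conjNormal (H := F) (l x) = MulAut.conjNormal (l y) := congrArg Subtype.val hxy
  apply Subtype.ext
  rw [← hl2, ← hl2, QuotientGroup.eq]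
  apply hCF
  rw [Subgroup.mem_centralizer_iff]
  intro f hf
  have h2 := congrArg Subtype.val (DFunLike.congr_fun h1 ⟨f, hf⟩)
  rw [MulAut.conjNormal_apply, MulAut.conjNormal_apply] at h2
  have h3 : l x * f * (l x)⁻¹ = l y * f * (l y)⁻¹ := h2
  calc f * ((l x)⁻¹ * l y) = (l x)⁻¹ * (l x * f * (l x)⁻¹) * l y := by group
    _ = (l x)⁻¹ * l y * f := by rw [h3]; group
end

section
/- Let G be a finite soluble group with trivial centre Z(G) = 1 whose quotient G/F(G) by the Fitting subgroup F = F(G) is nilpotent, admitting an automorphism φ of prime order coprime to |G| such that the induced automorphism on G/F is fixed-point-free (C_{G/F}(φ) = 1). Suppose F is a direct product of minimal normal φ-invariant subgroups of G, and let m be a positive integer such that every element g ∈ C_G(φ) has a right Engel sink of cardinality at most m. Then for each minimal normal φ-invariant factor V of F, the order of G/C_G(V) is bounded in terms of m only. -/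
theorem fix_lemma {K M : Type*} [Group K] [AddCommGroup M] [DistribMulAction K M]
    (H : Subgroup K) [Finite H] (Φ : K) (p : ℕ) (hp : p.Prime) (hΦ : Φ ^ p = 1)
    (hnorm : ∀ h ∈ H, Φ * h * Φ⁻¹ ∈ H)
    (hconj : ∀ h ∈ H, ∃ k ∈ H, h * Φ = k⁻¹ * Φ * k)
    (hfix : ∀ v : M, (∀ h ∈ H, h • v = v) → v = 0)
    (hcop : ∀ v : M, Nat.card H • v = 0 → v = 0)
    (hΦfix : ∀ v : M, Φ • v = v → v = 0) : ∀ v : M, v = 0 := by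
  classical
  have := Fintype.ofFinite H
  intro v
  have hpow : ∀ h ∈ H, (h * Φ) ^ p = 1 := by
    intro h hh
    obtain ⟨k, _, e⟩ := hconj h hh
    have : k⁻¹ * Φ * k = k⁻¹ * Φ * k⁻¹⁻¹ := by simp
    rw [e, this, conj_pow, hΦ]; simp
  have hfp : ∀ h ∈ H, ∀ w : M, (h * Φ) • w = w → w = 0 := by
    intro h hh w hw
    obtain ⟨k, _, e⟩ := hconj h hh
    rw [e] at hw
    have h1 : Φ • (k • w) = k • w := by
      conv_rhs => rw [← hw]
      simp [← mul_smul, mul_assoc]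
    have := hΦfix _ h1
    exact (smul_eq_zero_iff_eq k).1 this
  have hsum : ∀ h ∈ H, ∑ i ∈ Finset.range p, (h * Φ) ^ i • v = 0 := by
    intro h hh
    apply hfp h hh
    rw [Finset.smul_sum]
    simp_rw [← mul_smul, ← pow_succ']
    have h1 := Finset.sum_range_succ (fun i => (h * Φ) ^ i • v) p
    rw [Finset.sum_range_succ'] at h1
    rw [hpow h hh] at h1
    simpa using h1
  have hmem : ∀ i : ℕ, ∀ h ∈ H, (h * Φ) ^ i * (Φ ^ i)⁻¹ ∈ H := by
    intro i
    induction i with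
    | zero => intro h hh; simp
    | succ i ih =>
      intro h hh
      have : (h * Φ) ^ (i+1) * (Φ ^ (i+1))⁻¹ = h * (Φ * ((h * Φ) ^ i * (Φ ^ i)⁻¹) * Φ⁻¹) := by
        rw [pow_succ' (h * Φ), pow_succ' Φ, mul_inv_rev]; 
        simp only [mul_assoc]
      rw [this]
      exact H.mul_mem hh (hnorm _ (ih h hh))
  have hz : ∀ w : M, ∑ h : H, (h : K) • w = 0 := by
    intro w
    apply hfix
    intro h hh
    rw [Finset.smul_sum]
    simp_rw [← mul_smul]
    exact Fintype.sum_equiv (Equiv.mulLeft (⟨h, hh⟩ : H)) _ _ (fun x => rfl)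
  have hi : ∀ i ∈ Finset.range p, i ≠ 0 → ∑ h : H, ((h : K) * Φ) ^ i • v = 0 := by
    intro i hip hi0
    have hcopr : Nat.Coprime i p :=
      (Nat.Coprime.symm (Nat.coprime_of_lt_prime hi0 (Finset.mem_range.1 hip) hp))
    let T : H → H := fun h => ⟨(h * Φ) ^ i * (Φ ^ i)⁻¹, hmem i h h.2⟩
    have hinj : Function.Injective T := by
      intro a b hab
      have h1 : ((a : K) * Φ) ^ i = (b * Φ) ^ i := by
        have := congrArg Subtype.val hab
        exact mul_right_cancel this
      obtain ⟨j, hj⟩ := Nat.exists_mul_mod_eq_one_of_coprime hcopr hp.one_lt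
      have key : ∀ h ∈ H, ((h * Φ) ^ i) ^ j = h * Φ := by
        intro h hh
        rw [← pow_mul, pow_eq_pow_mod _ (hpow h hh), hj.2, pow_one]
      have h2 := key a a.2
      rw [h1, key b b.2] at h2
      exact Subtype.ext (mul_right_cancel h2).symm
    have hbij := Finite.injective_iff_bijective.1 hinj
    rw [← hz (Φ ^ i • v)]
    refine Fintype.sum_bijective T hbij _ _ ?_
    intro h
    simp [T, ← mul_smul]
  have htot : ∑ i ∈ Finset.range p, ∑ h : H, ((h : K) * Φ) ^ i • v = 0 := by
    rw [Finset.sum_comm]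
    exact Finset.sum_eq_zero (fun h _ => hsum h h.2)
  rw [Finset.sum_eq_single_of_mem 0 (Finset.mem_range.2 hp.pos) hi] at htot
  apply hcop
  simpa using htot

theorem cop_lemma {K M : Type*} [Group K] [AddCommGroup M] [DistribMulAction K M]
    [FaithfulSMul K M] [Finite M] [Nontrivial M]
    (H : Subgroup K) [Finite H] [Group.IsNilpotent H] (Φ : K) (q : ℕ) [Fact q.Prime]
    (hq : ∀ v : M, q • v = 0)
    (hnorm : ∀ h ∈ H, Φ⁻¹ * h * Φ ∈ H)
    (hirr : ∀ W : AddSubgroup M, (∀ h ∈ H, ∀ w ∈ W, h • w ∈ W) → (∀ w ∈ W, Φ • w ∈ W) →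
      W = ⊥ ∨ W = ⊤) : ¬ q ∣ Nat.card H := by
  intro hdvd
  let W : AddSubgroup M :=
    { carrier := {v | ∀ h ∈ H, (∃ n : ℕ, h ^ q ^ n = 1) → h • v = v}
      zero_mem' := by simp
      add_mem' := by
        intro a b ha hb h hh hn
        rw [smul_add, ha h hh hn, hb h hh hn]
      neg_mem' := by
        intro a ha h hh hn
        rw [smul_neg, ha h hh hn] }
  have hqM : q ∣ Nat.card M := by
    obtain ⟨v, hv⟩ := exists_ne (0 : M)
    have : addOrderOf v = q := addOrderOf_eq_prime (hq v) hv
    rw [← this]; exact addOrderOf_dvd_natCard v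
  obtain ⟨P⟩ : Nonempty (Sylow q H) := inferInstance
  have hPn : (P : Subgroup H).Normal := by
    have := (Group.isNilpotent_of_finite_tfae (G := H)).out 0 3
    exact this.1 inferInstance q inferInstance P
  have hPall : ∀ x : H, (∃ n : ℕ, x ^ q ^ n = 1) → x ∈ P := by
    rintro x ⟨n, hn⟩
    have hz : IsPGroup q (Subgroup.zpowers x) := by
      rintro ⟨y, hy⟩
      obtain ⟨k, rfl⟩ := Subgroup.mem_zpowers_iff.1 hy
      refine ⟨n, Subtype.ext ?_⟩
      simp only [Subgroup.coe_pow, Subgroup.coe_one]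
      rw [← zpow_natCast, ← zpow_mul, mul_comm, zpow_mul, zpow_natCast, hn, one_zpow]
    obtain ⟨Q, hQ⟩ := hz.exists_le_sylow
    have : Q = P := by
      have := Sylow.unique_of_normal P hPn
      exact Subsingleton.elim _ _
    rw [← this]
    exact hQ (Subgroup.mem_zpowers x)
  have hW0 : W ≠ ⊥ := by
    obtain ⟨b, hb, hb0⟩ := P.isPGroup'.exists_fixed_point_of_prime_dvd_card_of_fixed_point M hqM
      (a := 0) (by intro g; exact smul_zero _)
    intro hW
    apply hb0
    symm
    rw [← AddSubgroup.mem_bot, ← hW]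
    intro h hh ⟨n, hn⟩
    exact hb ⟨⟨h, hh⟩, hPall ⟨h, hh⟩ ⟨n, Subtype.ext hn⟩⟩
  have hWT : W = ⊤ := by
    refine (hirr W ?_ ?_).resolve_left hW0
    · intro k hk w hw h hh ⟨n, hn⟩
      have := hw (k⁻¹ * h * k) (H.mul_mem (H.mul_mem (H.inv_mem hk) hh) hk)
        ⟨n, by
          have : k⁻¹ * h * k = k⁻¹ * h * k⁻¹⁻¹ := by simp
          rw [this, conj_pow, hn]; simp⟩
      conv_rhs => rw [← this]
      simp [← mul_smul, mul_assoc]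
    · intro w hw h hh ⟨n, hn⟩
      have := hw (Φ⁻¹ * h * Φ) (hnorm h hh)
        ⟨n, by
          have : Φ⁻¹ * h * Φ = Φ⁻¹ * h * Φ⁻¹⁻¹ := by simp
          rw [this, conj_pow, hn]; simp⟩
      conv_rhs => rw [← this]
      simp [← mul_smul, mul_assoc]
  obtain ⟨x, hx⟩ := exists_prime_orderOf_dvd_card' q hdvd
  have hx1 : (x : K) = 1 := by
    apply FaithfulSMul.eq_of_smul_eq_smul (α := M)
    intro v
    have : v ∈ W := hWT ▸ AddSubgroup.mem_top v
    rw [one_smul]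
    refine this x x.2 ⟨1, ?_⟩
    rw [pow_one, ← hx]
    exact_mod_cast congrArg Subtype.val (pow_orderOf_eq_one x)
  have : x = 1 := Subtype.ext hx1
  rw [this, orderOf_one] at hx
  exact (Fact.out : q.Prime).one_lt.ne hx

theorem engel_lemma {K M : Type*} [Group K] [AddCommGroup M] [DistribMulAction K M]
    [Nontrivial M] (x : K) (n q : ℕ) [Fact q.Prime]
    (hq : ∀ v : M, q • v = 0) (hn : ¬ q ∣ n) (hn0 : n ≠ 0) (hx : x ^ n = 1) (r₀ : ℕ) (v : M) :
    ∃ r ≥ r₀, (fun w : M => x • w - w)^[r] v = x • v - v := by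
  have hqp : q.Prime := Fact.out
  have : CharP (AddMonoid.End M) q := by
    have h0 : ((q : ℕ) : AddMonoid.End M) = 0 := by
      ext v; simpa using hq v
    have : Nontrivial (AddMonoid.End M) := by
      obtain ⟨v, hv⟩ := exists_ne (0 : M)
      exact ⟨⟨1, 0, fun h => hv (by simpa using DFunLike.congr_fun h v)⟩⟩
    exact (CharP.charP_iff_prime_eq_zero hqp).2 h0
  let X : AddMonoid.End M := DistribMulAction.toAddMonoidEnd K M x
  have hX : X ^ n = 1 := by
    simp only [X]; rw [← map_pow, hx, map_one]
  have hcop : Nat.Coprime q n := (Nat.Prime.coprime_iff_not_dvd hqp).2 hn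
  let j := n.totient * r₀
  have hj : q ^ j ≡ 1 [MOD n] := by
    have := (Nat.ModEq.pow_totient hcop).pow r₀
    rwa [one_pow, ← pow_mul] at this
  refine ⟨q ^ j, ?_, ?_⟩
  · have h1 : r₀ ≤ j := Nat.le_mul_of_pos_left _ (Nat.totient_pos.2 (Nat.pos_of_ne_zero hn0))
    exact h1.trans (Nat.lt_pow_self hqp.one_lt).le
  · have h1 : (X - 1) ^ q ^ j = X - 1 := by
      rw [sub_pow_char_pow_of_commute _ _ (Commute.one_right X), one_pow]
      congr 1
      have : X ^ q ^ j = X ^ 1 := by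
        rw [pow_eq_pow_mod _ hX, hj, ← pow_eq_pow_mod _ hX]
      rw [this, pow_one]
    have h2 : ∀ r : ℕ, ∀ v, (fun w : M => x • w - w)^[r] v = ((X - 1) ^ r) v := by
      intro r
      induction r with
      | zero => intro v; rfl
      | succ r ih => intro v; rw [Function.iterate_succ_apply, ih, pow_succ]; rfl
    rw [h2, h1]; rfl

@[reducible] def mulAutAct (V : Type*) [CommGroup V] : DistribMulAction (MulAut V) (Additive V) where
  smul f a := Additive.ofMul (f a.toMul)
  one_smul _ := rfl
  mul_smul _ _ _ := rfl
  smul_zero f := map_one f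
  smul_add f a b := map_mul f a.toMul b.toMul

section core
variable {G : Type} [Group G] [Finite G]

/-- a minimal invariant subgroup contained in a nilpotent subgroup is elementary abelian -/
theorem elem_ab (φ : G ≃* G) (V : Subgroup G) (hV : IsMinNormalInv φ V)
    (hnil : Group.IsNilpotent V) :
    (∀ a ∈ V, ∀ b ∈ V, a * b = b * a) ∧ ∃ q : ℕ, q.Prime ∧ ∀ a ∈ V, a ^ q = 1 := by
  obtain ⟨hne, hn, hinv, hmin⟩ := hV
  have hnt : Nontrivial V := (Subgroup.nontrivial_iff_ne_bot V).2 hne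
  have hsurj : ∀ v ∈ V, ∃ w ∈ V, φ w = v := by
    have hmap : V.map φ.toMonoidHom = V := by
      apply Subgroup.eq_of_le_of_card_ge
      · rintro _ ⟨w, hw, rfl⟩; exact hinv w hw
      · rw [Subgroup.card_map_of_injective φ.injective]
    intro v hv
    rw [← hmap] at hv
    exact hv
  have hab : ∀ a ∈ V, ∀ b ∈ V, a * b = b * a := by
    have hZ : V ⊓ Subgroup.centralizer (V : Set G) = V := by
      apply hmin
      · intro hbot
        apply Group.IsNilpotent.center_ne_bot (G := V)
        rw [eq_bot_iff]
        rintro ⟨x, hx⟩ hxc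
        have : x ∈ V ⊓ Subgroup.centralizer (V : Set G) := by
          refine ⟨hx, ?_⟩
          refine Subgroup.mem_centralizer_iff.2 ?_
          intro h hh
          exact congrArg Subtype.val (Subgroup.mem_center_iff.1 hxc ⟨h, hh⟩)
        rw [hbot, Subgroup.mem_bot] at this
        rw [Subgroup.mem_bot]
        exact Subtype.ext this
      · infer_instance
      · rintro w ⟨hw, hwc⟩
        refine ⟨hinv w hw, ?_⟩
        refine Subgroup.mem_centralizer_iff.2 ?_
        replace hwc := Subgroup.mem_centralizer_iff.1 hwc
        intro h hh
        obtain ⟨k, hk, rfl⟩ := hsurj h hh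
        rw [← map_mul, hwc k hk, map_mul]
      · exact inf_le_left
    intro a ha b hb
    rw [← hZ] at hb
    exact Subgroup.mem_centralizer_iff.1 hb.2 a ha
  refine ⟨hab, ?_⟩
  have hc : Nat.card V ≠ 1 := by
    intro h; exact hne (Subgroup.card_eq_one.1 h)
  obtain ⟨q, hq, hd⟩ := Nat.exists_prime_and_dvd hc
  refine ⟨q, hq, ?_⟩
  have := Fact.mk hq
  let W : Subgroup G :=
    { carrier := {v | v ∈ V ∧ v ^ q = 1}
      one_mem' := ⟨V.one_mem, one_pow _⟩
      mul_mem' := by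
        rintro a b ⟨ha, ha1⟩ ⟨hb, hb1⟩
        exact ⟨V.mul_mem ha hb, by
          rw [(show Commute a b from hab a ha b hb).mul_pow, ha1, hb1, one_mul]⟩
      inv_mem' := by
        rintro a ⟨ha, ha1⟩
        exact ⟨V.inv_mem ha, by rw [inv_pow, ha1, inv_one]⟩ }
  have hW : W = V := by
    apply hmin
    · intro hbot
      obtain ⟨x, hx⟩ := exists_prime_orderOf_dvd_card' (G := V) q hd
      have hxW : (x : G) ∈ W := ⟨x.2, by
        rw [← hx]; exact_mod_cast congrArg Subtype.val (pow_orderOf_eq_one x)⟩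
      rw [hbot, Subgroup.mem_bot] at hxW
      have : x = 1 := Subtype.ext hxW
      rw [this, orderOf_one] at hx
      exact hq.one_lt.ne hx
    · constructor
      rintro a ⟨ha, ha1⟩ g
      exact ⟨hn.conj_mem a ha g, by rw [conj_pow, ha1]; simp⟩
    · rintro a ⟨ha, ha1⟩
      exact ⟨hinv a ha, by rw [← map_pow, ha1, map_one]⟩
    · rintro a ⟨ha, _⟩; exact ha
  intro a ha
  rw [← hW] at ha
  exact ha.2

/-- final counting step -/
theorem index_bound (φ : G ≃* G) (V : Subgroup G) (hV : IsMinNormalInv φ V)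
    (v : G) (hv : v ∈ V) (hv1 : v ≠ 1) (hφ : φ v = v) (m : ℕ) (R : Set G) (hR : R.ncard ≤ m)
    (hsink : ∀ x : G, engelComm v x ∈ R) :
    (Subgroup.centralizer (V : Set G)).index ≤ m.factorial := by
  classical
  obtain ⟨hne, hn, hinv, hmin⟩ := hV
  let O := MulAction.orbit (ConjAct G) v
  have hOcard : Nat.card O ≤ m := by
    refine le_trans ?_ hR
    rw [← Nat.card_coe_set_eq]
    have hmem : ∀ o : O, v⁻¹ * (o : G) ∈ R := by
      rintro ⟨o, ⟨c, rfl⟩⟩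
      have := hsink (ConjAct.ofConjAct c)⁻¹
      simpa [engelComm, ConjAct.smul_def, mul_assoc] using this
    refine Nat.card_le_card_of_injective (fun o : O => (⟨v⁻¹ * o, hmem o⟩ : R)) ?_
    intro a b hab
    exact Subtype.ext (mul_left_cancel (congrArg Subtype.val hab))
  have hcl : Subgroup.closure O = V := by
    apply hmin
    · intro h
      apply hv1
      rw [← Subgroup.mem_bot, ← h]
      exact Subgroup.subset_closure (MulAction.mem_orbit_self v)
    · constructor
      intro w hw g
      have : Subgroup.closure O ≤ (Subgroup.closure O).comap (MulAut.conj g).toMonoidHom := by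
        rw [Subgroup.closure_le]
        rintro _ ⟨c, rfl⟩
        apply Subgroup.subset_closure
        refine ⟨ConjAct.toConjAct g * c, ?_⟩
        simp [ConjAct.smul_def, mul_assoc]
      exact this hw
    · intro w hw
      have : Subgroup.closure O ≤ (Subgroup.closure O).comap φ.toMonoidHom := by
        rw [Subgroup.closure_le]
        rintro _ ⟨c, rfl⟩
        apply Subgroup.subset_closure
        refine ⟨ConjAct.toConjAct (φ (ConjAct.ofConjAct c)), ?_⟩
        simp [ConjAct.smul_def, hφ]
      exact this hw
    · rw [Subgroup.closure_le]
      rintro _ ⟨c, rfl⟩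
      simpa [ConjAct.smul_def] using hn.conj_mem v hv (ConjAct.ofConjAct c)
  let T : G →* Equiv.Perm O :=
    (MulAction.toPermHom (ConjAct G) O).comp ConjAct.toConjAct.toMonoidHom
  have hker : T.ker ≤ Subgroup.centralizer (V : Set G) := by
    intro g hg
    have h1 : V ≤ Subgroup.centralizer {g} := by
      rw [← hcl, Subgroup.closure_le]
      intro o ho
      have h2 := congrArg (fun σ : Equiv.Perm O => ((σ ⟨o, ho⟩ : O) : G)) (MonoidHom.mem_ker.1 hg)
      have h3 : g * o * g⁻¹ = o := by
        exact h2
      rw [SetLike.mem_coe, Subgroup.mem_centralizer_singleton_iff]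
      exact (mul_inv_eq_iff_eq_mul.1 h3).symm
    rw [Subgroup.mem_centralizer_iff]
    intro h hh
    have := Subgroup.mem_centralizer_singleton_iff.1 (h1 hh)
    exact this
  calc (Subgroup.centralizer (V : Set G)).index ≤ T.ker.index :=
        Nat.le_of_dvd (Nat.pos_of_ne_zero Subgroup.index_ne_zero_of_finite)
          (Subgroup.index_dvd_of_le hker)
    _ = Nat.card T.range := Subgroup.index_ker T
    _ ≤ Nat.card (Equiv.Perm O) := Nat.card_le_card_of_injective _ Subtype.val_injective
    _ = (Nat.card O).factorial := Nat.card_perm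
    _ ≤ m.factorial := Nat.factorial_le hOcard

end core

theorem core_bound {G : Type} [Group G] [Finite G] (φ : G ≃* G) (m : ℕ) (V : Subgroup G)
    (hV : IsMinNormalInv φ V) (hcenter : Subgroup.center G = ⊥) (hp : (orderOf φ).Prime)
    (hab : ∀ a ∈ V, ∀ b ∈ V, a * b = b * a) (q : ℕ) (hqp : q.Prime) (hq : ∀ a ∈ V, a ^ q = 1)
    (F : Subgroup G) [F.Normal] (hnil : Group.IsNilpotent (G ⧸ F))
    (hFV : ∀ f ∈ F, ∀ v ∈ V, f * v = v * f)
    (hlang : ∀ g : G, ∃ k : G, g⁻¹ * (k⁻¹ * φ k) ∈ F)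
    (hsink : ∀ g : G, φ g = g → ∃ R : Set G, IsRightEngelSink g R ∧ R.ncard ≤ m) :
    (Subgroup.centralizer (V : Set G)).index ≤ m.factorial := by
  have hV' := hV
  obtain ⟨hne, hn, hinv, hmin⟩ := hV'
  have hqf := Fact.mk hqp
  have hnt : Nontrivial V := (Subgroup.nontrivial_iff_ne_bot V).2 hne
  let cg : CommGroup V :=
    { (inferInstance : Group V) with mul_comm := fun a b => Subtype.ext (hab a a.2 b b.2) }
  let act : DistribMulAction (MulAut V) (Additive V) := mulAutAct V
  have hfaith : FaithfulSMul (MulAut V) (Additive V) := ⟨by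
    intro f g h
    ext x
    exact congrArg (fun y : Additive V => ((Additive.toMul y : V) : G)) (h (Additive.ofMul x))⟩
  let ρ : G →* MulAut V := MulAut.conjNormal
  let φr : V →* V := (φ.toMonoidHom.comp V.subtype).codRestrict V (fun v => hinv v v.2)
  have hφr : Function.Bijective φr := by
    apply Finite.injective_iff_bijective.1
    intro a b hab
    exact Subtype.ext (φ.injective (congrArg Subtype.val hab))
  let Φ : MulAut V := MulEquiv.ofBijective φr hφr
  have hΦv : ∀ v : V, ((Φ v : V) : G) = φ v := fun v => rfl
  have hρv : ∀ g : G, ∀ v : V, ((ρ g v : V) : G) = g * v * g⁻¹ := fun g v => rfl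
  have hΦρ : ∀ g : G, Φ * ρ g = ρ (φ g) * Φ := by
    intro g
    ext v
    simp [MulAut.mul_apply, hΦv, hρv]
  have hΦρ' : ∀ g : G, Φ * ρ g * Φ⁻¹ = ρ (φ g) := by
    intro g
    rw [hΦρ, mul_inv_cancel_right]
  have hΦp : Φ ^ (orderOf φ) = 1 := by
    have h1 : ∀ n : ℕ, ∀ v : V, (((Φ ^ n) v : V) : G) = ((show MulAut G from φ) ^ n) v := by
      intro n
      induction n with
      | zero => intro v; rfl
      | succ n ih => intro v; rw [pow_succ', pow_succ', MulAut.mul_apply, hΦv, ih]; rfl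
    ext v
    rw [h1]
    have : (show MulAut G from φ) ^ (orderOf φ) = 1 := pow_orderOf_eq_one φ
    rw [this]; rfl
  have hρF : ∀ f ∈ F, ρ f = 1 := by
    intro f hf
    ext v
    rw [hρv, hFV f hf v v.2]; simp
  let H : Subgroup (MulAut V) := ρ.range
  have hHnil : Group.IsNilpotent H := by
    let T : G ⧸ F →* H := QuotientGroup.lift F ρ.rangeRestrict (by
      intro f hf
      exact Subtype.ext (hρF f hf))
    refine Group.nilpotent_of_surjective T ?_
    rintro ⟨_, ⟨g, rfl⟩⟩
    exact ⟨QuotientGroup.mk g, rfl⟩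
  have hnorm1 : ∀ h ∈ H, Φ * h * Φ⁻¹ ∈ H := by
    rintro _ ⟨g, rfl⟩
    exact ⟨φ g, (hΦρ' g).symm⟩
  have hnorm2 : ∀ h ∈ H, Φ⁻¹ * h * Φ ∈ H := by
    rintro _ ⟨g, rfl⟩
    refine ⟨φ.symm g, ?_⟩
    have := hΦρ (φ.symm g)
    rw [φ.apply_symm_apply] at this
    rw [mul_assoc, ← this, inv_mul_cancel_left]
  have hqM : ∀ v : Additive V, q • v = 0 := by
    intro v
    have : (Additive.toMul v) ^ q = 1 := Subtype.ext (hq _ (Additive.toMul v).2)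
    exact this
  have hirr : ∀ W : AddSubgroup (Additive V), (∀ h ∈ H, ∀ w ∈ W, h • w ∈ W) →
      (∀ w ∈ W, Φ • w ∈ W) → W = ⊥ ∨ W = ⊤ := by
    intro W hWH hWΦ
    let U : Subgroup G := (AddSubgroup.toSubgroup' W).map V.subtype
    have hUmem : ∀ v : V, (v : G) ∈ U ↔ Additive.ofMul v ∈ W := by
      intro v
      constructor
      · rintro ⟨w, hw, e⟩
        have : w = v := Subtype.ext e
        rw [← this]; exact hw
      · intro h; exact ⟨v, h, rfl⟩
    have hUV : U ≤ V := by
      rintro _ ⟨w, _, rfl⟩; exact w.2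
    by_cases hU : U = ⊥
    · left
      rw [eq_bot_iff]
      intro w hw
      have := (hUmem (Additive.toMul w)).2 hw
      rw [hU, Subgroup.mem_bot] at this
      have h2 : Additive.toMul w = 1 := Subtype.ext this
      exact h2
    · right
      have : U = V := by
        apply hmin U hU _ _ hUV
        · constructor
          intro u hu g
          exact (hUmem (ρ g ⟨u, hUV hu⟩)).2
            (hWH (ρ g) ⟨g, rfl⟩ _ ((hUmem ⟨u, hUV hu⟩).1 hu))
        · intro u hu
          exact (hUmem (Φ ⟨u, hUV hu⟩)).2 (hWΦ _ ((hUmem ⟨u, hUV hu⟩).1 hu))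
      rw [eq_top_iff]
      intro w _
      refine (hUmem (Additive.toMul w)).1 ?_
      rw [this]; exact (Additive.toMul w).2
  have hcop : ¬ q ∣ Nat.card H := cop_lemma H Φ q hqM hnorm2 hirr
  have hconj : ∀ h ∈ H, ∃ k ∈ H, h * Φ = k⁻¹ * Φ * k := by
    rintro _ ⟨g, rfl⟩
    obtain ⟨k, hk⟩ := hlang g
    refine ⟨ρ k, ⟨k, rfl⟩, ?_⟩
    have h1 := hρF _ hk
    rw [map_mul, map_mul, map_inv, map_inv] at h1
    rw [mul_assoc, hΦρ, ← mul_assoc, ← inv_mul_eq_one.1 h1]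
  have hfix : ∀ v : Additive V, (∀ h ∈ H, h • v = v) → v = 0 := by
    intro v hv
    have : ((Additive.toMul v : V) : G) ∈ Subgroup.center G := by
      rw [Subgroup.mem_center_iff]
      intro g
      have h1 : ρ g (Additive.toMul v) = Additive.toMul v := hv (ρ g) ⟨g, rfl⟩
      have h2 := congrArg Subtype.val h1
      rw [hρv] at h2
      exact mul_inv_eq_iff_eq_mul.1 h2
    rw [hcenter, Subgroup.mem_bot] at this
    have h2 : Additive.toMul v = 1 := Subtype.ext this
    exact h2
  have hcop' : ∀ v : Additive V, Nat.card H • v = 0 → v = 0 := by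
    intro v hv
    by_contra h0
    have h1 : addOrderOf v = q := addOrderOf_eq_prime (hqM v) h0
    exact hcop (h1 ▸ addOrderOf_dvd_of_nsmul_eq_zero hv)
  obtain ⟨v, hΦvv, hv0⟩ : ∃ v : Additive V, Φ • v = v ∧ v ≠ 0 := by
    by_contra hcon
    push Not at hcon
    obtain ⟨w, hw⟩ := exists_ne (0 : Additive V)
    exact hw (fix_lemma H Φ (orderOf φ) hp hΦp hnorm1 hconj hfix hcop' hcon w)
  have hφv : φ ((Additive.toMul v : V) : G) = (Additive.toMul v : V) :=
    congrArg (fun y : Additive V => ((Additive.toMul y : V) : G)) hΦvv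
  obtain ⟨R, hR, hRm⟩ := hsink _ hφv
  refine index_bound φ V hV (Additive.toMul v : V) (Additive.toMul v).2 ?_ hφv m R hRm ?_
  · intro h
    apply hv0
    have h2 : Additive.toMul v = 1 := Subtype.ext h
    exact h2
  · intro x
    obtain ⟨r₀, hr₀⟩ := hR x
    have hx : (ρ x⁻¹) ^ Nat.card H = 1 := by
      have := pow_card_eq_one' (x := (⟨ρ x⁻¹, ⟨x⁻¹, rfl⟩⟩ : H))
      exact congrArg Subtype.val this
    obtain ⟨r, hr, he⟩ := engel_lemma (M := Additive V) (ρ x⁻¹) (Nat.card H) q hqM hcop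
      Nat.card_pos.ne' hx r₀ v
    have hstep : ∀ w : Additive V,
        ((Additive.toMul (ρ x⁻¹ • w - w) : V) : G) = engelComm ((Additive.toMul w : V) : G) x := by
      intro w
      have h1 : ρ x⁻¹ • w - w = - w + ρ x⁻¹ • w := by abel
      rw [h1]
      change ((Additive.toMul w : V) : G)⁻¹ * (x⁻¹ * (Additive.toMul w : V) * x⁻¹⁻¹) = _
      simp [engelComm, mul_assoc]
    have hit : ∀ n : ℕ, ∀ w : Additive V,
        ((Additive.toMul ((fun w : Additive V => ρ x⁻¹ • w - w)^[n] w) : V) : G)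
          = (fun y => engelComm y x)^[n] ((Additive.toMul w : V) : G) := by
      intro n
      induction n with
      | zero => intro w; rfl
      | succ n ih =>
        intro w
        rw [Function.iterate_succ_apply, Function.iterate_succ_apply, ih, hstep]
    have := hr₀ r hr
    rw [← hit, he, hstep] at this
    exact this

theorem stmt12 :
    ∃ f : ℕ → ℕ, ∀ (G : Type) (_ : Group G) (_ : Finite G) (_ : IsSolvable G)
      (φ : G ≃* G) (m : ℕ) (F : Subgroup G) (hFn : F.Normal),
      Subgroup.center G = ⊥ →
      (orderOf φ).Prime → Nat.Coprime (orderOf φ) (Nat.card G) → 0 < m →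
      -- `F` is the Fitting subgroup: the largest nilpotent normal subgroup
      Group.IsNilpotent ↥F →
      (∀ K : Subgroup G, K.Normal → Group.IsNilpotent ↥K → K ≤ F) →
      -- `G/F` is nilpotent
      Group.IsNilpotent (G ⧸ F) →
      -- the automorphism induced by `φ` on `G/F` is fixed-point-free
      (∀ ψ : (G ⧸ F) ≃* (G ⧸ F),
        (∀ g : G, ψ (QuotientGroup.mk g) = QuotientGroup.mk (φ g)) →
        ∀ x : G ⧸ F, ψ x = x → x = 1) →
      -- every fixed point of `φ` has a right Engel sink of cardinality at most `m`
      (∀ g : G, φ g = g → ∃ R : Set G, IsRightEngelSink g R ∧ R.ncard ≤ m) →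
      -- conclusion: if `F` is the direct product of minimal normal `φ`-invariant
      -- subgroups `V i`, then each `G/C_G(V i)` has order at most `f m`
      ∀ (k : ℕ) (V : Fin k → Subgroup G),
        (∀ i, IsMinNormalInv φ (V i)) → iSupIndep V → (⨆ i, V i) = F →
        ∀ i, (Subgroup.centralizer ((V i : Subgroup G) : Set G)).index ≤ f m := by
  refine ⟨Nat.factorial, ?_⟩
  intro G _ _ _ φ m F hFn hcenter hp _ _ hFnil _ hnil hfpf hsink k V hV hind hsup i
  have hVF : ∀ j, V j ≤ F := fun j => hsup ▸ le_iSup V j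
  have hVnil : ∀ j, Group.IsNilpotent (V j) := fun j =>
    Group.nilpotent_of_mulEquiv (Subgroup.subgroupOfEquivOfLe (hVF j))
  obtain ⟨hab, q, hqp, hq⟩ := elem_ab φ (V i) (hV i) (hVnil i)
  have hFV : ∀ f ∈ F, ∀ v ∈ V i, f * v = v * f := by
    have : F ≤ Subgroup.centralizer (V i : Set G) := by
      rw [← hsup, iSup_le_iff]
      intro j x hx
      rw [Subgroup.mem_centralizer_iff]
      intro v hv
      by_cases hij : i = j
      · subst hij; exact hab v hv x hx
      · exact Subgroup.commute_of_normal_of_disjoint _ _ (hV i).2.1 (hV j).2.1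
          (hind.pairwiseDisjoint hij) v x hv hx
    intro f hf v hv
    exact (Subgroup.mem_centralizer_iff.1 (this hf) v hv).symm
  have hFφ : F.map φ.toMonoidHom = F := by
    apply Subgroup.eq_of_le_of_card_ge
    · rw [Subgroup.map_le_iff_le_comap]
      conv_lhs => rw [← hsup]
      rw [iSup_le_iff]
      intro j x hx
      exact hVF j ((hV j).2.2.1 x hx)
    · rw [Subgroup.card_map_of_injective φ.injective]
  have hlang : ∀ g : G, ∃ k : G, g⁻¹ * (k⁻¹ * φ k) ∈ F := by
    let ψ : (G ⧸ F) ≃* (G ⧸ F) := QuotientGroup.congr F F φ hFφ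
    have hψ : ∀ g : G, ψ (QuotientGroup.mk g) = QuotientGroup.mk (φ g) := fun g => rfl
    have hinj : Function.Injective (fun x : G ⧸ F => x⁻¹ * ψ x) := by
      intro a b hab
      have hab' : a⁻¹ * ψ a = b⁻¹ * ψ b := hab
      have h1 : ψ (b * a⁻¹) = b * a⁻¹ := by
        rw [map_mul, map_inv, mul_inv_eq_iff_eq_mul, mul_assoc, hab', mul_inv_cancel_left]
      exact (mul_inv_eq_one.1 (hfpf ψ hψ _ h1)).symm
    have hsurj := (Finite.injective_iff_surjective.1 hinj)
    intro g
    obtain ⟨x, hx⟩ := hsurj (QuotientGroup.mk g)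
    obtain ⟨k, rfl⟩ := QuotientGroup.mk_surjective x
    refine ⟨k, ?_⟩
    rw [← QuotientGroup.eq]
    exact hx.symm
  exact core_bound φ m (V i) (hV i) hcenter hp hab q hqp hq F hnil hFV hlang hsink
end

section
/- Let V be a finite abelian group and U a group of automorphisms of V with gcd(|U|, |V|) = 1. If |[V, u]| ≤ m for every u ∈ U, where [V, u] = ⟨v⁻¹·u(v) : v ∈ V⟩, then the order of [V, U] = ⟨v⁻¹·u(v) : v ∈ V, u ∈ U⟩ is bounded in terms of m only, and therefore |U| is also bounded in terms of m only. -/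
set_option linter.unusedSectionVars false
set_option linter.unusedVariables false

namespace CoprimeAux

open Classical Finset

theorem exists_reps {α β : Type*} (f : α → β) (s : Finset α) :
    ∃ t ⊆ s, t.card = (s.image f).card ∧ ∀ a ∈ s, ∃ b ∈ t, f b = f a := by
  obtain ⟨t, hts, hinj, him⟩ := Finset.exists_subset_injOn_image_eq_of_surjOn (f := f) s
    (s.image f) (by intro x hx; simpa using hx)
  refine ⟨t, by exact_mod_cast hts, ?_, ?_⟩
  · rw [← him, Finset.card_image_of_injOn hinj]
  · intro a ha
    have : f a ∈ t.image f := by rw [him]; exact Finset.mem_image_of_mem f ha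
    simpa using this

variable {G V : Type} [Group G] [CommGroup V] [Fintype G] [Fintype V] [MulDistribMulAction G V]

/-- The homomorphism `v ↦ [v, g]`. -/
noncomputable def del (g : G) : V →* V where
  toFun v := v⁻¹ * g • v
  map_one' := by simp
  map_mul' a b := by
    rw [smul_mul', mul_inv]
    exact mul_mul_mul_comm _ _ _ _

theorem del_apply (g : G) (v : V) : del g v = v⁻¹ * g • v := rfl

theorem smul_eq (g : G) (v : V) : g • v = v * del g v := by simp [del_apply]

/-- The orbit as a finset. -/
noncomputable def orb (G : Type) {V : Type} [Group G] [CommGroup V] [Fintype G]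
    [MulDistribMulAction G V] (v : V) : Finset V :=
  univ.image (fun g : G => g • v)

theorem orb_reps (v : V) : ∃ t : Finset G, t.card = (orb G v).card ∧
    ∀ g : G, ∃ h ∈ t, h • v = g • v := by
  obtain ⟨t, _, h1, h2⟩ := exists_reps (fun g : G => g • v) univ
  exact ⟨t, h1, fun g => h2 g (mem_univ g)⟩

theorem card_orb_mul (v w : V) : (orb G (v * w)).card ≤ (orb G v).card * (orb G w).card := by
  rw [← Finset.card_product]
  refine (Finset.card_le_card ?_).trans
    (Finset.card_image_le (s := orb G v ×ˢ orb G w) (f := fun p => p.1 * p.2))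
  intro x hx
  simp only [orb, mem_image, mem_univ, true_and, mem_product, Prod.exists] at hx ⊢
  obtain ⟨g, rfl⟩ := hx
  exact ⟨g • v, g • w, ⟨⟨g, rfl⟩, ⟨g, rfl⟩⟩, (smul_mul' g v w).symm⟩

theorem card_orb_inv (v : V) : (orb G v⁻¹).card ≤ (orb G v).card := by
  refine (Finset.card_le_card ?_).trans
    (Finset.card_image_le (s := orb G v) (f := fun p => p⁻¹))
  intro x hx
  simp only [orb, mem_image, mem_univ, true_and] at hx ⊢
  obtain ⟨g, rfl⟩ := hx
  exact ⟨g • v, ⟨g, rfl⟩, (smul_inv' g v).symm⟩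

theorem card_orb_smul (g : G) (v : V) : (orb G (g • v)).card ≤ (orb G v).card := by
  refine Finset.card_le_card ?_
  intro x hx
  simp only [orb, mem_image, mem_univ, true_and] at hx ⊢
  obtain ⟨h, rfl⟩ := hx
  exact ⟨h * g, mul_smul h g v⟩

theorem card_orb_one : (orb G (1 : V)).card ≤ 1 := by
  rw [Finset.card_le_one]
  simp [orb]

theorem orb_stab (v : V) :
    (orb G v).card * (univ.filter (fun g : G => g • v = v)).card = Fintype.card G := by
  have h := MulAction.card_orbit_mul_card_stabilizer_eq_card_group G v
  rw [← h]
  congr 1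
  · rw [← Set.toFinset_card]
    congr 1
    ext x
    simp [orb, MulAction.mem_orbit_iff]
  · rw [Fintype.card_subtype]
    congr 1

theorem fix_card (g : G) :
    (univ.filter (fun v : V => g • v = v)).card * Nat.card (del (V := V) g).range
      = Fintype.card V := by
  have h := (del (V := V) g).ker.card_mul_index
  rw [Subgroup.index_ker, Nat.card_eq_fintype_card (α := V)] at h
  rw [← h]
  congr 1
  rw [Nat.card_eq_fintype_card, Fintype.card_subtype]
  congr 1
  ext v
  simp [MonoidHom.mem_ker, del_apply, inv_mul_eq_one, eq_comm]

theorem count {m : ℕ} (hm : 0 < m) (h : ∀ g : G, Nat.card (del (V := V) g).range ≤ m) :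
    Fintype.card V ≤ 2 * m * (univ.filter (fun v : V => (orb G v).card ≤ 2 * m)).card := by
  set Y := univ.filter (fun v : V => (orb G v).card ≤ 2 * m) with hY
  have hdc := Finset.sum_card_bipartiteAbove_eq_sum_card_bipartiteBelow
    (s := (univ : Finset V)) (t := (univ : Finset G)) (fun v g => g • v = v)
  simp only [Finset.bipartiteAbove, Finset.bipartiteBelow] at hdc
  have h1 : Fintype.card G * Fintype.card V ≤
      m * ∑ g : G, (univ.filter (fun v : V => g • v = v)).card := by
    rw [Finset.mul_sum]
    calc Fintype.card G * Fintype.card V = ∑ g : G, Fintype.card V := by simp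
      _ ≤ _ := by
        refine Finset.sum_le_sum fun g _ => ?_
        rw [← fix_card (V := V) g, mul_comm]
        exact Nat.mul_le_mul_right _ (h g)
  have h2 : 2 * m * ∑ v : V, (univ.filter (fun g : G => g • v = v)).card
      ≤ 2 * m * (Y.card * Fintype.card G) + Fintype.card V * Fintype.card G := by
    rw [Finset.mul_sum]
    calc _ ≤ ∑ v : V, ((if v ∈ Y then 2 * m * Fintype.card G else 0) + Fintype.card G) := by
          refine Finset.sum_le_sum fun v _ => ?_
          split_ifs with hv
          · refine le_add_right ?_
            exact Nat.mul_le_mul_left _ (Finset.card_le_univ _)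
          · have hv' : 2 * m ≤ (orb G v).card := by
              simp [hY] at hv; omega
            rw [zero_add, ← orb_stab (G := G) v]
            exact Nat.mul_le_mul_right _ hv'
      _ = _ := by
          rw [Finset.sum_add_distrib, Finset.sum_ite_mem]
          simp
          ring
  rw [hdc] at h2
  have hG : 0 < Fintype.card G := Fintype.card_pos
  have h3 : Fintype.card G * (2 * Fintype.card V) ≤
      Fintype.card G * (2 * m * Y.card + Fintype.card V) := by nlinarith
  have := Nat.le_of_mul_le_mul_left h3 hG
  omega

theorem exists_level {m : ℕ} (hm : 0 < m)
    (h : Fintype.card V ≤ 2 * m * (univ.filter (fun v : V => (orb G v).card ≤ 2 * m)).card) :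
    ∃ b, 2 * m ≤ b ∧ b ≤ (2 * m) ^ (5 ^ (2 * m)) ∧
      ∀ v : V, (orb G v).card ≤ b ^ 4 → (orb G v).card ≤ b ^ 2 := by
  by_contra hcon
  push Not at hcon
  set Y : ℕ → Finset V := fun b => univ.filter (fun v : V => (orb G v).card ≤ b) with hY
  have hb1 : ∀ i, 2 * m ≤ (2 * m) ^ (5 ^ i) := fun i =>
    Nat.le_self_pow (by positivity) _
  have key : ∀ i, i ≤ 2 * m → (i + 1) * (Y (2 * m)).card ≤ (Y ((2 * m) ^ (5 ^ i))).card := by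
    intro i
    induction i with
    | zero => intro _; simp
    | succ i ih =>
      intro hi
      have ih := ih (by omega)
      set b := (2 * m) ^ (5 ^ i) with hb
      have hbb : (2 * m) ^ (5 ^ (i + 1)) = b ^ 5 := by
        rw [hb, ← pow_mul, pow_succ]
      have h2b : 2 * m ≤ b := hb1 i
      obtain ⟨v, hv4, hv2⟩ := hcon b h2b
        (Nat.pow_le_pow_right (by omega) (Nat.pow_le_pow_right (by omega) (by omega)))
      rw [hbb]
      have hdis : Disjoint (Y b) ((Y (2 * m)).image (fun y => v * y)) := by
        rw [Finset.disjoint_left]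
        intro x hx hx'
        simp only [hY, mem_filter, mem_univ, true_and, mem_image] at hx hx'
        obtain ⟨y, hy, rfl⟩ := hx'
        have e : v = (v * y) * y⁻¹ := by simp
        have := card_orb_mul (G := G) (v * y) y⁻¹
        rw [← e] at this
        have h3 := card_orb_inv (G := G) y
        have : (orb G v).card ≤ b * b := this.trans (Nat.mul_le_mul hx (by omega))
        nlinarith
      have hsub : Y b ∪ ((Y (2 * m)).image (fun y => v * y)) ⊆ Y (b ^ 5) := by
        intro x hx
        simp only [hY, mem_filter, mem_univ, true_and, mem_image, mem_union] at hx ⊢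
        rcases hx with hx | ⟨y, hy, rfl⟩
        · exact hx.trans (Nat.le_self_pow (by norm_num) _)
        · refine (card_orb_mul (G := G) v y).trans ?_
          rw [pow_succ]
          exact Nat.mul_le_mul hv4 (by omega)
      have := Finset.card_le_card hsub
      rw [Finset.card_union_of_disjoint hdis,
        Finset.card_image_of_injective _ (mul_right_injective v)] at this
      linarith
  have h1 := key (2 * m) le_rfl
  have h2 : (Y ((2 * m) ^ (5 ^ (2 * m)))).card ≤ Fintype.card V := Finset.card_le_univ _
  have h3 : 0 < Fintype.card V := Fintype.card_pos
  have h4 : Fintype.card V ≤ 2 * m * (Y (2 * m)).card := h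
  have h5 : 0 < (Y (2 * m)).card := by
    rcases Nat.eq_zero_or_pos (Y (2 * m)).card with h0 | h0
    · rw [h0] at h4; omega
    · exact h0
  nlinarith

theorem exists_sub {m : ℕ} (hm : 0 < m) (h : ∀ g : G, Nat.card (del (V := V) g).range ≤ m) :
    ∃ B ≤ ((2 * m) ^ (5 ^ (2 * m))) ^ 2, ∃ V0 : Subgroup V,
      (∀ v, v ∈ V0 ↔ (orb G v).card ≤ B) ∧ V0.index ≤ 2 * m := by
  have hc := count hm h
  obtain ⟨b, hb, hb', hcl⟩ := exists_level hm hc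
  have hb0 : 0 < b := by omega
  let V0 : Subgroup V :=
    { carrier := {v | (orb G v).card ≤ b ^ 2}
      one_mem' := card_orb_one.trans (Nat.one_le_pow _ _ hb0)
      mul_mem' := by
        intro v w hv hw
        refine hcl _ ((card_orb_mul (G := G) v w).trans ?_)
        calc _ ≤ b ^ 2 * b ^ 2 := Nat.mul_le_mul hv hw
          _ = b ^ 4 := by ring
      inv_mem' := by
        intro v hv
        exact (card_orb_inv (G := G) v).trans hv }
  refine ⟨b ^ 2, Nat.pow_le_pow_left hb' 2, V0, fun v => Iff.rfl, ?_⟩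
  have hle : (univ.filter (fun v : V => (orb G v).card ≤ 2 * m)).card ≤ Nat.card V0 := by
    rw [Nat.card_eq_fintype_card, Fintype.card_subtype]
    refine Finset.card_le_card ?_
    intro v hv
    simp only [mem_filter, mem_univ, true_and] at hv ⊢
    exact hv.trans (hb.trans (Nat.le_self_pow (by norm_num) _))
  have h1 := V0.card_mul_index
  have h0 : 0 < Nat.card V0 := Nat.card_pos
  rw [Nat.card_eq_fintype_card (α := V)] at h1
  have : Nat.card V0 * V0.index ≤ Nat.card V0 * (2 * m) := by
    rw [h1]
    nlinarith
  exact Nat.le_of_mul_le_mul_left this h0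

theorem card_sup_le (H K : Subgroup V) : Nat.card ↥(H ⊔ K) ≤ Nat.card H * Nat.card K := by
  rw [← Nat.card_prod]
  refine Nat.card_le_card_of_surjective
    (fun p : H × K => (⟨p.1 * p.2, Subgroup.mul_mem_sup p.1.2 p.2.2⟩ : ↥(H ⊔ K))) ?_
  rintro ⟨x, hx⟩
  obtain ⟨y, hy, z, hz, rfl⟩ := Subgroup.mem_sup.1 hx
  exact ⟨(⟨y, hy⟩, ⟨z, hz⟩), rfl⟩

/-- The join of `[V, g]` for `g ∈ S`. -/
noncomputable def L (V : Type) {G : Type} [Group G] [CommGroup V]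
    [MulDistribMulAction G V] (S : Finset G) : Subgroup V :=
  S.sup (fun g => (del (V := V) g).range)

theorem mem_L {S : Finset G} {g : G} (hg : g ∈ S) (v : V) : del g v ∈ L V S :=
  (Finset.le_sup (f := fun g : G => (del (V := V) g).range) hg) ⟨v, rfl⟩

theorem card_L {m : ℕ} (h : ∀ g : G, Nat.card (del (V := V) g).range ≤ m) (S : Finset G) :
    Nat.card (L V S) ≤ m ^ S.card := by
  induction S using Finset.induction_on with
  | empty => simp [L]
  | insert a S ha ih =>
    rw [Finset.card_insert_of_notMem ha, pow_succ, L, Finset.sup_insert, mul_comm]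
    exact (card_sup_le _ _).trans (Nat.mul_le_mul (h a) ih)

theorem neumann {m B : ℕ} (hm : 0 < m) (h : ∀ g : G, Nat.card (del (V := V) g).range ≤ m)
    (V0 : Subgroup V) (hV0 : ∀ v, v ∈ V0 ↔ (orb G v).card ≤ B) :
    ∃ S : Finset G, S.card ≤ B + m ^ B * B ∧ ∀ v ∈ V0, ∀ g : G, del g v ∈ L V S := by
  obtain ⟨x, hx, hmax⟩ := Finset.exists_max_image (univ.filter (fun v : V => v ∈ V0))
    (fun v => (orb G v).card) ⟨1, by simp [V0.one_mem]⟩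
  simp only [mem_filter, mem_univ, true_and] at hx hmax
  obtain ⟨Sx, hSx, hSx'⟩ := orb_reps (G := G) x
  have hxB : Sx.card ≤ B := hSx ▸ (hV0 x).1 hx
  -- representatives of cosets
  obtain ⟨T, hTV, hT, hT'⟩ := exists_reps
    (fun v : V => (fun s : Sx => (⟨del s.1 v, ⟨v, rfl⟩⟩ : (del (V := V) s.1).range)))
    (univ.filter (fun v : V => v ∈ V0))
  have hTc : T.card ≤ m ^ B := by
    rw [hT]
    refine (Finset.card_le_univ _).trans ?_
    rw [Fintype.card_pi]
    calc _ ≤ ∏ s : Sx, m := Finset.prod_le_prod' fun s _ => by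
            rw [← Nat.card_eq_fintype_card]; exact h s.1
      _ = m ^ Sx.card := by simp
      _ ≤ m ^ B := Nat.pow_le_pow_right hm hxB
  choose R hR hR' using fun v : V => orb_reps (G := G) v
  refine ⟨Sx ∪ T.biUnion R, ?_, ?_⟩
  · refine (Finset.card_union_le _ _).trans (Nat.add_le_add hxB ?_)
    refine (Finset.card_biUnion_le_card_mul T R B ?_).trans (Nat.mul_le_mul_right _ hTc)
    intro t ht
    rw [hR]
    have := hTV ht
    simp only [mem_filter, mem_univ, true_and] at this
    exact (hV0 t).1 this
  set S := Sx ∪ T.biUnion R with hS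
  have hgx : ∀ g : G, del g x ∈ L V S := by
    intro g
    obtain ⟨s, hs, hsx⟩ := hSx' g
    have : del g x = del s x := by rw [del_apply, del_apply, hsx]
    rw [this]
    exact mem_L (Finset.mem_union_left _ hs) x
  have hgt : ∀ t ∈ T, ∀ g : G, del g t ∈ L V S := by
    intro t ht g
    obtain ⟨s, hs, hsx⟩ := hR' t g
    have : del g t = del s t := by rw [del_apply, del_apply, hsx]
    rw [this]
    exact mem_L (Finset.mem_union_right _ (Finset.mem_biUnion.2 ⟨t, ht, hs⟩)) t
  have hgc : ∀ c ∈ V0, (∀ s ∈ Sx, del s c = 1) → ∀ g : G, del g c ∈ L V S := by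
    intro c hc hcs g
    have hfix : ∀ s ∈ Sx, s • c = c := fun s hs => by rw [smul_eq, hcs s hs, mul_one]
    have hle := hmax (c * x) (V0.mul_mem hc hx)
    have hsub : (orb G x).image (fun y => c * y) ⊆ orb G (c * x) := by
      intro y hy
      simp only [orb, mem_image, mem_univ, true_and, exists_exists_eq_and] at hy ⊢
      obtain ⟨a, rfl⟩ := hy
      obtain ⟨s, hs, hsx⟩ := hSx' a
      exact ⟨s, by rw [smul_mul', hfix s hs, hsx]⟩
    have heq := Finset.eq_of_subset_of_card_le hsub
      (by rw [Finset.card_image_of_injective _ (mul_right_injective c)]; exact hle)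
    have hmem : g • (c * x) ∈ orb G (c * x) := by simp [orb]
    rw [← heq] at hmem
    simp only [orb, mem_image, mem_univ, true_and, exists_exists_eq_and] at hmem
    obtain ⟨a, ha⟩ := hmem
    have : del g c = del a x * (del g x)⁻¹ := by
      rw [smul_mul', smul_eq g c, smul_eq g x, smul_eq a x] at ha
      rw [eq_mul_inv_iff_mul_eq]
      have e : (c * x) * (del a x) = (c * x) * (del g c * del g x) := by
        rw [mul_assoc, ha]; exact mul_mul_mul_comm _ _ _ _
      exact (mul_left_cancel e).symm
    rw [this]
    exact (L V S).mul_mem (hgx a) ((L V S).inv_mem (hgx g))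
  intro v hv g
  obtain ⟨t, ht, hvt⟩ := hT' v (by simpa using hv)
  have htV : t ∈ V0 := by simpa using hTV ht
  have hc : v * t⁻¹ ∈ V0 := V0.mul_mem hv (V0.inv_mem htV)
  have h1 := hgc (v * t⁻¹) hc (by
    intro s hs
    have : del s t = del s v := congrArg Subtype.val (congrFun hvt ⟨s, hs⟩)
    rw [map_mul, map_inv, this, mul_inv_cancel]) g
  have h2 : del g v = del g (v * t⁻¹) * del g t := by rw [← map_mul]; simp
  rw [h2]
  exact (L V S).mul_mem h1 (hgt t ht g)

/-- Coprime trick. -/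
theorem coprime_trick (hco : Nat.Coprime (Fintype.card G) (Fintype.card V)) (K : Subgroup V)
    (g : G) (v : V) (hK : ∀ k ∈ K, g • k ∈ K) (hw : del g (del g v) ∈ K) : del g v ∈ K := by
  set w := del g v with hwdef
  have key : ∀ i : ℕ, ∃ k ∈ K, g ^ i • v = v * w ^ i * k := by
    intro i
    induction i with
    | zero => exact ⟨1, K.one_mem, by simp⟩
    | succ i ih =>
      obtain ⟨k, hk, e⟩ := ih
      refine ⟨(del g w) ^ i * g • k, K.mul_mem (K.pow_mem hw i) (hK k hk), ?_⟩
      rw [pow_succ', mul_smul, e, smul_mul', smul_mul', smul_pow', smul_eq g v, smul_eq g w,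
        ← hwdef, mul_pow, pow_succ']
      simp only [mul_assoc]
  obtain ⟨k, hk, e⟩ := key (Fintype.card G)
  rw [pow_card_eq_one, one_smul, mul_assoc] at e
  have e1 : w ^ Fintype.card G * k = 1 := by
    have : v * 1 = v * (w ^ Fintype.card G * k) := by rw [mul_one]; exact e
    exact (mul_left_cancel this).symm
  have e2 : w ^ Fintype.card G ∈ K := by
    rw [eq_inv_of_mul_eq_one_left e1]; exact K.inv_mem hk
  have hco' : (Nat.card V).Coprime (Fintype.card G) := by
    rw [Nat.card_eq_fintype_card]; exact hco.symm
  have e3 : (w ^ Fintype.card G) ^ (Nat.card V).gcdB (Fintype.card G) = w :=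
    (powCoprime (G := V) hco').symm_apply_apply w
  rw [← e3]
  exact K.zpow_mem e2 _

/-- The bound on the number of generators. -/
def bnd (m : ℕ) : ℕ :=
  let B := ((2 * m) ^ (5 ^ (2 * m))) ^ 2
  B + m ^ B * B + (2 * m) ^ (2 * m)

theorem main_bound {m : ℕ} (hm : 0 < m) (h : ∀ g : G, Nat.card (del (V := V) g).range ≤ m)
    (hco : Nat.Coprime (Fintype.card G) (Fintype.card V)) :
    ∃ W : Subgroup V, Nat.card W ≤ m ^ bnd m ∧ ∀ (g : G) (v : V), del g v ∈ W := by
  obtain ⟨B, hB, V0, hV0, hind⟩ := exists_sub hm h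
  obtain ⟨S, hS, hS'⟩ := neumann hm h V0 hV0
  have hinv : ∀ g : G, ∀ v ∈ V0, g • v ∈ V0 := by
    intro g v hv
    exact (hV0 _).2 ((card_orb_smul g v).trans ((hV0 v).1 hv))
  let f : G → (V ⧸ V0 → V ⧸ V0) := fun g q => QuotientGroup.mk (g • q.out)
  obtain ⟨T, _, hT, hT'⟩ := exists_reps f univ
  have hTc : T.card ≤ (2 * m) ^ (2 * m) := by
    rw [hT]
    refine (Finset.card_le_univ _).trans ?_
    rw [Fintype.card_fun]
    have : Fintype.card (V ⧸ V0) ≤ 2 * m := by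
      rw [← Nat.card_eq_fintype_card]; exact hind
    exact (Nat.pow_le_pow_left this _).trans (Nat.pow_le_pow_right (by omega) this)
  refine ⟨L V (S ∪ T), (card_L h _).trans (Nat.pow_le_pow_right hm ?_), ?_⟩
  · refine (Finset.card_union_le _ _).trans ?_
    refine Nat.add_le_add (hS.trans ?_) hTc
    exact Nat.add_le_add hB (Nat.mul_le_mul (Nat.pow_le_pow_right hm hB) hB)
  -- the subgroup generated by commutators with `V0`
  let K : Subgroup V := Subgroup.closure {x | ∃ v ∈ V0, ∃ g : G, x = del g v}
  have hKL : K ≤ L V (S ∪ T) := by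
    rw [Subgroup.closure_le]
    rintro x ⟨v, hv, g, rfl⟩
    exact (Finset.sup_mono (f := fun g : G => (del (V := V) g).range)
      (Finset.subset_union_left (s₁ := S) (s₂ := T))) (hS' v hv g)
  have hdV0 : ∀ v ∈ V0, ∀ g : G, del g v ∈ V0 := fun v hv g =>
    V0.mul_mem (V0.inv_mem hv) (hinv g v hv)
  have hKV : K ≤ V0 := by
    rw [Subgroup.closure_le]
    rintro x ⟨v, hv, g, rfl⟩
    exact hdV0 v hv g
  have hdK : ∀ v ∈ V0, ∀ g : G, del g v ∈ K := fun v hv g =>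
    Subgroup.subset_closure ⟨v, hv, g, rfl⟩
  have hKinv : ∀ g : G, ∀ k ∈ K, g • k ∈ K := by
    intro g k hk
    rw [smul_eq]
    exact K.mul_mem hk (hdK k (hKV hk) g)
  intro g v
  obtain ⟨t, ht, htg⟩ := hT' g (mem_univ g)
  have hmod : ∀ v : V, (t • v)⁻¹ * g • v ∈ V0 := by
    intro v
    have e := congrFun htg (QuotientGroup.mk v)
    simp only [f] at e
    rw [QuotientGroup.eq] at e
    set r := (QuotientGroup.mk v : V ⧸ V0).out with hr
    have hrv : r⁻¹ * v ∈ V0 := by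
      rw [← QuotientGroup.eq, hr]; simp
    have h1 := V0.mul_mem (V0.mul_mem e (hinv g _ hrv)) (V0.inv_mem (hinv t _ hrv))
    have : (t • r)⁻¹ * g • r * g • (r⁻¹ * v) * (t • (r⁻¹ * v))⁻¹ = (t • v)⁻¹ * g • v := by
      simp only [smul_mul', smul_inv', mul_inv, inv_inv]
      generalize t • r = a, g • r = b, g • v = c, t • v = d
      rw [mul_assoc a⁻¹ b, mul_inv_cancel_left, mul_assoc, mul_left_comm c a, inv_mul_cancel_left,
        mul_comm]
    rwa [this] at h1
  have hu : del (t⁻¹ * g) v ∈ V0 := by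
    have := hinv t⁻¹ _ (hmod v)
    rw [smul_mul', smul_inv', inv_smul_smul, ← mul_smul] at this
    exact this
  have hu' : del (t⁻¹ * g) v ∈ K :=
    coprime_trick hco K _ v (hKinv _) (hdK _ hu _)
  have : del g v = del (t⁻¹ * g) v * del t ((t⁻¹ * g) • v) := by
    simp only [del_apply, mul_smul, smul_inv_smul]
    rw [mul_assoc, mul_inv_cancel_left]
  rw [this]
  exact (L V (S ∪ T)).mul_mem (hKL hu') (mem_L (Finset.mem_union_right _ ht) _)

end CoprimeAux

theorem stmt13 :
    ∃ f : ℕ → ℕ, ∀ (V : Type) (_ : CommGroup V) (_ : Finite V)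
      (U : Subgroup (MulAut V)) (m : ℕ),
      Nat.Coprime (Nat.card U) (Nat.card V) → 0 < m →
      (∀ u ∈ U, Nat.card ↥(Subgroup.closure (Set.range fun v : V => v⁻¹ * u v)) ≤ m) →
      Nat.card ↥(Subgroup.closure {x : V | ∃ v : V, ∃ u ∈ U, x = v⁻¹ * u v}) ≤ f m ∧
        Nat.card U ≤ f m := by
  classical
  refine ⟨fun m => (m ^ CoprimeAux.bnd m) ^ (m ^ CoprimeAux.bnd m), ?_⟩
  intro V _ _ U m hco hm h
  have := Fintype.ofFinite V
  have : Finite (MulAut V) := Finite.of_injective (fun u : MulAut V => (u : V → V))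
    DFunLike.coe_injective
  have := Fintype.ofFinite U
  have hco' : Nat.Coprime (Fintype.card U) (Fintype.card V) := by
    rwa [Nat.card_eq_fintype_card, Nat.card_eq_fintype_card] at hco
  have h' : ∀ g : U, Nat.card (CoprimeAux.del (V := V) g).range ≤ m := by
    intro g
    have e : (CoprimeAux.del (V := V) g).range
        = Subgroup.closure (Set.range fun v : V => v⁻¹ * (g : MulAut V) v) := by
      rw [← Subgroup.closure_eq (CoprimeAux.del (V := V) g).range]
      congr 1
    rw [e]
    exact h g.1 g.2
  obtain ⟨W, hW, hW'⟩ := CoprimeAux.main_bound hm h' hco'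
  set F := m ^ CoprimeAux.bnd m with hF
  have hF0 : 0 < F := Nat.pow_pos hm
  set C := Subgroup.closure {x : V | ∃ v : V, ∃ u ∈ U, x = v⁻¹ * u v} with hC
  have hCW : C ≤ W := by
    rw [hC, Subgroup.closure_le]
    rintro x ⟨v, u, hu, rfl⟩
    exact hW' ⟨u, hu⟩ v
  constructor
  · exact (Nat.card_le_card_of_injective _ (Subgroup.inclusion_injective hCW)).trans
      (hW.trans (Nat.le_self_pow hF0.ne' F))
  · have hdC : ∀ (g : U) (v : V), CoprimeAux.del g v ∈ C := fun g v =>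
      Subgroup.subset_closure ⟨v, g.1, g.2, rfl⟩
    have hst : ∀ (g : U) (w : W), g • (w : V) ∈ W := by
      intro g w
      rw [CoprimeAux.smul_eq]
      exact W.mul_mem w.2 (hW' g w)
    let φ : U → (W → W) := fun g w => ⟨g • (w : V), hst g w⟩
    have hφ : Function.Injective φ := by
      intro a b hab
      have hab' : ∀ w ∈ W, (b⁻¹ * a) • w = w := by
        intro w hw
        have := congrArg Subtype.val (congrFun hab ⟨w, hw⟩)
        simp only [φ] at this
        rw [mul_smul, this, inv_smul_smul]
      have h1 : ∀ v : V, CoprimeAux.del (b⁻¹ * a) v = 1 := by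
        intro v
        have := CoprimeAux.coprime_trick hco' ⊥ (b⁻¹ * a) v
          (by intro k hk; rw [Subgroup.mem_bot] at hk ⊢; rw [hk, smul_one])
          (by rw [Subgroup.mem_bot, CoprimeAux.del_apply, hab' _ (hW' _ v), inv_mul_cancel])
        simpa using this
      have h2 : b⁻¹ * a = 1 := by
        apply Subtype.ext
        apply MulEquiv.ext
        intro v
        have := CoprimeAux.smul_eq (b⁻¹ * a) v
        rw [h1, mul_one] at this
        exact this
      exact (inv_mul_eq_one.1 h2).symm
    have := Nat.card_le_card_of_injective φ hφ
    rw [Nat.card_fun] at this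
    exact this.trans ((Nat.pow_le_pow_left hW _).trans (Nat.pow_le_pow_right hF0 hW))
end
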